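/- arXiv:2104.11204 — 3 statements merged into one kernel-verified Lean document; each statement's English description precedes it below -/
import Mathlib

section
/- Let d ≥ 3. For Lebesgue-almost every β ∈ (ℝ⁺)^d there exists a constant C_β such that for every R ≥ 1, the number of triples (X,Y,Z) ∈ (ℤ^d)³ with |X|,|Y|,|Z| ≤ R, X ≠ 0 and max(|⟨X,Y⟩_β|, |⟨X,Z⟩_β|) ≤ 1 is at most C_β R^{3d−4+1/6}. -/
open MeasureTheory

namespace WKE

/-- The Euclidean norm of a vector in `ℝ^d`. -/
noncomputable def euclNorm {d : ℕ} (x : Fin d → ℝ) : ℝ := Real.sqrt (∑ j, x j ^ 2)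

/-- `x ∈ Z_L^d = (L⁻¹ℤ)^d`. -/
def isLatticeVec (d : ℕ) (L : ℝ) (x : Fin d → ℝ) : Prop := ∀ j, ∃ m : ℤ, x j = m / L

/-- The weighted square norm `|x|_β² = ∑ j, β j * (x j)²`. -/
noncomputable def wnormSq {d : ℕ} (β x : Fin d → ℝ) : ℝ := ∑ j, β j * x j ^ 2

/-- The weighted inner product `⟨x, y⟩_β = ∑ j, β j * x j * y j`. -/
noncomputable def winner {d : ℕ} (β x y : Fin d → ℝ) : ℝ := ∑ j, β j * x j * y j

/-- The set of integer triples `(X, Y, Z)` with `|X|, |Y|, |Z| ≤ R`, `X ≠ 0` and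
`max(|⟨X,Y⟩_β|, |⟨X,Z⟩_β|) ≤ 1`. -/
def latticeTriples (d : ℕ) (β : Fin d → ℝ) (R : ℝ) :
    Set ((Fin d → ℤ) × (Fin d → ℤ) × (Fin d → ℤ)) :=
  {T | euclNorm (fun j => (T.1 j : ℝ)) ≤ R ∧ euclNorm (fun j => (T.2.1 j : ℝ)) ≤ R ∧
    euclNorm (fun j => (T.2.2 j : ℝ)) ≤ R ∧ T.1 ≠ 0 ∧
    max |winner β (fun j => (T.1 j : ℝ)) (fun j => (T.2.1 j : ℝ))|
        |winner β (fun j => (T.1 j : ℝ)) (fun j => (T.2.2 j : ℝ))| ≤ 1}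

/-- Volume of a slab intersection, via a linear change of variables. -/
lemma vol_two {d : ℕ} (M : ℝ) (hM : 1 ≤ M) (u v : Fin d → ℝ) (i j : Fin d) (hij : i ≠ j)
    (hD : u i * v j - u j * v i ≠ 0) :
    volume {β : Fin d → ℝ | (∀ k, 0 ≤ β k ∧ β k ≤ M) ∧ |∑ k, β k * u k| ≤ 1 ∧
      |∑ k, β k * v k| ≤ 1} ≤ ENNReal.ofReal (4 * M ^ d * |u i * v j - u j * v i|⁻¹) := by
  classical
  set P : Matrix (Fin d) (Fin 2) ℝ :=
    Matrix.of fun k c => (![Pi.single i (1:ℝ), Pi.single j (1:ℝ)] : Fin 2 → Fin d → ℝ) c k with hP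
  set Q : Matrix (Fin 2) (Fin d) ℝ :=
    Matrix.of ![u - Pi.single i (1:ℝ), v - Pi.single j (1:ℝ)] with hQ
  have hdet : (1 + P * Q).det = u i * v j - u j * v i := by
    rw [Matrix.det_one_add_mul_comm, Matrix.det_fin_two]
    simp only [Matrix.add_apply, Matrix.mul_apply, hP, hQ, Matrix.of_apply, Matrix.cons_val_zero,
      Matrix.cons_val_one, Pi.sub_apply, Pi.single_apply, mul_ite, mul_one, mul_zero,
      Finset.sum_ite_eq', Finset.mem_univ, if_true]
    simp [hij, hij.symm]
  have hA : ∀ β : Fin d → ℝ, ∀ k, (Matrix.toLin' (1 + P * Q) β) k =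
      if k = i then ∑ k, β k * u k else if k = j then ∑ k, β k * v k else β k := by
    intro β k
    rw [Matrix.toLin'_apply, Matrix.add_mulVec, Matrix.one_mulVec, ← Matrix.mulVec_mulVec]
    simp only [Pi.add_apply, Matrix.mulVec, dotProduct, Fin.sum_univ_two, hP, hQ, Matrix.of_apply,
      Matrix.cons_val_zero, Matrix.cons_val_one, Pi.sub_apply, sub_mul, Finset.sum_sub_distrib,
      Pi.single_apply, ite_mul, one_mul, zero_mul, Finset.sum_ite_eq', Finset.mem_univ, if_true]
    simp only [mul_comm (β _)]
    by_cases h1 : k = i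
    · subst h1; simp [hij]
    · by_cases h2 : k = j
      · subst h2; simp [h1]
      · simp [h1, h2]
  set box : Set (Fin d → ℝ) := Set.univ.pi fun k =>
    if k = i ∨ k = j then Set.Icc (-1) 1 else Set.Icc 0 M with hbox
  have hsub : {β : Fin d → ℝ | (∀ k, 0 ≤ β k ∧ β k ≤ M) ∧ |∑ k, β k * u k| ≤ 1 ∧
      |∑ k, β k * v k| ≤ 1} ⊆ (Matrix.toLin' (1 + P * Q)) ⁻¹' box := by
    rintro β ⟨h0, h1, h2⟩
    rw [Set.mem_preimage, hbox, Set.mem_univ_pi]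
    intro k
    rw [hA]
    rw [abs_le] at h1 h2
    by_cases hk : k = i
    · simp only [hk, true_or, if_true]; exact h1
    · by_cases hk2 : k = j
      · simp only [hk2, or_true, if_true, hij.symm, if_false]; exact h2
      · simp only [hk, hk2, or_self, if_false]; exact h0 k
  refine (measure_mono hsub).trans ?_
  rw [MeasureTheory.Measure.addHaar_preimage_linearMap _ (by rwa [LinearMap.det_toLin', hdet]),
    LinearMap.det_toLin', hdet, mul_comm, abs_inv, ENNReal.ofReal_mul (by positivity)]
  gcongr
  rw [hbox, volume_pi_pi]
  have : ∀ k, volume (if k = i ∨ k = j then Set.Icc (-1:ℝ) 1 else Set.Icc 0 M) =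
      ENNReal.ofReal (if k = i ∨ k = j then 2 else M) := by
    intro k
    split_ifs <;> simp
    norm_num
  simp_rw [this]
  rw [← ENNReal.ofReal_prod_of_nonneg (by intro k _; split_ifs <;> linarith)]
  apply ENNReal.ofReal_le_ofReal
  calc ∏ k, (if k = i ∨ k = j then 2 else M) 
      ≤ ∏ k, ((if k = i then 2 else 1) * (if k = j then 2 else 1) * M) := by
        apply Finset.prod_le_prod
        · intro k _; split_ifs <;> linarith
        · intro k _
          by_cases h1 : k = i <;> by_cases h2 : k = j <;> simp [h1, h2] <;> 
          first | linarith | (split_ifs <;> linarith)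
    _ = 4 * M ^ d := by
        rw [Finset.prod_mul_distrib, Finset.prod_mul_distrib]
        simp
        norm_num

/-- Sum of the reciprocals. -/
noncomputable def hs (N : ℕ) : ℝ := ∑ n ∈ Finset.Icc (-(N:ℤ)) N, |(n:ℝ)|⁻¹

lemma hs_nonneg (N : ℕ) : 0 ≤ hs N := Finset.sum_nonneg fun _ _ => by positivity

lemma hs_mono {N N' : ℕ} (h : N ≤ N') : hs N ≤ hs N' := by
  apply Finset.sum_le_sum_of_subset_of_nonneg
  · apply Finset.Icc_subset_Icc <;> omega
  · intros; positivity

lemma hs_eq (N : ℕ) : hs N = 2 * (harmonic N : ℝ) := by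
  induction N with
  | zero => simp [hs]
  | succ n ih =>
    have : Finset.Icc (-((n+1:ℕ):ℤ)) ((n+1:ℕ):ℤ) = insert (-((n+1:ℕ):ℤ)) (insert ((n+1:ℕ):ℤ) (Finset.Icc (-(n:ℤ)) n)) := by
      ext x; simp only [Finset.mem_Icc, Finset.mem_insert]; omega
    rw [hs, this, Finset.sum_insert, Finset.sum_insert, ← hs, ih, harmonic_succ]
    · push_cast
      rw [abs_neg, abs_of_nonneg (by positivity)]
      ring
    · simp
    · simp only [Finset.mem_insert, Finset.mem_Icc]; omega

lemma hs_le (k : ℕ) : hs (2 * (2 ^ k) ^ 2) ≤ 4 * (k + 1) := by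
  rw [hs_eq]
  have := harmonic_le_one_add_log (2 * (2 ^ k) ^ 2)
  have h2 : Real.log ((2 * (2 ^ k) ^ 2 : ℕ) : ℝ) = (2 * k + 1) * Real.log 2 := by
    push_cast
    rw [show (2 * (2 ^ k) ^ 2 : ℝ) = 2 ^ (2 * k + 1) by ring, Real.log_pow]
    push_cast; ring
  rw [h2] at this
  have h3 := Real.log_two_lt_d9
  nlinarith

lemma one_le_hs {N : ℕ} (hN : 1 ≤ N) : 1 ≤ hs N := by
  refine le_trans ?_ (hs_mono hN)
  rw [hs_eq]; simp

lemma energy_le (N : ℕ) :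
    ((((Finset.Icc (-(N:ℤ)) N ×ˢ Finset.Icc (-(N:ℤ)) N) ×ˢ
      (Finset.Icc (-(N:ℤ)) N ×ˢ Finset.Icc (-(N:ℤ)) N)).filter
      fun q => q.1.1 * q.1.2 = q.2.1 * q.2.2).card : ℝ) ≤ 
      (2 * (2 * N + 1)) ^ 2 + N ^ 2 * hs N ^ 4 := by
  classical
  set I := Finset.Icc (-(N:ℤ)) N with hI
  have hcI : I.card = 2 * N + 1 := by rw [hI, Int.card_Icc]; omega
  set Z : Finset (ℤ × ℤ) := ({0} ×ˢ I) ∪ (I ×ˢ {0}) with hZ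
  have hZc : Z.card ≤ 2 * (2 * N + 1) := by
    refine (Finset.card_union_le _ _).trans ?_
    simp [hcI]; omega
  set U := ((I ×ˢ I) ×ˢ (I ×ˢ I)).filter fun q : (ℤ × ℤ) × (ℤ × ℤ) =>
    q.1.1 * q.1.2 * (q.2.1 * q.2.2) ≠ 0 ∧ |q.1.1 * q.1.2 * (q.2.1 * q.2.2)| ≤ (N:ℤ) ^ 2 with hU
  have hUc : (U.card : ℝ) ≤ N ^ 2 * hs N ^ 4 := by
    have h1 : (U.card : ℝ) ≤ ∑ q ∈ U, (N:ℝ) ^ 2 * ((|(q.1.1:ℝ)|⁻¹ * |(q.1.2:ℝ)|⁻¹) * (|(q.2.1:ℝ)|⁻¹ * |(q.2.2:ℝ)|⁻¹)) := by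
      rw [Finset.card_eq_sum_ones]
      push_cast
      apply Finset.sum_le_sum
      intro q hq
      rw [hU, Finset.mem_filter] at hq
      have h2 : |(q.1.1 * q.1.2 * (q.2.1 * q.2.2) : ℝ)| ≤ (N:ℝ) ^ 2 := by exact_mod_cast hq.2.2
      have h3 : (q.1.1 * q.1.2 * (q.2.1 * q.2.2) : ℝ) ≠ 0 := by exact_mod_cast hq.2.1
      rw [← mul_inv, ← mul_inv, ← mul_inv, ← abs_mul, ← abs_mul, ← abs_mul, ← div_eq_mul_inv,
        le_div_iff₀ (abs_pos.mpr h3), one_mul]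
      exact h2
    refine h1.trans ?_
    refine (Finset.sum_le_sum_of_subset_of_nonneg (Finset.filter_subset _ _)
      (fun _ _ _ => by positivity)).trans (le_of_eq ?_)
    rw [← Finset.mul_sum]
    congr 1
    have hpr : ∀ g : ℤ → ℝ, ∑ q ∈ I ×ˢ I, g q.1 * g q.2 = (∑ n ∈ I, g n) * ∑ n ∈ I, g n :=
      fun g => by rw [Finset.sum_product, Finset.sum_mul_sum]
    rw [Finset.sum_product]
    dsimp only
    rw [← Finset.sum_mul_sum, hpr (fun n => |(n:ℝ)|⁻¹)]
    simp only [hs]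
    ring
  have hsub : (((I ×ˢ I) ×ˢ (I ×ˢ I)).filter fun q : (ℤ × ℤ) × (ℤ × ℤ) => q.1.1 * q.1.2 = q.2.1 * q.2.2) ⊆
      (Z ×ˢ Z) ∪ U.image fun q => ((q.1.1 * q.1.2, q.2.1 * q.2.2), (q.1.1 * q.2.1, q.1.2 * q.2.2)) := by
    rintro ⟨⟨a, b⟩, ⟨c, e⟩⟩ hq
    simp only [Finset.mem_filter, Finset.mem_product] at hq
    obtain ⟨⟨⟨ha, hb⟩, hc, he⟩, h⟩ := hq
    rw [Finset.mem_union]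
    by_cases h0 : a * b = 0
    · left
      have h0' : c * e = 0 := by rw [← h, h0]
      simp only [hZ, Finset.mem_product, Finset.mem_union, Finset.mem_singleton]
      rcases mul_eq_zero.mp h0 with h1 | h1 <;> rcases mul_eq_zero.mp h0' with h2 | h2 <;> tauto
    · right
      obtain ⟨x, y, ⟨c', rfl⟩, ⟨e', rfl⟩, rfl⟩ := exists_dvd_and_dvd_of_dvd_mul (Dvd.intro b h)
      have hxy : x * y ≠ 0 := left_ne_zero_of_mul h0
      have hb' : b = c' * e' := by
        apply mul_left_cancel₀ hxy; rw [h]; ring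
      subst hb'
      have hx : x ≠ 0 := left_ne_zero_of_mul hxy
      have hy : y ≠ 0 := right_ne_zero_of_mul hxy
      have hce := right_ne_zero_of_mul h0
      have hc' : c' ≠ 0 := left_ne_zero_of_mul hce
      have he' : e' ≠ 0 := right_ne_zero_of_mul hce
      rw [hI, Finset.mem_Icc, ← abs_le] at ha hb hc he
      have hl : ∀ s t : ℤ, s ≠ 0 → |t * s| ≤ N → |t| ≤ N := by
        intro s t hs ht
        rw [abs_mul] at ht
        have : 1 ≤ |s| := Int.one_le_abs hs
        nlinarith [abs_nonneg t]
      rw [Finset.mem_image]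
      refine ⟨((x, y), (c', e')), ?_, rfl⟩
      simp only [hU, Finset.mem_filter, Finset.mem_product, hI, Finset.mem_Icc, ← abs_le]
      refine ⟨⟨⟨hl y x hy ha, hl x y hx (by rwa [mul_comm])⟩, hl e' c' he' hb, 
        hl c' e' hc' (by rwa [mul_comm])⟩, h0, ?_⟩
      rw [abs_mul, sq]
      exact mul_le_mul ha hb (abs_nonneg _) (by positivity)
  have := (Finset.card_le_card hsub).trans ((Finset.card_union_le _ _).trans 
    (Nat.add_le_add_left Finset.card_image_le _))
  rw [Finset.card_product] at this
  have h5 : ((((I ×ˢ I) ×ˢ (I ×ˢ I)).filter fun q : (ℤ × ℤ) × (ℤ × ℤ) => q.1.1 * q.1.2 = q.2.1 * q.2.2).card : ℝ) ≤ Z.card * Z.card + U.card := by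
    exact_mod_cast this
  have h6 : (Z.card : ℝ) ≤ 2 * (2 * N + 1) := by exact_mod_cast hZc
  refine h5.trans ?_
  rw [sq (2 * (2 * (N:ℝ) + 1))]
  gcongr

lemma quad_le (N : ℕ) :
    ∑ s ∈ Finset.Icc (-(N:ℤ)) N ×ˢ Finset.Icc (-(N:ℤ)) N,
      ∑ t ∈ Finset.Icc (-(N:ℤ)) N ×ˢ Finset.Icc (-(N:ℤ)) N,
        |((s.1 * s.2 - t.1 * t.2 : ℤ) : ℝ)|⁻¹ ≤ 
      ((2 * (2 * N + 1)) ^ 2 + N ^ 2 * hs N ^ 4) * hs (2 * N ^ 2) := by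
  classical
  set I := Finset.Icc (-(N:ℤ)) N with hI
  set J := Finset.Icc (-(N ^ 2:ℤ)) (N ^ 2) with hJ
  set S := I ×ˢ I with hS
  set f : ℤ × ℤ → ℤ := fun s => s.1 * s.2 with hf
  have hmap : ∀ s ∈ S, f s ∈ J := by
    intro s hs
    simp only [hS, Finset.mem_product, hI, Finset.mem_Icc, ← abs_le] at hs
    simp only [hJ, Finset.mem_Icc, ← abs_le, hf]
    rw [abs_mul, sq]
    exact mul_le_mul hs.1 hs.2 (abs_nonneg _) (by positivity)
  set r : ℤ → ℝ := fun n => ((S.filter fun s => f s = n).card : ℝ) with hr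
  have hsum : ∀ F : ℤ → ℝ, ∑ s ∈ S, F (f s) = ∑ n ∈ J, r n * F n := by
    intro F
    rw [← Finset.sum_fiberwise_of_maps_to hmap]
    apply Finset.sum_congr rfl
    intro n _
    rw [Finset.sum_congr rfl (g := fun _ => F n), Finset.sum_const, nsmul_eq_mul]
    intro s hs
    rw [(Finset.mem_filter.mp hs).2]
  have hE : ∑ n ∈ J, r n * r n ≤ (2 * (2 * N + 1)) ^ 2 + N ^ 2 * hs N ^ 4 := by
    refine le_trans (le_of_eq ?_) (energy_le N)
    rw [← hsum r, Finset.card_filter]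
    push_cast
    conv_rhs => rw [Finset.sum_product]
    apply Finset.sum_congr rfl
    intro s _
    simp only [hr, hf]
    rw [Finset.card_filter]
    push_cast
    apply Finset.sum_congr rfl
    intro t _
    simp only [eq_comm]
  have hk : ∀ n ∈ J, ∑ m ∈ J, |((n - m : ℤ) : ℝ)|⁻¹ ≤ hs (2 * N ^ 2) := by
    intro n hn
    rw [hs]
    rw [← Finset.sum_image (f := fun k : ℤ => |(k:ℝ)|⁻¹) (g := fun m => n - m) (by intro a _ b _ h; simpa using h)]
    apply Finset.sum_le_sum_of_subset_of_nonneg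
    · intro k hk
      obtain ⟨m, hm, rfl⟩ := Finset.mem_image.mp hk
      rw [hJ, Finset.mem_Icc] at hn hm
      rw [Finset.mem_Icc]
      push_cast
      constructor <;> linarith [hn.1, hn.2, hm.1, hm.2]
    · intros; positivity
  calc ∑ s ∈ S, ∑ t ∈ S, |((f s - f t : ℤ) : ℝ)|⁻¹ 
      = ∑ n ∈ J, r n * ∑ m ∈ J, r m * |((n - m : ℤ) : ℝ)|⁻¹ := by
        rw [← hsum (fun n => ∑ m ∈ J, r m * |((n - m : ℤ) : ℝ)|⁻¹)]
        apply Finset.sum_congr rfl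
        intro s _
        rw [← hsum (fun m => |((f s - m : ℤ) : ℝ)|⁻¹)]
    _ ≤ ∑ n ∈ J, ∑ m ∈ J, (r n * r n * |((n - m : ℤ) : ℝ)|⁻¹ / 2 + r m * r m * |((m - n : ℤ) : ℝ)|⁻¹ / 2) := by
        apply Finset.sum_le_sum
        intro n _
        rw [Finset.mul_sum]
        apply Finset.sum_le_sum
        intro m _
        have : |((m - n : ℤ) : ℝ)|⁻¹ = |((n - m : ℤ) : ℝ)|⁻¹ := by
          push_cast; rw [abs_sub_comm]
        rw [this]
        have h0 : 0 ≤ |((n - m : ℤ) : ℝ)|⁻¹ := by positivity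
        nlinarith [mul_nonneg (sq_nonneg (r n - r m)) h0]
    _ = ∑ n ∈ J, r n * r n * ∑ m ∈ J, |((n - m : ℤ) : ℝ)|⁻¹ := by
        simp_rw [Finset.sum_add_distrib]
        rw [Finset.sum_comm (f := fun n m => r m * r m * |((m - n : ℤ) : ℝ)|⁻¹ / 2), ← Finset.sum_add_distrib]
        apply Finset.sum_congr rfl
        intro n _
        rw [← Finset.sum_add_distrib, Finset.mul_sum]
        apply Finset.sum_congr rfl
        intro m _
        ring
    _ ≤ ∑ n ∈ J, r n * r n * hs (2 * N ^ 2) := by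
        apply Finset.sum_le_sum
        intro n hn
        exact mul_le_mul_of_nonneg_left (hk n hn) (mul_self_nonneg _)
    _ ≤ _ := by
        rw [← Finset.sum_mul]
        exact mul_le_mul_of_nonneg_right hE (hs_nonneg _)

/-- The box of integer triples. -/
noncomputable def Bx (N : ℕ) : Finset (ℤ × ℤ × ℤ) :=
  Finset.Icc (-(N:ℤ)) N ×ˢ (Finset.Icc (-(N:ℤ)) N ×ˢ Finset.Icc (-(N:ℤ)) N)

lemma card_I (N : ℕ) : (Finset.Icc (-(N:ℤ)) N).card = 2 * N + 1 := by
  rw [Int.card_Icc]; omega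

lemma card_Bx (N : ℕ) : (Bx N).card = (2 * N + 1) ^ 3 := by
  rw [Bx, Finset.card_product, Finset.card_product, card_I]; ring

lemma sum_fiber {T : Type*} [DecidableEq T] {d : ℕ} (i : Fin d) (B : Finset T) (w : T → ℝ)
    (hw : ∀ a, 0 ≤ w a) (A : T → Finset T) (c : ℕ) 
    (hc : ∀ a ∈ B, w a ≠ 0 → (A a).card ≤ c) :
    ∑ p ∈ Fintype.piFinset (fun _ : Fin d => B), 
      (if ∀ j, j ≠ i → p j ∈ A (p i) then w (p i) else 0) ≤ (c:ℝ) ^ (d - 1) * ∑ a ∈ B, w a := by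
  classical
  rw [← Finset.sum_fiberwise_of_maps_to (g := fun p : Fin d → T => p i) (t := B)
    (fun p hp => Fintype.mem_piFinset.mp hp i), Finset.mul_sum]
  apply Finset.sum_le_sum
  intro a ha
  rw [← Finset.sum_filter, Finset.filter_filter]
  rw [Finset.sum_congr rfl (g := fun _ => w a) (by
    intro p hp; rw [(Finset.mem_filter.mp hp).2.1]), Finset.sum_const, nsmul_eq_mul]
  by_cases h0 : w a = 0
  · simp [h0]
  apply mul_le_mul_of_nonneg_right _ (hw a)
  have hsub : (Fintype.piFinset (fun _ : Fin d => B)).filter 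
      (fun p => p i = a ∧ ∀ j, j ≠ i → p j ∈ A (p i)) ⊆
      Fintype.piFinset (fun j : Fin d => if j = i then {a} else A a) := by
    intro p hp
    obtain ⟨_, h1, h2⟩ := Finset.mem_filter.mp hp
    rw [Fintype.mem_piFinset]
    intro j
    by_cases hj : j = i
    · simp [hj, h1]
    · simp only [hj, if_false]; rw [← h1]; exact h2 j hj
  have := Finset.card_le_card hsub
  rw [Fintype.card_piFinset, ← Finset.mul_prod_erase _ _ (Finset.mem_univ i)] at this
  rw [Finset.prod_congr rfl (g := fun _ => (A a).card) (by
    intro j hj; rw [if_neg (Finset.ne_of_mem_erase hj)])] at this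
  simp only [if_true, Finset.card_singleton, one_mul, Finset.prod_const, 
    Finset.card_erase_of_mem (Finset.mem_univ i), Finset.card_univ, Fintype.card_fin] at this
  exact_mod_cast this.trans (Nat.pow_le_pow_left (hc a ha h0) _)

lemma sum_pair {T : Type*} [DecidableEq T] {d : ℕ} (i j : Fin d) (hij : i ≠ j) (B : Finset T) 
    (F : T → T → ℝ) (hF : ∀ a b, 0 ≤ F a b) :
    ∑ p ∈ Fintype.piFinset (fun _ : Fin d => B), F (p i) (p j) ≤ 
      (B.card:ℝ) ^ (d - 2) * ∑ a ∈ B, ∑ b ∈ B, F a b := by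
  classical
  rw [← Finset.sum_product' (f := F), 
    ← Finset.sum_fiberwise_of_maps_to (g := fun p : Fin d → T => (p i, p j)) (t := B ×ˢ B)
    (fun p hp => Finset.mem_product.mpr ⟨Fintype.mem_piFinset.mp hp i, 
      Fintype.mem_piFinset.mp hp j⟩), Finset.mul_sum]
  apply Finset.sum_le_sum
  rintro ⟨a, b⟩ ha
  rw [Finset.sum_congr rfl (g := fun _ => F a b) (by
    intro p hp
    have := (Finset.mem_filter.mp hp).2
    rw [Prod.mk.injEq] at this
    rw [this.1, this.2]), Finset.sum_const, nsmul_eq_mul]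
  apply mul_le_mul_of_nonneg_right _ (hF a b)
  have hsub : (Fintype.piFinset (fun _ : Fin d => B)).filter 
      (fun p => (p i, p j) = (a, b)) ⊆
      Fintype.piFinset (fun k : Fin d => if k = i then {a} else if k = j then {b} else B) := by
    intro p hp
    obtain ⟨h0, h1⟩ := Finset.mem_filter.mp hp
    rw [Prod.mk.injEq] at h1
    rw [Fintype.mem_piFinset] at h0 ⊢
    intro k
    by_cases hk : k = i
    · simp [hk, h1]
    · by_cases hk' : k = j
      · simp [hk', h1, hij.symm]
      · simp only [hk, hk', if_false]; exact h0 k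
  have := Finset.card_le_card hsub
  have hj : j ∈ Finset.univ.erase i := Finset.mem_erase.mpr ⟨hij.symm, Finset.mem_univ _⟩
  rw [Fintype.card_piFinset, ← Finset.mul_prod_erase _ _ (Finset.mem_univ i),
    ← Finset.mul_prod_erase _ _ hj] at this
  rw [Finset.prod_congr rfl (g := fun _ => B.card) (by
    intro k hk
    have h1 := Finset.mem_erase.mp hk
    rw [if_neg (Finset.ne_of_mem_erase h1.2), if_neg h1.1])] at this
  simp only [if_true, if_neg hij.symm, Finset.card_singleton, one_mul, Finset.prod_const, 
    Finset.card_erase_of_mem hj,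
    Finset.card_erase_of_mem (Finset.mem_univ i), Finset.card_univ, Fintype.card_fin] at this
  rw [Nat.sub_sub] at this
  exact_mod_cast this

/-- Two-coordinate weight. -/
noncomputable def F2 (a b : ℤ × ℤ × ℤ) : ℝ :=
  |(a.1:ℝ)|⁻¹ * |(b.1:ℝ)|⁻¹ * |((a.2.1 * b.2.2 - b.2.1 * a.2.2 : ℤ) : ℝ)|⁻¹

/-- One-coordinate weight. -/
noncomputable def w1 (a : ℤ × ℤ × ℤ) : ℝ :=
  |(a.1:ℝ)|⁻¹ * |(a.2.1:ℝ)|⁻¹ + |(a.1:ℝ)|⁻¹ * |(a.2.2:ℝ)|⁻¹ + 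
    (if a.2.1 = 0 ∧ a.2.2 = 0 then 1 else 0)

/-- Admissible other coordinates in the degenerate case. -/
noncomputable def adm (N : ℕ) (a : ℤ × ℤ × ℤ) : Finset (ℤ × ℤ × ℤ) :=
  (Bx N).filter fun b => b.1 = 0 ∨ 
    (if a.2.1 = 0 ∧ a.2.2 = 0 then b.2.1 = 0 ∧ b.2.2 = 0 else a.2.1 * b.2.2 = a.2.2 * b.2.1)

lemma F2_nonneg (a b) : 0 ≤ F2 a b := by unfold F2; positivity

lemma w1_nonneg (a) : 0 ≤ w1 a := by unfold w1; positivity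

lemma card_adm (N : ℕ) (a : ℤ × ℤ × ℤ) : (adm N a).card ≤ 2 * (2 * N + 1) ^ 2 := by
  classical
  set I := Finset.Icc (-(N:ℤ)) N with hI
  have hc : (I ×ˢ I).card = (2 * N + 1) ^ 2 := by rw [Finset.card_product, card_I]; ring
  rw [adm, Finset.filter_or, two_mul, ← hc]
  refine (Finset.card_union_le _ _).trans (Nat.add_le_add ?_ ?_)
  · apply Finset.card_le_card_of_injOn (fun b => b.2)
    · rintro ⟨x, y, z⟩ hb
      simp only [Bx, Finset.coe_filter, Finset.mem_product, Set.mem_ofPred_eq] at hb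
      simp [hI] at hb ⊢; tauto
    · rintro ⟨x, y, z⟩ hb ⟨x', y', z'⟩ hb' h
      simp only [Finset.coe_filter, Set.mem_ofPred_eq] at hb hb'
      simp_all
  · by_cases h1 : a.2.1 = 0
    · apply Finset.card_le_card_of_injOn (fun b => (b.1, b.2.2))
      · rintro ⟨x, y, z⟩ hb
        simp only [Bx, Finset.coe_filter, Finset.mem_product, Set.mem_ofPred_eq] at hb
        simp [hI] at hb ⊢; tauto
      · rintro ⟨x, y, z⟩ hb ⟨x', y', z'⟩ hb' h
        simp only [Finset.coe_filter, Set.mem_ofPred_eq, h1, true_and] at hb hb'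
        simp only [Prod.mk.injEq] at h
        by_cases h2 : a.2.2 = 0
        · simp_all
        · simp only [h2, if_false, zero_mul, zero_eq_mul, false_or] at hb hb'
          simp [h, hb.2, hb'.2]
    · apply Finset.card_le_card_of_injOn (fun b => (b.1, b.2.1))
      · rintro ⟨x, y, z⟩ hb
        simp only [Bx, Finset.coe_filter, Finset.mem_product, Set.mem_ofPred_eq] at hb
        simp [hI] at hb ⊢; tauto
      · rintro ⟨x, y, z⟩ hb ⟨x', y', z'⟩ hb' h
        simp only [Finset.coe_filter, Set.mem_ofPred_eq, h1, false_and, if_false] at hb hb'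
        simp only [Prod.mk.injEq] at h
        have : z = z' := by
          apply mul_left_cancel₀ h1; rw [hb.2, hb'.2, h.2]
        simp [h, this]

lemma sum_w1 {N : ℕ} (hN : 1 ≤ N) : ∑ a ∈ Bx N, w1 a ≤ 3 * (2 * N + 1) * hs N ^ 2 := by
  have hh := one_le_hs hN
  have hc : (((Finset.Icc (-(N:ℤ)) N).card : ℕ) : ℝ) = 2 * N + 1 := by rw [card_I]; push_cast; ring
  unfold w1
  rw [Finset.sum_add_distrib, Finset.sum_add_distrib, Bx]
  have e1 : ∑ a ∈ Finset.Icc (-(N:ℤ)) N ×ˢ (Finset.Icc (-(N:ℤ)) N ×ˢ Finset.Icc (-(N:ℤ)) N),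
      |(a.1:ℝ)|⁻¹ * |(a.2.1:ℝ)|⁻¹ = (2 * N + 1) * hs N ^ 2 := by
    simp_rw [Finset.sum_product, Finset.sum_const, nsmul_eq_mul, hc, ← Finset.mul_sum]
    rw [← Finset.sum_mul, ← hs]; ring
  have e2 : ∑ a ∈ Finset.Icc (-(N:ℤ)) N ×ˢ (Finset.Icc (-(N:ℤ)) N ×ˢ Finset.Icc (-(N:ℤ)) N),
      |(a.1:ℝ)|⁻¹ * |(a.2.2:ℝ)|⁻¹ = (2 * N + 1) * hs N ^ 2 := by
    simp only [Finset.sum_product]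
    calc _ = ∑ x ∈ Finset.Icc (-(N:ℤ)) N, |(x:ℝ)|⁻¹ * ((2 * N + 1) * hs N) := by
          apply Finset.sum_congr rfl
          intro x _
          rw [Finset.sum_const, nsmul_eq_mul, hc, hs, ← Finset.mul_sum]
          ring
      _ = _ := by rw [← Finset.sum_mul, ← hs]; ring
  have e3 : ∑ a ∈ Finset.Icc (-(N:ℤ)) N ×ˢ (Finset.Icc (-(N:ℤ)) N ×ˢ Finset.Icc (-(N:ℤ)) N),
      (if a.2.1 = 0 ∧ a.2.2 = 0 then (1:ℝ) else 0) = (2 * N + 1) := by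
    simp only [Finset.sum_product, ite_and]
    simp [-Int.card_Icc, hc]
  rw [e1, e2, e3]
  have : (1:ℝ) ≤ hs N ^ 2 := one_le_pow₀ hh
  nlinarith [(by positivity : (0:ℝ) ≤ 2 * N + 1)]

lemma sum_F2 (N : ℕ) : ∑ a ∈ Bx N, ∑ b ∈ Bx N, F2 a b ≤ 
    hs N ^ 2 * (((2 * (2 * N + 1)) ^ 2 + N ^ 2 * hs N ^ 4) * hs (2 * N ^ 2)) := by
  refine le_trans (le_of_eq ?_) (mul_le_mul_of_nonneg_left (quad_le N) (by positivity))
  set I := Finset.Icc (-(N:ℤ)) N with hI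
  set φ : ℤ → ℤ → ℤ → ℤ → ℝ := fun y z y' z' => |((y * z' - y' * z : ℤ) : ℝ)|⁻¹ with hφ
  have hcomm : ∀ G : ℤ → ℤ → ℤ → ℝ, ∑ z ∈ I, ∑ y' ∈ I, ∑ z' ∈ I, G z y' z' =
      ∑ z' ∈ I, ∑ y' ∈ I, ∑ z ∈ I, G z y' z' := by
    intro G
    rw [Finset.sum_comm]
    conv_rhs => rw [Finset.sum_comm]
    exact Finset.sum_congr rfl fun _ _ => Finset.sum_comm
  have hL : ∑ a ∈ Bx N, ∑ b ∈ Bx N, F2 a b = ∑ x ∈ I, ∑ y ∈ I, ∑ z ∈ I, ∑ x' ∈ I, ∑ y' ∈ I,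
      ∑ z' ∈ I, |(x:ℝ)|⁻¹ * (|(x':ℝ)|⁻¹ * φ y z y' z') := by
    simp only [Bx, Finset.sum_product, F2, hφ, mul_assoc, hI]
  have hR : ∑ s ∈ I ×ˢ I, ∑ t ∈ I ×ˢ I, |((s.1 * s.2 - t.1 * t.2 : ℤ) : ℝ)|⁻¹ =
      ∑ y ∈ I, ∑ z' ∈ I, ∑ y' ∈ I, ∑ z ∈ I, φ y z y' z' := by
    simp only [Finset.sum_product, hφ]
  have h1 : ∀ x y z : ℤ, ∑ x' ∈ I, ∑ y' ∈ I,
      ∑ z' ∈ I, |(x:ℝ)|⁻¹ * (|(x':ℝ)|⁻¹ * φ y z y' z') = 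
      |(x:ℝ)|⁻¹ * (hs N * ∑ y' ∈ I, ∑ z' ∈ I, φ y z y' z') := by
    intro x y z
    rw [hs, Finset.sum_mul, Finset.mul_sum]
    apply Finset.sum_congr rfl
    intro x' _
    rw [Finset.mul_sum, Finset.mul_sum]
    apply Finset.sum_congr rfl
    intro y' _
    rw [Finset.mul_sum, Finset.mul_sum]
  rw [hL, hR]
  calc _ = ∑ x ∈ I, |(x:ℝ)|⁻¹ * (hs N * ∑ y ∈ I, ∑ z ∈ I, ∑ y' ∈ I, ∑ z' ∈ I, φ y z y' z') := by
        apply Finset.sum_congr rfl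
        intro x _
        rw [Finset.mul_sum, Finset.mul_sum]
        apply Finset.sum_congr rfl
        intro y _
        rw [Finset.mul_sum, Finset.mul_sum]
        apply Finset.sum_congr rfl
        intro z _
        rw [h1]
    _ = _ := by
        rw [← Finset.sum_mul, ← hs, sq, mul_assoc]
        congr 2
        exact Finset.sum_congr rfl fun y _ => hcomm (fun z y' z' => φ y z y' z')

/-- The parameters in the box which are resonant for `p`. -/
def Vs {d : ℕ} (M : ℝ) (p : Fin d → ℤ × ℤ × ℤ) : Set (Fin d → ℝ) :=
  {β | (∀ k, 0 ≤ β k ∧ β k ≤ M) ∧ |∑ k, β k * (((p k).1:ℝ) * ((p k).2.1:ℝ))| ≤ 1 ∧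
      |∑ k, β k * (((p k).1:ℝ) * ((p k).2.2:ℝ))| ≤ 1}

lemma Vs_meas {d : ℕ} (M : ℝ) (p : Fin d → ℤ × ℤ × ℤ) : MeasurableSet (Vs M p) := by
  apply IsClosed.measurableSet
  unfold Vs
  simp only [Set.ofPred_and, Set.ofPred_forall]
  refine IsClosed.inter (isClosed_iInter fun k => IsClosed.inter ?_ ?_) (IsClosed.inter ?_ ?_)
  · exact isClosed_le (by fun_prop) (by fun_prop)
  · exact isClosed_le (by fun_prop) (by fun_prop)
  · exact isClosed_le (by fun_prop) (by fun_prop)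
  · exact isClosed_le (by fun_prop) (by fun_prop)

lemma vol_one {d : ℕ} (hd : 2 ≤ d) (M : ℝ) (hM : 1 ≤ M) (u : Fin d → ℝ) (i : Fin d)
    (hu : u i ≠ 0) :
    volume {β : Fin d → ℝ | (∀ k, 0 ≤ β k ∧ β k ≤ M) ∧ |∑ k, β k * u k| ≤ 1} 
      ≤ ENNReal.ofReal (4 * M ^ (d + 1) * |u i|⁻¹) := by
  have : Nontrivial (Fin d) := Fin.nontrivial_iff_two_le.mpr hd
  obtain ⟨j, hj⟩ := exists_ne i
  have hM0 : (0:ℝ) < M := by linarith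
  have h := vol_two M hM u (Pi.single j M⁻¹) i j hj.symm
    (by simp [hj.symm, hu, hM0.ne'])
  refine (measure_mono ?_).trans (h.trans (le_of_eq ?_))
  · rintro β ⟨h1, h2⟩
    refine ⟨h1, h2, ?_⟩
    simp only [Pi.single_apply, mul_ite, mul_zero, Finset.sum_ite_eq', Finset.mem_univ, if_true]
    rw [abs_of_nonneg (mul_nonneg (h1 j).1 (by positivity)), ← div_eq_mul_inv, div_le_one hM0]
    exact (h1 j).2
  · congr 1
    simp only [Pi.single_eq_same, Pi.single_eq_of_ne hj.symm, mul_zero, sub_zero]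
    rw [abs_mul, mul_inv, abs_inv, inv_inv, abs_of_pos hM0]
    ring

lemma vol_Vs {d : ℕ} (hd : 2 ≤ d) (M : ℝ) (hM : 1 ≤ M) (N : ℕ) (p : Fin d → ℤ × ℤ × ℤ)
    (hp : ∀ k, p k ∈ Bx N) (hp0 : ∃ i, (p i).1 ≠ 0) :
    volume (Vs M p) ≤ ENNReal.ofReal (4 * M ^ (d + 1) * (∑ i, ∑ j, F2 (p i) (p j) +
      ∑ i, if ∀ j, j ≠ i → p j ∈ adm N (p i) then w1 (p i) else 0)) := by
  have hM0 : (0:ℝ) < M := by linarith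
  have hn1 : 0 ≤ ∑ i, ∑ j, F2 (p i) (p j) := 
    Finset.sum_nonneg fun _ _ => Finset.sum_nonneg fun _ _ => F2_nonneg _ _
  have hn2 : ∀ i, 0 ≤ if ∀ j, j ≠ i → p j ∈ adm N (p i) then w1 (p i) else 0 := by
    intro i; split_ifs; exacts [w1_nonneg _, le_rfl]
  by_cases h2 : ∃ i j, (p i).1 ≠ 0 ∧ (p j).1 ≠ 0 ∧
      (p i).2.1 * (p j).2.2 - (p j).2.1 * (p i).2.2 ≠ 0
  · obtain ⟨i, j, hi, hj, hD⟩ := h2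
    have hij : i ≠ j := by rintro rfl; exact hD (by ring)
    have hi' : ((p i).1 : ℝ) ≠ 0 := by exact_mod_cast hi
    have hj' : ((p j).1 : ℝ) ≠ 0 := by exact_mod_cast hj
    have hD' : (((p i).2.1 * (p j).2.2 - (p j).2.1 * (p i).2.2 : ℤ) : ℝ) ≠ 0 := by
      exact_mod_cast hD
    have e : ((p i).1:ℝ) * ((p i).2.1:ℝ) * (((p j).1:ℝ) * ((p j).2.2:ℝ)) - 
      ((p j).1:ℝ) * ((p j).2.1:ℝ) * (((p i).1:ℝ) * ((p i).2.2:ℝ)) = 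
      ((p i).1:ℝ) * (p j).1 * (((p i).2.1 * (p j).2.2 - (p j).2.1 * (p i).2.2 : ℤ) : ℝ) := by
      push_cast; ring
    have h := vol_two M hM (fun k => ((p k).1:ℝ) * ((p k).2.1:ℝ))
      (fun k => ((p k).1:ℝ) * ((p k).2.2:ℝ)) i j hij
      (by simp only [e]; exact mul_ne_zero (mul_ne_zero hi' hj') hD')
    refine h.trans (ENNReal.ofReal_le_ofReal ?_)
    simp only [e]
    rw [abs_mul, abs_mul, mul_inv, mul_inv]
    apply mul_le_mul
    · gcongr; omega
    · change F2 (p i) (p j) ≤ _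
      have a1 := Finset.single_le_sum (f := fun i => ∑ j, F2 (p i) (p j)) 
        (fun i _ => Finset.sum_nonneg fun _ _ => F2_nonneg _ _) (Finset.mem_univ i)
      have a2 := Finset.single_le_sum (f := fun j => F2 (p i) (p j)) 
        (fun _ _ => F2_nonneg _ _) (Finset.mem_univ j)
      have a3 := Finset.sum_nonneg (fun i (_ : i ∈ Finset.univ) => hn2 i)
      linarith
    · positivity
    · positivity
  · push Not at h2
    -- it suffices to find a suitable index
    have key : ∀ i, (∀ j, j ≠ i → p j ∈ adm N (p i)) → 
        volume (Vs M p) ≤ ENNReal.ofReal (4 * M ^ (d + 1) * w1 (p i)) →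
        volume (Vs M p) ≤ ENNReal.ofReal (4 * M ^ (d + 1) * (∑ i, ∑ j, F2 (p i) (p j) +
      ∑ i, if ∀ j, j ≠ i → p j ∈ adm N (p i) then w1 (p i) else 0)) := by
      intro i hi hv
      refine hv.trans (ENNReal.ofReal_le_ofReal ?_)
      apply mul_le_mul_of_nonneg_left _ (by positivity)
      have a1 := Finset.single_le_sum (fun i (_ : i ∈ Finset.univ) => hn2 i) (Finset.mem_univ i)
      rw [if_pos hi] at a1
      linarith
    by_cases h1 : ∃ i, (p i).1 ≠ 0 ∧ ((p i).2.1 ≠ 0 ∨ (p i).2.2 ≠ 0)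
    · obtain ⟨i, hi, hyz⟩ := h1
      have hi' : ((p i).1 : ℝ) ≠ 0 := by exact_mod_cast hi
      apply key i
      · intro j hj
        rw [adm, Finset.mem_filter]
        refine ⟨hp j, ?_⟩
        by_cases hx : (p j).1 = 0
        · exact Or.inl hx
        · right
          rw [if_neg (by tauto)]
          have := h2 i j hi hx
          linarith
      · rcases hyz with hy | hy
        · have hy' : ((p i).2.1 : ℝ) ≠ 0 := by exact_mod_cast hy
          have h := vol_one hd M hM (fun k => ((p k).1:ℝ) * ((p k).2.1:ℝ)) i (mul_ne_zero hi' hy')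
          refine (measure_mono (fun β (hβ : β ∈ Vs M p) => (⟨hβ.1, hβ.2.1⟩ : _ ∧ _))).trans 
            (h.trans (ENNReal.ofReal_le_ofReal ?_))
          apply mul_le_mul_of_nonneg_left _ (by positivity)
          rw [abs_mul, mul_inv, w1, add_assoc]
          apply le_add_of_nonneg_right
          positivity
        · have hy' : ((p i).2.2 : ℝ) ≠ 0 := by exact_mod_cast hy
          have h := vol_one hd M hM (fun k => ((p k).1:ℝ) * ((p k).2.2:ℝ)) i (mul_ne_zero hi' hy')
          refine (measure_mono (fun β (hβ : β ∈ Vs M p) => (⟨hβ.1, hβ.2.2⟩ : _ ∧ _))).trans 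
            (h.trans (ENNReal.ofReal_le_ofReal ?_))
          apply mul_le_mul_of_nonneg_left _ (by positivity)
          rw [abs_mul, mul_inv, w1, add_assoc, add_left_comm]
          apply le_add_of_nonneg_right
          positivity
    · push Not at h1
      obtain ⟨i, hi⟩ := hp0
      apply key i
      · intro j hj
        rw [adm, Finset.mem_filter]
        refine ⟨hp j, ?_⟩
        by_cases hx : (p j).1 = 0
        · exact Or.inl hx
        · right
          rw [if_pos (h1 i hi)]
          exact h1 j hx
      · have hw : 1 ≤ w1 (p i) := by
          rw [w1, if_pos (h1 i hi)]
          apply le_add_of_nonneg_left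
          positivity
        have hsub : Vs M p ⊆ Set.univ.pi fun _ => Set.Icc (0:ℝ) M := by
          intro β hβ
          rw [Set.mem_univ_pi]
          exact fun k => hβ.1 k
        refine (measure_mono hsub).trans ?_
        rw [volume_pi_pi]
        simp only [Real.volume_Icc, sub_zero, Finset.prod_const, Finset.card_univ, Fintype.card_fin]
        rw [← ENNReal.ofReal_pow hM0.le]
        apply ENNReal.ofReal_le_ofReal
        have : M ^ d ≤ M ^ (d + 1) := pow_le_pow_right₀ hM (by omega)
        have h3 : 0 < M ^ (d + 1) := by positivity
        nlinarith

/-- The nonzero tuples in the box. -/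
noncomputable def Pt (d N : ℕ) : Finset (Fin d → ℤ × ℤ × ℤ) :=
  open Classical in (Fintype.piFinset fun _ => Bx N).filter fun p => ∃ i, (p i).1 ≠ 0

lemma total {d : ℕ} (hd : 3 ≤ d) (M : ℝ) (hM : 1 ≤ M) : ∃ C : ℝ, 0 ≤ C ∧ ∀ k : ℕ,
    ∑ p ∈ Pt d (2 ^ k), volume (Vs M p) ≤ 
      ENNReal.ofReal (C * (((2:ℝ) ^ k) ^ (3 * d - 4) * ((k:ℝ) + 1) ^ 7)) := by
  classical
  have hM0 : (0:ℝ) < M := by linarith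
  refine ⟨4 * M ^ (d + 1) * (d * d * (3 ^ (3 * (d - 2)) * 37 * 4 ^ 7) + 
    d * (18 ^ (d - 1) * 9 * 4 ^ 7)), by positivity, ?_⟩
  intro k
  set N : ℕ := 2 ^ k with hN
  have hN1 : 1 ≤ N := Nat.one_le_two_pow
  have hNr : ((2:ℝ) ^ k) = N := by rw [hN]; push_cast; rfl
  rw [hNr]
  have hN1r : (1:ℝ) ≤ N := by exact_mod_cast hN1
  set G : ℝ := 4 * (k + 1) with hG
  have hg : hs (2 * N ^ 2) ≤ G := hs_le k
  have hh : hs N ≤ G := (hs_mono (by nlinarith)).trans hg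
  have hh0 : 1 ≤ hs N := one_le_hs hN1
  have hG1 : 1 ≤ G := hh0.trans hh
  have h3N : 2 * (N:ℝ) + 1 ≤ 3 * N := by linarith
  calc ∑ p ∈ Pt d N, volume (Vs M p) 
      ≤ ∑ p ∈ Pt d N, ENNReal.ofReal (4 * M ^ (d + 1) * (∑ i, ∑ j, F2 (p i) (p j) +
      ∑ i, if ∀ j, j ≠ i → p j ∈ adm N (p i) then w1 (p i) else 0)) := by
        apply Finset.sum_le_sum
        intro p hp
        rw [Pt, Finset.mem_filter, Fintype.mem_piFinset] at hp
        exact vol_Vs (by omega) M hM N p hp.1 hp.2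
    _ ≤ ∑ p ∈ Fintype.piFinset fun _ => Bx N, ENNReal.ofReal (4 * M ^ (d + 1) * (∑ i, ∑ j, F2 (p i) (p j) +
      ∑ i, if ∀ j, j ≠ i → p j ∈ adm N (p i) then w1 (p i) else 0)) := by
        apply Finset.sum_le_sum_of_subset
        exact Finset.filter_subset _ _
    _ = ENNReal.ofReal (4 * M ^ (d + 1) * 
        ((∑ i, ∑ j, ∑ p ∈ Fintype.piFinset fun _ : Fin d => Bx N, F2 (p i) (p j)) +
         ∑ i, ∑ p ∈ Fintype.piFinset fun _ : Fin d => Bx N,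
           if ∀ j, j ≠ i → p j ∈ adm N (p i) then w1 (p i) else 0)) := by
        rw [← ENNReal.ofReal_sum_of_nonneg]
        · congr 1
          rw [← Finset.mul_sum, Finset.sum_add_distrib, Finset.sum_comm]
          congr 2
          · exact Finset.sum_congr rfl fun i _ => Finset.sum_comm
          · exact Finset.sum_comm
        · intro p _
          apply mul_nonneg (by positivity)
          apply add_nonneg
          · exact Finset.sum_nonneg fun _ _ => Finset.sum_nonneg fun _ _ => F2_nonneg _ _
          · apply Finset.sum_nonneg
            intro i _
            split_ifs; exacts [w1_nonneg _, le_rfl]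
    _ ≤ _ := by
        apply ENNReal.ofReal_le_ofReal
        rw [mul_assoc (4 * M ^ (d + 1))]
        apply mul_le_mul_of_nonneg_left _ (by positivity)
        rw [add_mul]
        apply add_le_add
        · have hb : ∀ i j : Fin d, ∑ p ∈ Fintype.piFinset fun _ : Fin d => Bx N, F2 (p i) (p j) ≤ 
              (3 ^ (3 * (d - 2)) * 37 * 4 ^ 7) * ((N:ℝ) ^ (3 * d - 4) * ((k:ℝ) + 1) ^ 7) := by
            intro i j
            by_cases hij : i = j
            · subst hij
              refine le_trans (le_of_eq ?_) (by positivity : (0:ℝ) ≤ _)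
              apply Finset.sum_eq_zero
              intro p _
              simp [F2]
            · refine (sum_pair i j hij (Bx N) F2 F2_nonneg).trans ?_
              rw [card_Bx]
              calc _ ≤ ((3 * (N:ℝ)) ^ 3) ^ (d - 2) * (G ^ 2 * (37 * N ^ 2 * G ^ 4 * G)) := by
                    push_cast
                    have hG4 : 1 ≤ G ^ 4 := one_le_pow₀ hG1
                    apply mul_le_mul _ ((sum_F2 N).trans _)
                    · exact Finset.sum_nonneg fun _ _ => Finset.sum_nonneg fun _ _ => F2_nonneg _ _
                    · positivity
                    · gcongr
                    · have := hs_nonneg (2 * N ^ 2)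
                      have h1 : (2 * (2 * (N:ℝ) + 1)) ^ 2 + N ^ 2 * hs N ^ 4 ≤ 37 * N ^ 2 * G ^ 4 := by
                        have t1 : (2 * (2 * (N:ℝ) + 1)) ^ 2 ≤ 36 * N ^ 2 * G ^ 4 := by
                          calc _ ≤ (2 * (3 * (N:ℝ))) ^ 2 := by gcongr
                            _ = 36 * N ^ 2 * 1 := by ring
                            _ ≤ _ := by gcongr
                        have t2 : (N:ℝ) ^ 2 * hs N ^ 4 ≤ N ^ 2 * G ^ 4 := by gcongr
                        linarith
                      gcongr
                _ = _ := by
                    rw [← pow_mul, mul_pow, hG, show 3 * d - 4 = 3 * (d - 2) + 2 by omega, pow_add]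
                    ring
          calc _ ≤ ∑ i : Fin d, ∑ j : Fin d, (3 ^ (3 * (d - 2)) * 37 * 4 ^ 7) * ((N:ℝ) ^ (3 * d - 4) * ((k:ℝ) + 1) ^ 7) :=
                Finset.sum_le_sum fun i _ => Finset.sum_le_sum fun j _ => hb i j
            _ = _ := by
                simp only [Finset.sum_const, Finset.card_univ, Fintype.card_fin, nsmul_eq_mul]
                ring
        · have hb : ∀ i : Fin d, (∑ p ∈ Fintype.piFinset fun _ : Fin d => Bx N,
              if ∀ j, j ≠ i → p j ∈ adm N (p i) then w1 (p i) else 0) ≤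
              (18 ^ (d - 1) * 9 * 4 ^ 7) * ((N:ℝ) ^ (3 * d - 4) * ((k:ℝ) + 1) ^ 7) := by
            intro i
            refine (sum_fiber i (Bx N) w1 w1_nonneg (adm N) (2 * (2 * N + 1) ^ 2) 
              (fun a _ _ => card_adm N a)).trans ?_
            calc _ ≤ (2 * (3 * (N:ℝ)) ^ 2) ^ (d - 1) * (3 * (3 * N) * G ^ 7) := by
                  push_cast
                  apply mul_le_mul _ ((sum_w1 hN1).trans _)
                  · exact Finset.sum_nonneg fun _ _ => w1_nonneg _
                  · positivity
                  · gcongr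
                  · have : hs N ^ 2 ≤ G ^ 7 := 
                      (pow_le_pow_left₀ (by linarith) hh 2).trans (pow_le_pow_right₀ hG1 (by norm_num))
                    gcongr
              _ = (18 ^ (d - 1) * 9 * 4 ^ 7) * ((N:ℝ) ^ (2 * (d - 1) + 1) * ((k:ℝ) + 1) ^ 7) := by
                  rw [hG, show (2 * (3 * (N:ℝ)) ^ 2) = 18 * N ^ 2 by ring, mul_pow, ← pow_mul, pow_succ]
                  ring
              _ ≤ _ := by
                  gcongr
                  omega
          calc _ ≤ ∑ i : Fin d, (18 ^ (d - 1) * 9 * 4 ^ 7) * ((N:ℝ) ^ (3 * d - 4) * ((k:ℝ) + 1) ^ 7) :=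
                Finset.sum_le_sum fun i _ => hb i
            _ = _ := by
                simp only [Finset.sum_const, Finset.card_univ, Fintype.card_fin, nsmul_eq_mul]
                ring

lemma ae_summable {d : ℕ} (hd : 3 ≤ d) (M : ℝ) (hM : 1 ≤ M) :
    ∀ᵐ β : Fin d → ℝ ∂volume, ∑' k : ℕ, (∑ p ∈ Pt d (2 ^ k), (Vs M p).indicator 1 β) * 
      ENNReal.ofReal (((2:ℝ) ^ k) ^ (-(3 * (d:ℝ) - 4 + 1 / 6))) < ⊤ := by
  obtain ⟨C, hC, h⟩ := total hd M hM
  have hm : ∀ k : ℕ, Measurable fun β : Fin d → ℝ => 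
      ∑ p ∈ Pt d (2 ^ k), (Vs M p).indicator (1 : (Fin d → ℝ) → ENNReal) β := by
    intro k
    apply Finset.measurable_sum
    intro p _
    exact measurable_one.indicator (Vs_meas M p)
  apply ae_lt_top
  · exact Measurable.tsum fun k => (hm k).mul_const _
  rw [lintegral_tsum (fun k => ((hm k).mul_const _).aemeasurable)]
  set ρ : ℝ := (2:ℝ) ^ (-(1 / 6 : ℝ)) with hρ
  have hρ0 : 0 < ρ := by positivity
  have hρ1 : ρ < 1 := Real.rpow_lt_one_of_one_lt_of_neg (by norm_num) (by norm_num)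
  have hsum : Summable fun k : ℕ => C * (((k:ℝ) + 1) ^ 7 * ρ ^ k) := by
    apply Summable.mul_left
    have := (summable_nat_add_iff 1).2 (summable_pow_mul_geometric_of_norm_lt_one 7 (r := ρ)
      (by rwa [Real.norm_of_nonneg hρ0.le]))
    refine (this.mul_right ρ⁻¹).congr ?_
    intro k
    push_cast
    rw [pow_succ ρ, mul_assoc, mul_assoc, mul_inv_cancel₀ hρ0.ne', mul_one]
  refine ne_top_of_le_ne_top hsum.tsum_ofReal_ne_top (ENNReal.tsum_le_tsum fun k => ?_)
  rw [lintegral_mul_const _ (hm k), lintegral_finsetSum _ 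
    (fun p _ => measurable_one.indicator (Vs_meas M p))]
  have e1 : ∀ p : Fin d → ℤ × ℤ × ℤ, 
      ∫⁻ β, (Vs M p).indicator (1 : (Fin d → ℝ) → ENNReal) β = volume (Vs M p) :=
    fun p => lintegral_indicator_one (Vs_meas M p)
  simp_rw [e1]
  refine (mul_le_mul_left (h k) _).trans (le_of_eq ?_)
  rw [← ENNReal.ofReal_mul (by positivity)]
  congr 1
  have e2 : ((2:ℝ) ^ k) ^ (3 * d - 4) * ((2:ℝ) ^ k) ^ (-(3 * (d:ℝ) - 4 + 1 / 6)) = ρ ^ k := by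
    rw [← Real.rpow_natCast _ (3 * d - 4), ← Real.rpow_add (by positivity)]
    rw [hρ, ← Real.rpow_natCast 2 k, ← Real.rpow_mul (by norm_num), ← Real.rpow_natCast (2 ^ _) k,
      ← Real.rpow_mul (by norm_num)]
    congr 1
    rw [Nat.cast_sub (by omega)]
    push_cast
    ring
  rw [← e2]
  ring

lemma abs_le_of_euclNorm {d : ℕ} {x : Fin d → ℤ} {R : ℝ} {N : ℕ} (hR : R ≤ N)
    (h : euclNorm (fun j => (x j : ℝ)) ≤ R) (j : Fin d) : x j ∈ Finset.Icc (-(N:ℤ)) N := by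
  rw [Finset.mem_Icc, ← abs_le]
  have h1 : |(x j : ℝ)| ≤ euclNorm (fun j => (x j : ℝ)) := by
    rw [euclNorm]
    apply Real.abs_le_sqrt
    exact Finset.single_le_sum (f := fun j => (x j : ℝ) ^ 2) (fun _ _ => sq_nonneg _)
      (Finset.mem_univ j)
  exact_mod_cast h1.trans (h.trans hR)

lemma ncard_le {d : ℕ} (M : ℝ) (β : Fin d → ℝ) (hβ : ∀ k, 0 ≤ β k ∧ β k ≤ M) (R : ℝ) (N : ℕ)
    (hR : R ≤ N) :
    ((latticeTriples d β R).ncard : ENNReal) ≤ 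
      ∑ p ∈ Pt d N, (Vs M p).indicator (1 : (Fin d → ℝ) → ENNReal) β := by
  classical
  have e : ∑ p ∈ Pt d N, (Vs M p).indicator (1 : (Fin d → ℝ) → ENNReal) β = 
      (((Pt d N).filter fun p => β ∈ Vs M p).card : ENNReal) := by
    rw [Finset.card_filter]
    push_cast
    rfl
  rw [e, Nat.cast_le, ← Set.ncard_coe_finset]
  apply Set.ncard_le_ncard_of_injOn (fun (T : (Fin d → ℤ) × (Fin d → ℤ) × (Fin d → ℤ)) (j : Fin d) => (T.1 j, T.2.1 j, T.2.2 j))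
  · rintro ⟨X, Y, Z⟩ ⟨hX, hY, hZ, h0, hmax⟩
    rw [max_le_iff] at hmax
    rw [Finset.mem_coe, Finset.mem_filter, Pt, Finset.mem_filter, Fintype.mem_piFinset]
    refine ⟨⟨fun k => ?_, ?_⟩, hβ, ?_, ?_⟩
    · simp only [Bx, Finset.mem_product]
      exact ⟨abs_le_of_euclNorm hR hX k, abs_le_of_euclNorm hR hY k, abs_le_of_euclNorm hR hZ k⟩
    · by_contra hcon
      push Not at hcon
      exact h0 (funext hcon)
    · simpa only [winner, mul_assoc] using hmax.1
    · simpa only [winner, mul_assoc] using hmax.2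
  · rintro ⟨X, Y, Z⟩ _ ⟨X', Y', Z'⟩ _ h
    have h' := fun j => congrFun h j
    simp only [Prod.mk.injEq] at h' ⊢
    exact ⟨funext fun j => (h' j).1, funext fun j => (h' j).2.1, funext fun j => (h' j).2.2⟩

/-- Lemma A.1 (2) of Deng–Hani (genericity): for `d ≥ 3` and Lebesgue-almost every
`β ∈ (ℝ⁺)^d` there is a constant `C_β` such that for every `R ≥ 1` the number of integer
triples `(X, Y, Z)` with `|X|, |Y|, |Z| ≤ R`, `X ≠ 0` and
`max(|⟨X,Y⟩_β|, |⟨X,Z⟩_β|) ≤ 1` is at most `C_β R^{3d - 4 + 1/6}`. -/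
theorem generic_triple_counting (d : ℕ) (hd : 3 ≤ d) :
    ∀ᵐ β : Fin d → ℝ ∂volume, (∀ j, 0 < β j) →
      ∃ C : ℝ, ∀ R : ℝ, 1 ≤ R →
        ((latticeTriples d β R).ncard : ℝ) ≤ C * R ^ (3 * (d : ℝ) - 4 + 1 / 6) := by
  have hall : ∀ᵐ β : Fin d → ℝ ∂volume, ∀ m : ℕ, ∑' k : ℕ,
      (∑ p ∈ Pt d (2 ^ k), (Vs ((m:ℝ) + 1) p).indicator 1 β) * 
      ENNReal.ofReal (((2:ℝ) ^ k) ^ (-(3 * (d:ℝ) - 4 + 1 / 6))) < ⊤ :=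
    ae_all_iff.mpr fun m => ae_summable hd _ (by linarith [Nat.cast_nonneg (α := ℝ) m])
  filter_upwards [hall] with β hβ hpos
  obtain ⟨m, hm⟩ := exists_nat_ge (∑ j, β j)
  have hbox : ∀ k, 0 ≤ β k ∧ β k ≤ (m:ℝ) + 1 := fun k => ⟨(hpos k).le, by
    have := Finset.single_le_sum (fun j _ => (hpos j).le) (Finset.mem_univ k)
    linarith⟩
  set e : ℝ := 3 * (d:ℝ) - 4 + 1 / 6 with he
  have he0 : 0 ≤ e := by
    have : (3:ℝ) ≤ d := by exact_mod_cast hd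
    rw [he]; linarith
  set S := ∑' k : ℕ, (∑ p ∈ Pt d (2 ^ k), (Vs ((m:ℝ) + 1) p).indicator 1 β) * 
      ENNReal.ofReal (((2:ℝ) ^ k) ^ (-e)) with hS
  have hStop : S ≠ ⊤ := (hβ m).ne
  refine ⟨S.toReal * 2 ^ e, fun R hR => ?_⟩
  obtain ⟨n, hn1, hn2⟩ := exists_nat_pow_near hR (one_lt_two)
  have hc := ncard_le ((m:ℝ) + 1) β hbox R (2 ^ (n + 1)) (by push_cast; exact hn2.le)
  have hle : ((latticeTriples d β R).ncard : ENNReal) * 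
      ENNReal.ofReal (((2:ℝ) ^ (n + 1)) ^ (-e)) ≤ S :=
    (mul_le_mul_left hc _).trans (ENNReal.le_tsum (f := fun k : ℕ => 
      (∑ p ∈ Pt d (2 ^ k), (Vs ((m:ℝ) + 1) p).indicator 1 β) * 
      ENNReal.ofReal (((2:ℝ) ^ k) ^ (-e))) (n + 1))
  have hle' := ENNReal.toReal_mono hStop hle
  rw [ENNReal.toReal_mul, ENNReal.toReal_natCast, ENNReal.toReal_ofReal (by positivity),
    Real.rpow_neg (by positivity), ← div_eq_mul_inv, div_le_iff₀ (by positivity)] at hle'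
  refine hle'.trans ?_
  rw [mul_assoc, ← Real.mul_rpow (by norm_num) (by linarith)]
  apply mul_le_mul_of_nonneg_left _ ENNReal.toReal_nonneg
  apply Real.rpow_le_rpow (by positivity) _ he0
  rw [pow_succ]; linarith

end WKE
end

section
/- Let d ≥ 3 and β ∈ (ℝ⁺)^d. There is a constant C, depending only on d and β, such that the following holds for all L ≥ 2, all δ ∈ (0,1], all signs ζ₁, ζ₂ ∈ {+1,−1}, all a₁, a₂, k ∈ Z_L^d and all γ ∈ ℝ. Let S be the set of pairs (x₁,x₂) ∈ (Z_L^d)² such that |x₁ − a₁| ≤ 1, |x₂ − a₂| ≤ 1, ζ₁x₁ + ζ₂x₂ = k, |ζ₁|x₁|_β² + ζ₂|x₂|_β² − γ| ≤ δ⁻¹L⁻², and x₁ ≠ x₂ in case ζ₁ + ζ₂ = 0. Then #S ≤ C δ⁻¹ L^{d−1}; if moreover ζ₁ = ζ₂, then #S ≤ C δ⁻¹ L^{d−1−1/3}. -/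
namespace WKE

/-- The counting set of Lemma A.7 (1) of Deng–Hani (two-vector counting). -/
def twoVecSet (d : ℕ) (β : Fin d → ℝ) (L δ ζ₁ ζ₂ : ℝ) (a₁ a₂ k : Fin d → ℝ) (γ : ℝ) :
    Set ((Fin d → ℝ) × (Fin d → ℝ)) :=
  {x | isLatticeVec d L x.1 ∧ isLatticeVec d L x.2 ∧
    euclNorm (x.1 - a₁) ≤ 1 ∧ euclNorm (x.2 - a₂) ≤ 1 ∧
    (∀ j, ζ₁ * x.1 j + ζ₂ * x.2 j = k j) ∧
    |ζ₁ * wnormSq β x.1 + ζ₂ * wnormSq β x.2 - γ| ≤ δ⁻¹ * (L ^ 2)⁻¹ ∧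
    (ζ₁ + ζ₂ = 0 → x.1 ≠ x.2)}

theorem card_int_le (X : Finset ℤ) (D : ℝ) (hD : 0 ≤ D)
    (h : ∀ x ∈ X, ∀ y ∈ X, (y : ℝ) - x ≤ D) : (X.card : ℝ) ≤ D + 1 := by
  rcases X.eq_empty_or_nonempty with rfl | hne
  · simp; linarith
  · have hm := X.min'_mem hne
    set m := X.min' hne with hmdef
    have hsub : X ⊆ Finset.Icc m (m + ⌊D⌋) := by
      intro y hy
      rw [Finset.mem_Icc]
      refine ⟨X.min'_le y hy, ?_⟩
      have h1 := h m hm y hy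
      have : y - m ≤ ⌊D⌋ := Int.le_floor.2 (by push_cast; exact h1)
      linarith
    have hc := Finset.card_le_card hsub
    rw [Int.card_Icc] at hc
    have h0 : 0 ≤ ⌊D⌋ := Int.floor_nonneg.2 hD
    have h2 : (X.card : ℤ) ≤ ⌊D⌋ + 1 := by omega
    have h3 : (X.card : ℝ) ≤ (⌊D⌋ : ℝ) + 1 := by exact_mod_cast h2
    linarith [Int.floor_le D]

theorem card_fiber_le {α ι : Type*} [DecidableEq ι] (F : Finset α) (I : Finset ι) (f : α → ι)
    (hf : ∀ x ∈ F, f x ∈ I) (N M : ℝ) (hN : 0 ≤ N) (hI : (I.card : ℝ) ≤ M)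
    (hfib : ∀ i ∈ I, ((F.filter (fun x => f x = i)).card : ℝ) ≤ N) :
    (F.card : ℝ) ≤ M * N := by
  rw [Finset.card_eq_sum_card_fiberwise (f := f) (t := I) (fun x hx => hf x hx)]
  push_cast
  calc _ ≤ ∑ i ∈ I, N := Finset.sum_le_sum hfib
    _ = I.card * N := by simp
    _ ≤ M * N := by gcongr

theorem card_fiber_real_le {α : Type*} (F : Finset α) (f : α → ℝ) (D N : ℝ) (hD : 0 ≤ D)
    (hf : ∀ x ∈ F, 0 ≤ f x ∧ f x ≤ D) (hN : 0 ≤ N)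
    (hfib : ∀ i : ℤ, ((F.filter (fun x => ⌊f x⌋ = i)).card : ℝ) ≤ N) :
    (F.card : ℝ) ≤ (D + 1) * N := by
  refine card_fiber_le F (Finset.Icc 0 ⌊D⌋) (fun x => ⌊f x⌋) ?_ N (D+1) hN ?_ (fun i _ => hfib i)
  · intro x hx
    rw [Finset.mem_Icc]
    exact ⟨Int.floor_nonneg.2 (hf x hx).1, Int.floor_le_floor (hf x hx).2⟩
  · rw [Int.card_Icc]
    have h0 : 0 ≤ ⌊D⌋ := Int.floor_nonneg.2 hD
    have : (((⌊D⌋ + 1 - 0).toNat : ℤ) : ℝ) = ⌊D⌋ + 1 := by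
      rw [Int.toNat_of_nonneg (by omega)]; push_cast; ring
    have h2 : ((⌊D⌋ + 1 - 0).toNat : ℝ) = ⌊D⌋ + 1 := by exact_mod_cast this
    rw [h2]; linarith [Int.floor_le D]

/-- A set without three `g`-separated points has at most `2 g + 2` points. -/
theorem card_two_clusters (X : Finset ℤ) (g : ℝ) (hg : 0 ≤ g)
    (h : ∀ x ∈ X, ∀ y ∈ X, ∀ z ∈ X, (x : ℝ) + g ≤ y → (y : ℝ) + g ≤ z → False) :
    (X.card : ℝ) ≤ 2 * (g + 1) := by
  rcases X.eq_empty_or_nonempty with rfl | hne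
  · simp; linarith
  · have hm := X.min'_mem hne
    have hmin := X.min'_le
    set m := X.min' hne with hmdef
    have h1 : ((X.filter (fun x : ℤ => (x : ℝ) < m + g)).card : ℝ) ≤ g + 1 := by
      apply card_int_le _ _ hg
      intro x hx y hy
      rw [Finset.mem_filter] at hx hy
      have : (m : ℝ) ≤ x := by exact_mod_cast hmin x hx.1
      linarith [hy.2]
    have h2 : ((X.filter (fun x : ℤ => ¬ (x : ℝ) < m + g)).card : ℝ) ≤ g + 1 := by
      apply card_int_le _ _ hg
      intro x hx y hy
      rw [Finset.mem_filter] at hx hy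
      by_contra hc
      exact h m hm x hx.1 y hy.1 (by linarith [hx.2]) (by linarith)
    have h3 := Finset.card_filter_add_card_filter_not (s := X) (fun x : ℤ => (x : ℝ) < m + g)
    have h4 : ((X.filter (fun x : ℤ => (x : ℝ) < m + g)).card : ℝ) +
      ((X.filter (fun x : ℤ => ¬ (x : ℝ) < m + g)).card : ℝ) = X.card := by exact_mod_cast h3
    linarith

theorem window_count (X : Finset ℤ) (g h A W : ℝ) (hg : 0 ≤ g) (hh : 0 < h) (hW : 0 ≤ W)
    (hX : ∀ x ∈ X, A ≤ (x : ℝ) ∧ (x : ℝ) ≤ A + W)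
    (H : ∀ x ∈ X, ∀ y ∈ X, ∀ z ∈ X, (x : ℝ) + g ≤ y → (y : ℝ) + g ≤ z → (z : ℝ) ≤ x + h → False) :
    (X.card : ℝ) ≤ (W / h + 1) * (2 * (g + 1)) := by
  refine card_fiber_real_le X (fun x => ((x : ℝ) - A) / h) (W / h) _ (by positivity) ?_
    (by positivity) ?_
  · intro x hx
    have := hX x hx
    refine ⟨div_nonneg (by linarith) hh.le, ?_⟩
    gcongr; linarith
  · intro i
    apply card_two_clusters _ _ hg
    intro x hx y hy z hz hxy hyz
    rw [Finset.mem_filter] at hx hy hz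
    refine H x hx.1 y hy.1 z hz.1 hxy hyz ?_
    have h1 := Int.floor_le (((x : ℝ) - A) / h)
    have h2 := Int.lt_floor_add_one (((z : ℝ) - A) / h)
    rw [hx.2] at h1
    rw [hz.2] at h2
    rw [le_div_iff₀ hh] at h1
    rw [div_lt_iff₀ hh] at h2
    linarith

set_option maxHeartbeats 1000000 in
/-- Three lattice points of the thin elliptic annulus cannot be close together. -/
theorem three_pts (b c K g h Y : ℝ) (hb : 0 < b) (hc : 0 < c) (hg : 2 < b * g ^ 2) (hg1 : 1 ≤ g)
    (hK : 1 ≤ K) (hK1 : 1 + b ≤ c * K) (hY : 1 ≤ Y)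
    (hYh : (1 + b + c * K ^ 2) * h ^ 3 < c * Y)
    (p1 p2 q1 q2 s1 s2 : ℤ) (T : ℝ)
    (hp : |(p1 : ℝ)| ≤ p2) (hq : |(q1 : ℝ)| ≤ q2) (hs : |(s1 : ℝ)| ≤ s2) (hpY : Y ≤ p2)
    (hpT : T ≤ b * (p1 : ℝ) ^ 2 + c * (p2 : ℝ) ^ 2) (hpT' : b * (p1 : ℝ) ^ 2 + c * (p2 : ℝ) ^ 2 ≤ T + 1)
    (hqT : T ≤ b * (q1 : ℝ) ^ 2 + c * (q2 : ℝ) ^ 2) (hqT' : b * (q1 : ℝ) ^ 2 + c * (q2 : ℝ) ^ 2 ≤ T + 1)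
    (hsT : T ≤ b * (s1 : ℝ) ^ 2 + c * (s2 : ℝ) ^ 2) (hsT' : b * (s1 : ℝ) ^ 2 + c * (s2 : ℝ) ^ 2 ≤ T + 1)
    (hpq : (p1 : ℝ) + g ≤ q1) (hqs : (q1 : ℝ) + g ≤ s1) (hps : (s1 : ℝ) ≤ p1 + h) : False := by
  -- vertical displacement
  have vert : ∀ r1 r2 : ℝ, |r1| ≤ r2 → T ≤ b * r1 ^ 2 + c * r2 ^ 2 →
      b * r1 ^ 2 + c * r2 ^ 2 ≤ T + 1 → 0 ≤ r1 - p1 → r1 - p1 ≤ h → 1 ≤ h →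
      |r2 - p2| ≤ K * h := by
    intro r1 r2 hr hrT hrT' h0 h1 hh
    have hr2 : 0 ≤ r2 := (abs_nonneg _).trans hr
    have hpos : 1 ≤ (p2 : ℝ) + r2 := by linarith
    have e : c * ((r2 - p2) * (p2 + r2)) =
        ((b * r1 ^ 2 + c * r2 ^ 2) - (b * (p1 : ℝ) ^ 2 + c * (p2 : ℝ) ^ 2)) -
          b * ((r1 - p1) * (r1 + p1)) := by ring
    have e1 : |(b * r1 ^ 2 + c * r2 ^ 2) - (b * (p1 : ℝ) ^ 2 + c * (p2 : ℝ) ^ 2)| ≤ 1 := by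
      rw [abs_le]; constructor <;> linarith
    have e2 : |b * ((r1 - p1) * (r1 + p1))| ≤ b * (h * (p2 + r2)) := by
      rw [abs_mul, abs_of_pos hb, abs_mul, abs_of_nonneg h0]
      have : |r1 + p1| ≤ p2 + r2 := (abs_add_le _ _).trans (by linarith)
      gcongr
    have e3 : |c * ((r2 - p2) * (p2 + r2))| ≤ 1 + b * (h * (p2 + r2)) := by
      rw [e]; exact (abs_sub _ _).trans (by linarith)
    rw [abs_mul, abs_of_pos hc, abs_mul, abs_of_pos (show (0 : ℝ) < p2 + r2 by linarith)] at e3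
    have e4 : 1 + b * (h * (p2 + r2)) ≤ (1 + b) * h * (p2 + r2) := by
      nlinarith [mul_le_mul hh hpos zero_le_one (by linarith)]
    have e5 : (1 + b) * h * (p2 + r2) ≤ c * K * h * (p2 + r2) := by
      gcongr
    have e6 : c * (p2 + r2) * |r2 - p2| ≤ c * (p2 + r2) * (K * h) := by linarith
    exact le_of_mul_le_mul_left e6 (by positivity)
  have hh : 1 ≤ h := by linarith
  have vq := vert q1 q2 hq hqT hqT' (by linarith) (by linarith) hh
  have vs := vert s1 s2 hs hsT hsT' (by linarith) (by linarith) hh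
  -- displacement vectors
  obtain ⟨u1, hu1⟩ : ∃ u : ℤ, u = q1 - p1 := ⟨_, rfl⟩
  obtain ⟨u2, hu2⟩ : ∃ u : ℤ, u = q2 - p2 := ⟨_, rfl⟩
  obtain ⟨v1, hv1⟩ : ∃ u : ℤ, u = s1 - p1 := ⟨_, rfl⟩
  obtain ⟨v2, hv2⟩ : ∃ u : ℤ, u = s2 - p2 := ⟨_, rfl⟩
  have ru1 : (u1 : ℝ) = q1 - p1 := by rw [hu1]; push_cast; ring
  have ru2 : (u2 : ℝ) = q2 - p2 := by rw [hu2]; push_cast; ring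
  have rv1 : (v1 : ℝ) = s1 - p1 := by rw [hv1]; push_cast; ring
  have rv2 : (v2 : ℝ) = s2 - p2 := by rw [hv2]; push_cast; ring
  rw [← ru2] at vq
  rw [← rv2] at vs
  have hu1g : g ≤ (u1 : ℝ) := by linarith
  have hv1g : (u1 : ℝ) + g ≤ (v1 : ℝ) := by linarith
  have hv1h : (v1 : ℝ) ≤ h := by linarith
  obtain ⟨α, hα⟩ : ∃ α : ℝ, α = (b * (q1 : ℝ) ^ 2 + c * (q2 : ℝ) ^ 2) -
    (b * (p1 : ℝ) ^ 2 + c * (p2 : ℝ) ^ 2) := ⟨_, rfl⟩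
  obtain ⟨η, hη⟩ : ∃ α : ℝ, α = (b * (s1 : ℝ) ^ 2 + c * (s2 : ℝ) ^ 2) -
    (b * (p1 : ℝ) ^ 2 + c * (p2 : ℝ) ^ 2) := ⟨_, rfl⟩
  have hα1 : |α| ≤ 1 := by rw [abs_le]; constructor <;> linarith
  have hη1 : |η| ≤ 1 := by rw [abs_le]; constructor <;> linarith
  have key : 2 * c * p2 * ((u1 : ℝ) * v2 - u2 * v1) =
      u1 * (η - (b * (v1 : ℝ) ^ 2 + c * (v2 : ℝ) ^ 2)) -
      v1 * (α - (b * (u1 : ℝ) ^ 2 + c * (u2 : ℝ) ^ 2)) := by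
    rw [hα, hη, ru1, ru2, rv1, rv2]; ring
  have hu0 : (0 : ℝ) < u1 := by linarith
  have hv0 : (0 : ℝ) < v1 := by linarith
  rw [abs_le] at hα1 hη1
  by_cases hD : u1 * v2 - u2 * v1 = 0
  · have hD' : (u1 : ℝ) * v2 - u2 * v1 = 0 := by exact_mod_cast hD
    rw [hD', mul_zero] at key
    set Qu : ℝ := b * (u1 : ℝ) ^ 2 + c * (u2 : ℝ) ^ 2 with hQu
    have hv : (u1 : ℝ) ^ 2 * (b * (v1 : ℝ) ^ 2 + c * (v2 : ℝ) ^ 2) = v1 ^ 2 * Qu := by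
      have : ((u1 : ℝ) * v2) ^ 2 = (u2 * v1) ^ 2 := by rw [show (u1 : ℝ) * v2 = u2 * v1 by linarith]
      rw [hQu]; linear_combination c * this
    have e1 : (v1 : ℝ) * ((v1 - u1) * Qu) = u1 ^ 2 * η - u1 * v1 * α := by
      linear_combination (u1 : ℝ) * key - hv
    have e2 : (u1 : ℝ) ^ 2 * η - u1 * v1 * α ≤ v1 * (2 * u1) := by
      have f1 : (u1 : ℝ) ^ 2 * η ≤ u1 ^ 2 * 1 := by gcongr; exact hη1.2
      have f2 : (u1 : ℝ) * v1 * (-1) ≤ u1 * v1 * α := by gcongr; exact hα1.1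
      have f3 : (u1 : ℝ) * u1 ≤ u1 * v1 := mul_le_mul_of_nonneg_left (by linarith) hu0.le
      linarith
    have e3 : (v1 - u1) * Qu ≤ 2 * u1 := by
      rw [← e1] at e2; exact le_of_mul_le_mul_left e2 hv0
    have e4 : g * (b * (u1 : ℝ) * g) ≤ (v1 - u1) * (b * u1 * u1) := by
      have : g ≤ (v1 : ℝ) - u1 := by linarith
      have : (0 : ℝ) ≤ v1 - u1 := by linarith
      gcongr
    have e5 : ((v1 : ℝ) - u1) * (b * u1 * u1) ≤ (v1 - u1) * Qu := by
      have : (0:ℝ) ≤ v1 - u1 := by linarith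
      gcongr
      rw [hQu]
      have : 0 ≤ c * (u2 : ℝ) ^ 2 := by positivity
      linarith
    have e6 : (u1 : ℝ) * 2 < u1 * (b * g ^ 2) := by gcongr
    linarith
  · have hD1 : (1 : ℝ) ≤ |(u1 : ℝ) * v2 - u2 * v1| := by
      have : 1 ≤ |u1 * v2 - u2 * v1| := Int.one_le_abs hD
      exact_mod_cast this
    have bd : ∀ w1 w2 : ℝ, 0 < w1 → w1 ≤ h → |w2| ≤ K * h → ∀ θ : ℝ, -1 ≤ θ → θ ≤ 1 →
        |θ - (b * w1 ^ 2 + c * w2 ^ 2)| ≤ (1 + b + c * K ^ 2) * h ^ 2 := by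
      intro w1 w2 h0 h1 h2 θ t1 t2
      have a1 : w1 ^ 2 ≤ h ^ 2 := by gcongr
      have a2 : w2 ^ 2 ≤ (K * h) ^ 2 := by rw [← sq_abs w2]; gcongr
      have a3 : 1 ≤ h ^ 2 := one_le_pow₀ hh
      have a4 : b * w1 ^ 2 ≤ b * h ^ 2 := by gcongr
      have a5 : c * w2 ^ 2 ≤ c * (K * h) ^ 2 := by gcongr
      have a6 : 0 ≤ b * w1 ^ 2 := by positivity
      have a7 : 0 ≤ c * w2 ^ 2 := by positivity
      rw [mul_pow] at a5
      have a8 : (1 + b + c * K ^ 2) * h ^ 2 = h ^ 2 + b * h ^ 2 + c * (K ^ 2 * h ^ 2) := by ring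
      rw [a8, abs_le]; constructor <;> linarith
    have b1 := bd u1 u2 hu0 (by linarith) vq α hα1.1 hα1.2
    have b2 := bd v1 v2 hv0 (by linarith) vs η hη1.1 hη1.2
    have hp0 : (0 : ℝ) < p2 := by linarith
    have k1 : 2 * c * p2 * |(u1 : ℝ) * v2 - u2 * v1| ≤ h * ((1 + b + c * K ^ 2) * h ^ 2) +
        h * ((1 + b + c * K ^ 2) * h ^ 2) := by
      rw [← abs_of_pos (show 0 < 2 * c * (p2 : ℝ) by positivity), ← abs_mul, key]
      refine (abs_sub _ _).trans ?_
      rw [abs_mul, abs_mul, abs_of_pos hu0, abs_of_pos hv0]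
      have : (u1 : ℝ) ≤ h := by linarith
      gcongr
    have k2 : 2 * c * p2 * 1 ≤ 2 * c * p2 * |(u1 : ℝ) * v2 - u2 * v1| := by gcongr
    have k3 : c * Y ≤ c * p2 := by gcongr
    linarith

set_option maxHeartbeats 1000000 in
theorem planar_sector (b c : ℝ) (hb : 0 < b) (hc : 0 < c) : ∃ C : ℝ, 0 ≤ C ∧
    ∀ (R A T : ℝ) (P : Finset (ℤ × ℤ)), 1 ≤ R →
      (∀ p ∈ P, |(p.1 : ℝ)| ≤ p.2 ∧ A ≤ (p.1 : ℝ) ∧ (p.1 : ℝ) ≤ A + R ∧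
        T ≤ b * (p.1 : ℝ) ^ 2 + c * (p.2 : ℝ) ^ 2 ∧
        b * (p.1 : ℝ) ^ 2 + c * (p.2 : ℝ) ^ 2 ≤ T + 1) →
      (P.card : ℝ) ≤ C * R ^ (2 / 3 : ℝ) := by
  obtain ⟨g, hg⟩ : ∃ g : ℝ, g = 1 + 2 / b := ⟨_, rfl⟩
  obtain ⟨K, hK⟩ : ∃ K : ℝ, K = 1 + (1 + b) / c := ⟨_, rfl⟩
  obtain ⟨E, hE⟩ : ∃ E : ℝ, E = 1 + b + c * K ^ 2 := ⟨_, rfl⟩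
  obtain ⟨κ, hκ⟩ : ∃ κ : ℝ, κ = c / (c + E) := ⟨_, rfl⟩
  obtain ⟨M, hM⟩ : ∃ M : ℝ, M = 1 + (b + c + 1) / c := ⟨_, rfl⟩
  have hg1 : 1 ≤ g := by rw [hg]; have : 0 < 2 / b := by positivity
                         linarith
  have hgb : 2 < b * g ^ 2 := by
    have : b * g = b + 2 := by rw [hg]; field_simp
    nlinarith
  have hK1 : 1 ≤ K := by rw [hK]; have : 0 < (1 + b) / c := by positivity
                         linarith
  have hKc : 1 + b ≤ c * K := by
    have : c * K = c + (1 + b) := by rw [hK]; field_simp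
    linarith
  have hE0 : 0 < E := by rw [hE]; positivity
  have hκ0 : 0 < κ := by rw [hκ]; positivity
  have hκ1 : κ ≤ 1 := by rw [hκ, div_le_one (by positivity)]; linarith
  have hκE : E * κ < c := by
    rw [hκ, mul_div_assoc', div_lt_iff₀ (by positivity)]; nlinarith
  have hM1 : 1 ≤ M := by rw [hM]; have : 0 < (b + c + 1) / c := by positivity
                         linarith
  have hMc : b + c + 1 ≤ c * M ^ 2 := by
    have : c * M = c + (b + c + 1) := by rw [hM]; field_simp
    nlinarith
  refine ⟨((2 * M / κ + 1) * (2 * (g + 1))) * (1 / c + 1), by positivity, ?_⟩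
  intro R A T P hR hP
  have hR1 : 1 ≤ R ^ (2 / 3 : ℝ) := Real.one_le_rpow hR (by norm_num)
  have hR0 : 0 < R := by linarith
  rcases P.eq_empty_or_nonempty with rfl | hne
  · simp; positivity
  suffices hX : ((P.image Prod.fst).card : ℝ) ≤ (2 * M / κ + 1) * (2 * (g + 1)) * R ^ (2 / 3 : ℝ) by
    have := card_fiber_le P (P.image Prod.fst) Prod.fst
      (fun x hx => Finset.mem_image_of_mem _ hx) (1 / c + 1) _ (by positivity) hX ?_
    · refine this.trans (le_of_eq (by ring))
    · intro i _
      have hinj : Set.InjOn Prod.snd ((P.filter (fun x => x.1 = i) : Finset (ℤ × ℤ)) : Set (ℤ × ℤ)) := by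
        intro p hp q hq h
        simp only [Finset.coe_filter, Set.mem_ofPred_eq] at hp hq
        exact Prod.ext (hp.2.trans hq.2.symm) h
      rw [← Finset.card_image_of_injOn hinj]
      apply card_int_le _ _ (by positivity)
      intro x hx y hy
      simp only [Finset.mem_image, Finset.mem_filter] at hx hy
      obtain ⟨p, ⟨hp, hpi⟩, rfl⟩ := hx
      obtain ⟨q, ⟨hq, hqi⟩, rfl⟩ := hy
      obtain ⟨p1, _, _, p2, p3⟩ := hP p hp
      obtain ⟨q1, _, _, q2, q3⟩ := hP q hq
      rw [hpi] at p1 p2 p3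
      rw [hqi] at q1 q2 q3
      by_contra hlt
      push Not at hlt
      have p0 : (0 : ℝ) ≤ p.2 := (abs_nonneg _).trans p1
      have hdpos : 0 < (q.2 : ℝ) - p.2 := lt_trans (by positivity) hlt
      have hi : 0 < q.2 - p.2 := by exact_mod_cast hdpos
      have hi1 : (1 : ℝ) ≤ q.2 - p.2 := by exact_mod_cast hi
      have h1 : 1 < c * ((q.2 : ℝ) - p.2) := by
        rw [div_lt_iff₀ hc] at hlt; linarith
      have h2 : c * ((q.2 : ℝ) - p.2) * 1 ≤ c * ((q.2 : ℝ) - p.2) * (q.2 + p.2) := by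
        gcongr; linarith
      have h3 : c * ((q.2 : ℝ) - p.2) * (q.2 + p.2) = c * (q.2 : ℝ) ^ 2 - c * (p.2 : ℝ) ^ 2 := by ring
      linarith
  obtain ⟨p0, hp0, hmin⟩ := Finset.exists_min_image P (fun p => p.2) hne
  obtain ⟨a1, _, _, a2, a3⟩ := hP p0 hp0
  have hY0 : (0 : ℝ) ≤ p0.2 := (abs_nonneg _).trans a1
  have hsq : (p0.1 : ℝ) ^ 2 ≤ (p0.2 : ℝ) ^ 2 := by
    rw [← sq_abs (p0.1 : ℝ)]; gcongr
  have hT : T ≤ (b + c) * (p0.2 : ℝ) ^ 2 := by nlinarith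
  obtain ⟨Z, hZ⟩ : ∃ Z : ℝ, Z = max 1 (p0.2 : ℝ) := ⟨_, rfl⟩
  have hZ1 : 1 ≤ Z := hZ ▸ le_max_left _ _
  have hZY : (p0.2 : ℝ) ≤ Z := hZ ▸ le_max_right _ _
  have hTZ : T + 1 ≤ (b + c + 1) * Z ^ 2 := by
    have : (p0.2 : ℝ) ^ 2 ≤ Z ^ 2 := by gcongr
    nlinarith
  have hyb : ∀ p ∈ P, (p.2 : ℝ) ≤ M * Z := by
    intro p hp
    obtain ⟨q1, _, _, q2, q3⟩ := hP p hp
    have h1 : c * (p.2 : ℝ) ^ 2 ≤ c * (M * Z) ^ 2 := by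
      have : (b + c + 1) * Z ^ 2 ≤ c * M ^ 2 * Z ^ 2 := by gcongr
      have : 0 ≤ b * (p.1 : ℝ) ^ 2 := by positivity
      rw [mul_pow]
      linarith
    exact le_of_sq_le_sq (le_of_mul_le_mul_left h1 hc) (by positivity)
  by_cases hY : p0.2 = 0
  · have hZe : Z = 1 := by rw [hZ, hY]; simp
    have h1 : ((P.image Prod.fst).card : ℝ) ≤ 2 * M + 1 := by
      apply card_int_le _ _ (by positivity)
      intro x hx y hy
      simp only [Finset.mem_image] at hx hy
      obtain ⟨p, hp, rfl⟩ := hx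
      obtain ⟨q, hq, rfl⟩ := hy
      have h1 := hyb p hp
      have h2 := hyb q hq
      have h3 := abs_le.1 (hP p hp).1
      have h4 := abs_le.1 (hP q hq).1
      rw [hZe] at h1 h2
      linarith [h3.1, h4.2]
    refine h1.trans ?_
    have h2 : 2 * M ≤ 2 * M / κ := by
      rw [le_div_iff₀ hκ0]
      exact mul_le_of_le_one_right (by linarith) hκ1
    calc 2 * M + 1 ≤ (2 * M / κ + 1) * 1 * 1 := by linarith
      _ ≤ _ := by gcongr; linarith
  have hYi : 1 ≤ p0.2 := by
    have : 0 ≤ p0.2 := by exact_mod_cast hY0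
    omega
  have hY1 : (1 : ℝ) ≤ p0.2 := by exact_mod_cast hYi
  have hZe : Z = p0.2 := by rw [hZ, max_eq_right hY1]
  rw [← hZe] at hY1
  obtain ⟨h, hh⟩ : ∃ h : ℝ, h = κ * Z ^ (1 / 3 : ℝ) := ⟨_, rfl⟩
  have hZ0 : 0 < Z := by linarith
  have hh0 : 0 < h := by rw [hh]; positivity
  have hh3 : h ^ 3 = κ ^ 3 * Z := by
    rw [hh, mul_pow, ← Real.rpow_natCast (Z ^ (1 / 3 : ℝ)) 3, ← Real.rpow_mul hZ0.le]; norm_num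
  have hYh : (1 + b + c * K ^ 2) * h ^ 3 < c * Z := by
    rw [← hE, hh3]
    have : κ ^ 3 ≤ κ := by
      have := pow_le_pow_of_le_one hκ0.le hκ1 (show 1 ≤ 3 by norm_num)
      simpa using this
    calc E * (κ ^ 3 * Z) ≤ E * (κ * Z) := by gcongr
      _ = (E * κ) * Z := by ring
      _ < c * Z := by gcongr
  have H : ∀ x ∈ P.image Prod.fst, ∀ y ∈ P.image Prod.fst, ∀ z ∈ P.image Prod.fst,
      (x : ℝ) + g ≤ y → (y : ℝ) + g ≤ z → (z : ℝ) ≤ x + h → False := by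
    intro x hx y hy z hz
    simp only [Finset.mem_image] at hx hy hz
    obtain ⟨p, hp, rfl⟩ := hx
    obtain ⟨q, hq, rfl⟩ := hy
    obtain ⟨s, hs, rfl⟩ := hz
    obtain ⟨p1, _, _, p2, p3⟩ := hP p hp
    obtain ⟨q1, _, _, q2, q3⟩ := hP q hq
    obtain ⟨s1, _, _, s2, s3⟩ := hP s hs
    have hm : Z ≤ (p.2 : ℝ) := by rw [hZe]; exact_mod_cast hmin p hp
    exact three_pts b c K g h Z hb hc hgb hg1 hK1 hKc hY1 hYh p.1 p.2 q.1 q.2 s.1 s.2 T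
      p1 q1 s1 hm p2 p3 q2 q3 s2 s3
  have hmain : ∃ W : ℝ, ∃ B : ℝ, 0 ≤ W ∧ (∀ x ∈ P.image Prod.fst, B ≤ (x : ℝ) ∧ (x : ℝ) ≤ B + W) ∧
      W / h ≤ 2 * M / κ * R ^ (2 / 3 : ℝ) := by
    rcases le_total R Z with hRZ | hRZ
    · refine ⟨R, A, by linarith, ?_, ?_⟩
      · intro x hx
        simp only [Finset.mem_image] at hx
        obtain ⟨p, hp, rfl⟩ := hx
        exact ⟨(hP p hp).2.1, (hP p hp).2.2.1⟩
      · rw [div_le_iff₀ hh0, hh]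
        have e1 : R = R ^ (2 / 3 : ℝ) * R ^ (1 / 3 : ℝ) := by
          rw [← Real.rpow_add hR0]; norm_num
        have e2 : R ^ (1 / 3 : ℝ) ≤ Z ^ (1 / 3 : ℝ) := by gcongr
        calc R = 1 * R ^ (2 / 3 : ℝ) * R ^ (1 / 3 : ℝ) := by rw [one_mul, ← e1]
          _ ≤ (2 * M) * R ^ (2 / 3 : ℝ) * Z ^ (1 / 3 : ℝ) := by gcongr; linarith
          _ = _ := by field_simp
    · refine ⟨2 * M * Z, - (M * Z), by positivity, ?_, ?_⟩
      · intro x hx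
        simp only [Finset.mem_image] at hx
        obtain ⟨p, hp, rfl⟩ := hx
        have h1 := abs_le.1 (hP p hp).1
        have h2 := hyb p hp
        constructor <;> linarith [h1.1, h1.2]
      · rw [div_le_iff₀ hh0, hh]
        have e1 : Z = Z ^ (2 / 3 : ℝ) * Z ^ (1 / 3 : ℝ) := by
          rw [← Real.rpow_add hZ0]; norm_num
        have e2 : Z ^ (2 / 3 : ℝ) ≤ R ^ (2 / 3 : ℝ) := by gcongr
        calc 2 * M * Z = 2 * M * (Z ^ (2 / 3 : ℝ) * Z ^ (1 / 3 : ℝ)) := by rw [← e1]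
          _ ≤ 2 * M * (R ^ (2 / 3 : ℝ) * Z ^ (1 / 3 : ℝ)) := by gcongr
          _ = _ := by field_simp
  obtain ⟨W, B, hW, hWX, hWh⟩ := hmain
  have := window_count (P.image Prod.fst) g h B W (by linarith) hh0 hW hWX H
  refine this.trans ?_
  calc (W / h + 1) * (2 * (g + 1)) ≤ (2 * M / κ * R ^ (2 / 3 : ℝ) + R ^ (2 / 3 : ℝ)) * (2 * (g + 1)) := by
        gcongr
    _ = _ := by ring

theorem planar_half (b c : ℝ) (hb : 0 < b) (hc : 0 < c) : ∃ C : ℝ, 0 ≤ C ∧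
    ∀ (R A T : ℝ) (P : Finset (ℤ × ℤ)), 1 ≤ R →
      (∀ p ∈ P, |(p.1 : ℝ)| ≤ |(p.2 : ℝ)| ∧ A ≤ (p.1 : ℝ) ∧ (p.1 : ℝ) ≤ A + R ∧
        T ≤ b * (p.1 : ℝ) ^ 2 + c * (p.2 : ℝ) ^ 2 ∧
        b * (p.1 : ℝ) ^ 2 + c * (p.2 : ℝ) ^ 2 ≤ T + 1) →
      (P.card : ℝ) ≤ C * R ^ (2 / 3 : ℝ) := by
  obtain ⟨C, hC, H⟩ := planar_sector b c hb hc
  refine ⟨2 * C, by positivity, ?_⟩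
  intro R A T P hR hP
  have h1 := H R A T (P.filter (fun p => 0 ≤ p.2)) hR (by
    intro p hp
    rw [Finset.mem_filter] at hp
    have h0 : (0 : ℝ) ≤ p.2 := by exact_mod_cast hp.2
    have := hP p hp.1
    rw [abs_of_nonneg h0] at this
    exact this)
  have hinj : Function.Injective (fun p : ℤ × ℤ => (p.1, -p.2)) := by
    intro p q h
    simp only [Prod.mk.injEq, neg_inj] at h
    exact Prod.ext h.1 h.2
  have h2 := H R A T ((P.filter (fun p => ¬ 0 ≤ p.2)).image (fun p : ℤ × ℤ => (p.1, -p.2))) hR (by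
    intro p hp
    rw [Finset.mem_image] at hp
    obtain ⟨q, hq, rfl⟩ := hp
    rw [Finset.mem_filter] at hq
    have h0 : (q.2 : ℝ) ≤ 0 := by exact_mod_cast (not_le.1 hq.2).le
    have := hP q hq.1
    rw [abs_of_nonpos h0] at this
    simpa using this)
  rw [Finset.card_image_of_injective _ hinj] at h2
  have h3 := Finset.card_filter_add_card_filter_not (s := P) (fun p => 0 ≤ p.2)
  have h4 : ((P.filter (fun p => 0 ≤ p.2)).card : ℝ) +
      ((P.filter (fun p => ¬ 0 ≤ p.2)).card : ℝ) = P.card := by exact_mod_cast h3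
  linarith

theorem planar_full (b c : ℝ) (hb : 0 < b) (hc : 0 < c) : ∃ C : ℝ, 0 ≤ C ∧
    ∀ (R A B T : ℝ) (P : Finset (ℤ × ℤ)), 1 ≤ R →
      (∀ p ∈ P, (A ≤ (p.1 : ℝ) ∧ (p.1 : ℝ) ≤ A + R) ∧ (B ≤ (p.2 : ℝ) ∧ (p.2 : ℝ) ≤ B + R) ∧
        T ≤ b * (p.1 : ℝ) ^ 2 + c * (p.2 : ℝ) ^ 2 ∧
        b * (p.1 : ℝ) ^ 2 + c * (p.2 : ℝ) ^ 2 ≤ T + 1) →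
      (P.card : ℝ) ≤ C * R ^ (2 / 3 : ℝ) := by
  obtain ⟨C, hC, H⟩ := planar_half b c hb hc
  obtain ⟨C', hC', H'⟩ := planar_half c b hc hb
  refine ⟨C + C', by positivity, ?_⟩
  intro R A B T P hR hP
  have h1 := H R A T (P.filter (fun p => |p.1| ≤ |p.2|)) hR (by
    intro p hp
    rw [Finset.mem_filter] at hp
    have h0 : |(p.1 : ℝ)| ≤ |(p.2 : ℝ)| := by exact_mod_cast hp.2
    obtain ⟨u, v, w⟩ := hP p hp.1
    exact ⟨h0, u.1, u.2, w⟩)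
  have h2 := H' R B T ((P.filter (fun p => ¬ |p.1| ≤ |p.2|)).image Prod.swap) hR (by
    intro p hp
    rw [Finset.mem_image] at hp
    obtain ⟨q, hq, rfl⟩ := hp
    rw [Finset.mem_filter] at hq
    have h0 : |(q.2 : ℝ)| ≤ |(q.1 : ℝ)| := by exact_mod_cast (not_le.1 hq.2).le
    obtain ⟨u, v, w⟩ := hP q hq.1
    refine ⟨h0, v.1, v.2, ?_, ?_⟩ <;> simp only [Prod.fst_swap, Prod.snd_swap] <;> linarith [w.1, w.2])
  rw [Finset.card_image_of_injective _ Prod.swap_injective] at h2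
  have h3 := Finset.card_filter_add_card_filter_not (s := P) (fun p => |p.1| ≤ |p.2|)
  have h4 : ((P.filter (fun p => |p.1| ≤ |p.2|)).card : ℝ) +
      ((P.filter (fun p => ¬ |p.1| ≤ |p.2|)).card : ℝ) = P.card := by exact_mod_cast h3
  linarith

theorem planar_wide (b c : ℝ) (hb : 0 < b) (hc : 0 < c) : ∃ C : ℝ, 0 ≤ C ∧
    ∀ (R A B T D : ℝ) (P : Finset (ℤ × ℤ)), 1 ≤ R → 0 ≤ D →
      (∀ p ∈ P, (A ≤ (p.1 : ℝ) ∧ (p.1 : ℝ) ≤ A + R) ∧ (B ≤ (p.2 : ℝ) ∧ (p.2 : ℝ) ≤ B + R) ∧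
        T ≤ b * (p.1 : ℝ) ^ 2 + c * (p.2 : ℝ) ^ 2 ∧
        b * (p.1 : ℝ) ^ 2 + c * (p.2 : ℝ) ^ 2 ≤ T + D) →
      (P.card : ℝ) ≤ (D + 1) * (C * R ^ (2 / 3 : ℝ)) := by
  obtain ⟨C, hC, H⟩ := planar_full b c hb hc
  refine ⟨C, hC, ?_⟩
  intro R A B T D P hR hD hP
  refine card_fiber_real_le P (fun p => b * (p.1 : ℝ) ^ 2 + c * (p.2 : ℝ) ^ 2 - T) D _ hD ?_
    (by positivity) ?_
  · intro p hp
    obtain ⟨_, _, h1, h2⟩ := hP p hp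
    constructor <;> linarith
  · intro i
    apply H R A B (T + i) _ hR
    intro p hp
    rw [Finset.mem_filter] at hp
    obtain ⟨u, v, _, _⟩ := hP p hp.1
    have h1 := Int.floor_le (b * (p.1 : ℝ) ^ 2 + c * (p.2 : ℝ) ^ 2 - T)
    have h2 := Int.lt_floor_add_one (b * (p.1 : ℝ) ^ 2 + c * (p.2 : ℝ) ^ 2 - T)
    rw [hp.2] at h1 h2
    refine ⟨u, v, ?_, ?_⟩ <;> linarith

/-- The integer points of a cube. -/
noncomputable def ibox {e : ℕ} (A : Fin e → ℝ) (R : ℝ) : Finset (Fin e → ℤ) :=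
  Fintype.piFinset (fun j => Finset.Icc ⌈A j⌉ ⌊A j + R⌋)

theorem mem_ibox {e : ℕ} (A : Fin e → ℝ) (R : ℝ) (n : Fin e → ℤ) :
    n ∈ ibox A R ↔ ∀ j, A j ≤ (n j : ℝ) ∧ (n j : ℝ) ≤ A j + R := by
  simp only [ibox, Fintype.mem_piFinset, Finset.mem_Icc, Int.ceil_le, Int.le_floor]

theorem card_ibox {e : ℕ} (A : Fin e → ℝ) (R : ℝ) (hR : 0 ≤ R) :
    ((ibox A R).card : ℝ) ≤ (R + 1) ^ e := by
  rw [ibox, Fintype.card_piFinset]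
  push_cast
  calc _ ≤ ∏ _j : Fin e, (R + 1) := by
        apply Finset.prod_le_prod
        · intros; positivity
        · intro j _
          apply card_int_le _ _ hR
          intro x hx y hy
          rw [Finset.mem_Icc, Int.ceil_le, Int.le_floor] at hx hy
          linarith [hx.1, hy.2]
    _ = _ := by simp

theorem count_quad (e : ℕ) (β : Fin (e + 2) → ℝ) (hβ : ∀ j, 0 < β j) : ∃ C : ℝ, 0 ≤ C ∧
    ∀ (R T D : ℝ) (A : Fin (e + 2) → ℝ) (F : Finset (Fin (e + 2) → ℤ)), 1 ≤ R → 0 ≤ D →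
      (∀ n ∈ F, n ∈ ibox A R ∧ T ≤ ∑ j, β j * (n j : ℝ) ^ 2 ∧ ∑ j, β j * (n j : ℝ) ^ 2 ≤ T + D) →
      (F.card : ℝ) ≤ (R + 1) ^ e * ((D + 1) * (C * R ^ (2 / 3 : ℝ))) := by
  obtain ⟨C, hC, H⟩ := planar_wide (β 0) (β 1) (hβ _) (hβ _)
  refine ⟨C, hC, ?_⟩
  intro R T D A F hR hD hF
  refine card_fiber_le F (ibox (fun j => A j.succ.succ) R) (fun n j => n j.succ.succ) ?_ _ _
    (by positivity) (card_ibox _ _ (by linarith)) ?_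
  · intro n hn
    rw [mem_ibox]
    intro j
    exact (mem_ibox _ _ _).1 (hF n hn).1 j.succ.succ
  · intro i _
    have hinj : Set.InjOn (fun n : Fin (e + 2) → ℤ => (n 0, n 1))
        ((F.filter (fun n => (fun j : Fin e => n j.succ.succ) = i) :
          Finset (Fin (e + 2) → ℤ)) : Set (Fin (e + 2) → ℤ)) := by
      intro n hn m hm h
      simp only [Finset.coe_filter, Set.mem_ofPred_eq] at hn hm
      simp only [Prod.mk.injEq] at h
      funext j
      refine Fin.cases h.1 (fun j => ?_) j
      refine Fin.cases h.2 (fun j => ?_) j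
      exact congrFun (hn.2.trans hm.2.symm) j
    rw [← Finset.card_image_of_injOn hinj]
    apply H R (A 0) (A 1) (T - ∑ j : Fin e, β j.succ.succ * (i j : ℝ) ^ 2) D _ hR hD
    intro p hp
    simp only [Finset.mem_image, Finset.mem_filter] at hp
    obtain ⟨n, ⟨hn, hni⟩, rfl⟩ := hp
    obtain ⟨h1, h2, h3⟩ := hF n hn
    rw [mem_ibox] at h1
    rw [Fin.sum_univ_succ, Fin.sum_univ_succ] at h2 h3
    have e1 : ∑ j : Fin e, β j.succ.succ * (i j : ℝ) ^ 2 =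
        ∑ j : Fin e, β j.succ.succ * (n j.succ.succ : ℝ) ^ 2 := by rw [← hni]
    rw [e1]
    simp only [Fin.succ_zero_eq_one] at h2 h3
    refine ⟨h1 0, h1 1, ?_, ?_⟩ <;> linarith

theorem count_lin (e : ℕ) (w A : Fin (e + 1) → ℝ) (i : Fin (e + 1)) (R T D : ℝ)
    (F : Finset (Fin (e + 1) → ℤ)) (hw : w i ≠ 0) (hR : 0 ≤ R) (hD : 0 ≤ D)
    (hF : ∀ n ∈ F, n ∈ ibox A R ∧ |∑ j, w j * (n j : ℝ) - T| ≤ D) :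
    (F.card : ℝ) ≤ (R + 1) ^ e * (2 * D / |w i| + 1) := by
  have hw0 : 0 < |w i| := abs_pos.2 hw
  refine card_fiber_le F (ibox (fun j => A (i.succAbove j)) R) (fun n j => n (i.succAbove j)) ?_ _ _
    (by positivity) (card_ibox _ _ hR) ?_
  · intro n hn
    rw [mem_ibox]
    intro j
    exact (mem_ibox _ _ _).1 (hF n hn).1 (i.succAbove j)
  · intro a _
    have hinj : Set.InjOn (fun n : Fin (e + 1) → ℤ => n i)
        ((F.filter (fun n => (fun j : Fin e => n (i.succAbove j)) = a) :
          Finset (Fin (e + 1) → ℤ)) : Set (Fin (e + 1) → ℤ)) := by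
      intro n hn m hm h
      simp only [Finset.coe_filter, Set.mem_ofPred_eq] at hn hm
      funext j
      refine Fin.succAboveCases i h (fun j => ?_) j
      exact congrFun (hn.2.trans hm.2.symm) j
    rw [← Finset.card_image_of_injOn hinj]
    apply card_int_le _ _ (by positivity)
    intro x hx y hy
    simp only [Finset.mem_image, Finset.mem_filter] at hx hy
    obtain ⟨n, ⟨hn, hna⟩, rfl⟩ := hx
    obtain ⟨m, ⟨hm, hma⟩, rfl⟩ := hy
    have h1 := (hF n hn).2
    have h2 := (hF m hm).2
    rw [Fin.sum_univ_succAbove _ i] at h1 h2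
    have e1 : ∑ j : Fin e, w (i.succAbove j) * (n (i.succAbove j) : ℝ) =
        ∑ j : Fin e, w (i.succAbove j) * (m (i.succAbove j) : ℝ) := by
      apply Finset.sum_congr rfl
      intro j _
      rw [congrFun (hna.trans hma.symm) j]
    rw [e1] at h1
    rw [le_div_iff₀ hw0]
    have h3 : |w i * ((m i : ℝ) - n i)| ≤ 2 * D := by
      rw [abs_le] at h1 h2 ⊢
      constructor <;> linarith [h1.1, h1.2, h2.1, h2.2]
    rw [abs_mul] at h3
    calc ((m i : ℝ) - n i) * |w i| ≤ |(m i : ℝ) - n i| * |w i| := by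
          gcongr; exact le_abs_self _
      _ ≤ _ := by linarith

theorem count_inj {α ι : Type*} (S : Set α) (F : Finset ι) (f : α → ι)
    (hf : ∀ x ∈ S, f x ∈ F) (hinj : ∀ x ∈ S, ∀ y ∈ S, f x = f y → x = y) :
    S.Finite ∧ S.ncard ≤ F.card := by
  have hm : Set.MapsTo f S (F : Set ι) := fun x hx => hf x hx
  have hi : Set.InjOn f S := fun x hx y hy h => hinj x hx y hy h
  refine ⟨Set.Finite.of_injOn hm hi F.finite_toSet, ?_⟩
  have := Set.ncard_le_ncard_of_injOn f hf hi F.finite_toSet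
  rwa [Set.ncard_coe_finset] at this

theorem coord_le {d : ℕ} (x : Fin d → ℝ) (h : euclNorm x ≤ 1) (j : Fin d) : |x j| ≤ 1 := by
  unfold euclNorm at h
  rw [Real.sqrt_le_one] at h
  have h1 : x j ^ 2 ≤ ∑ i, x i ^ 2 :=
    Finset.single_le_sum (f := fun i => x i ^ 2) (fun i _ => sq_nonneg _) (Finset.mem_univ j)
  exact (sq_le_one_iff_abs_le_one _).1 (h1.trans h)

theorem floor_lattice {d : ℕ} {L : ℝ} (hL : 0 < L) {x : Fin d → ℝ} (h : isLatticeVec d L x)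
    (j : Fin d) : ((⌊L * x j⌋ : ℤ) : ℝ) = L * x j := by
  obtain ⟨m, hm⟩ := h j
  have : L * x j = m := by rw [hm]; field_simp
  rw [this, Int.floor_intCast]

theorem lattice_sub {d : ℕ} {L : ℝ} {x y : Fin d → ℝ} (hx : isLatticeVec d L x)
    (hy : isLatticeVec d L y) : isLatticeVec d L (x - y) := by
  intro j
  obtain ⟨m, hm⟩ := hx j
  obtain ⟨n, hn⟩ := hy j
  exact ⟨m - n, by rw [Pi.sub_apply, hm, hn]; push_cast; ring⟩

theorem count_opp (e : ℕ) (β : Fin (e + 1) → ℝ) (hβ : ∀ j, 0 < β j) (L δ : ℝ) (hL : 2 ≤ L)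
    (hδ : 0 < δ) (hδ1 : δ ≤ 1) (ζ : ℝ) (hζ : ζ = 1 ∨ ζ = -1) (a₁ a₂ k : Fin (e + 1) → ℝ)
    (hk : isLatticeVec (e + 1) L k) (γ : ℝ) :
    (twoVecSet (e + 1) β L δ ζ (-ζ) a₁ a₂ k γ).Finite ∧
    ((twoVecSet (e + 1) β L δ ζ (-ζ) a₁ a₂ k γ).ncard : ℝ) ≤
      (3 * L) ^ e * (δ⁻¹ * (∑ j, (β j)⁻¹ + 1)) := by
  classical
  have hL0 : 0 < L := by linarith
  have hδi : 1 ≤ δ⁻¹ := (one_le_inv₀ hδ).2 hδ1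
  have hζ2 : ζ * ζ = 1 := by rcases hζ with rfl | rfl <;> norm_num
  have hβs : 0 ≤ ∑ j, (β j)⁻¹ := Finset.sum_nonneg (fun j _ => (inv_pos.2 (hβ j)).le)
  have hdiff : ∀ x ∈ twoVecSet (e + 1) β L δ ζ (-ζ) a₁ a₂ k γ, ∀ j, x.2 j = x.1 j - ζ * k j := by
    intro x hx j
    have := hx.2.2.2.2.1 j
    linear_combination -ζ * this + (x.1 j - x.2 j) * hζ2
  by_cases hk0 : k = 0
  · have : twoVecSet (e + 1) β L δ ζ (-ζ) a₁ a₂ k γ = ∅ := by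
      rw [Set.eq_empty_iff_forall_notMem]
      intro x hx
      apply hx.2.2.2.2.2.2 (by ring)
      funext j
      rw [hdiff x hx j, hk0]; simp
    rw [this]
    refine ⟨Set.finite_empty, ?_⟩
    simp only [Set.ncard_empty, Nat.cast_zero]
    positivity
  obtain ⟨i, hi⟩ : ∃ i, k i ≠ 0 := by
    by_contra hc
    push Not at hc
    exact hk0 (funext hc)
  have hki : 1 ≤ L * |k i| := by
    obtain ⟨m, hm⟩ := hk i
    have hm0 : m ≠ 0 := by
      rintro rfl
      apply hi; rw [hm]; simp
    have : (1 : ℝ) ≤ |(m : ℝ)| := by exact_mod_cast Int.one_le_abs hm0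
    rw [hm, abs_div, abs_of_pos hL0]
    field_simp
    exact this
  set w : Fin (e + 1) → ℝ := fun j => 2 * β j * (ζ * k j) with hw
  set T : ℝ := L * (∑ j, β j * k j ^ 2 + ζ * γ) with hT
  set A : Fin (e + 1) → ℝ := fun j => L * a₁ j - L with hA
  set F : Finset (Fin (e + 1) → ℤ) := (ibox A (2 * L)).filter
    (fun n => |∑ j, w j * (n j : ℝ) - T| ≤ δ⁻¹ * L⁻¹) with hFdef
  have hcount := count_inj (twoVecSet (e + 1) β L δ ζ (-ζ) a₁ a₂ k γ) F
    (fun x j => ⌊L * x.1 j⌋) (by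
      intro x hx
      have hx' := hx
      obtain ⟨h1, h2, h3, h4, h5, h6, h7⟩ := hx'
      rw [hFdef, Finset.mem_filter, mem_ibox]
      constructor
      · intro j
        rw [floor_lattice hL0 h1]
        have := abs_le.1 (coord_le _ h3 j)
        rw [Pi.sub_apply] at this
        simp only [hA]
        constructor <;> nlinarith [this.1, this.2]
      · have e1 : ∑ j, w j * ((⌊L * x.1 j⌋ : ℤ) : ℝ) - T =
            L * (ζ * (ζ * wnormSq β x.1 + (-ζ) * wnormSq β x.2 - γ)) := by
          have e2 : wnormSq β x.2 = ∑ j, β j * (x.1 j - ζ * k j) ^ 2 := by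
            unfold wnormSq
            exact Finset.sum_congr rfl (fun j _ => by rw [hdiff x hx j])
          have e3 : wnormSq β x.1 - wnormSq β x.2 + ∑ j, β j * k j ^ 2 =
              ∑ j, 2 * β j * (ζ * k j) * x.1 j := by
            rw [e2]; unfold wnormSq
            rw [← Finset.sum_sub_distrib, ← Finset.sum_add_distrib]
            apply Finset.sum_congr rfl
            intro j _
            linear_combination -(β j * k j ^ 2) * hζ2
          have e4 : ∑ j, w j * ((⌊L * x.1 j⌋ : ℤ) : ℝ) = L * ∑ j, 2 * β j * (ζ * k j) * x.1 j := by
            rw [Finset.mul_sum]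
            apply Finset.sum_congr rfl
            intro j _
            rw [floor_lattice hL0 h1]; ring
          rw [e4, ← e3, hT]
          linear_combination -(L * (wnormSq β x.1 - wnormSq β x.2)) * hζ2
        rw [e1, abs_mul, abs_mul, abs_of_pos hL0]
        have : |ζ| = 1 := by rcases hζ with rfl | rfl <;> simp
        rw [this, one_mul]
        calc L * _ ≤ L * (δ⁻¹ * (L ^ 2)⁻¹) := by gcongr
          _ = δ⁻¹ * L⁻¹ := by field_simp) (by
      intro x hx y hy h
      have h1 : x.1 = y.1 := by
        funext j
        have := congrArg (fun z : ℤ => (z : ℝ)) (congrFun h j)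
        rw [floor_lattice hL0 hx.1, floor_lattice hL0 hy.1] at this
        exact mul_left_cancel₀ hL0.ne' this
      refine Prod.ext h1 ?_
      funext j
      rw [hdiff x hx j, hdiff y hy j, h1])
  refine ⟨hcount.1, ?_⟩
  have hwi : |w i| = 2 * β i * |k i| := by
    have : |ζ| = 1 := by rcases hζ with rfl | rfl <;> simp
    rw [hw]
    simp only [abs_mul]
    rw [this, abs_of_pos (hβ i)]; norm_num
  have hkp : 0 < |k i| := abs_pos.2 hi
  have hwp : 0 < |w i| := by rw [hwi]; have := hβ i; positivity
  have hlin := count_lin e w A i (2 * L) T (δ⁻¹ * L⁻¹) F (abs_pos.1 hwp) (by positivity)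
    (by positivity) (by
      intro n hn
      rw [hFdef, Finset.mem_filter] at hn
      exact hn)
  have hc2 : ((twoVecSet (e + 1) β L δ ζ (-ζ) a₁ a₂ k γ).ncard : ℝ) ≤ F.card := by
    exact_mod_cast hcount.2
  refine (hc2.trans hlin).trans ?_
  have hq : 2 * (δ⁻¹ * L⁻¹) / |w i| ≤ δ⁻¹ * (β i)⁻¹ := by
    rw [div_le_iff₀ hwp, hwi]
    have hbi := hβ i
    have : δ⁻¹ * (β i)⁻¹ * (2 * β i * |k i|) = 2 * (δ⁻¹ * L⁻¹) * (L * |k i|) := by field_simp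
    rw [this]
    exact le_mul_of_one_le_right (by positivity) hki
  have hbs : (β i)⁻¹ ≤ ∑ j, (β j)⁻¹ :=
    Finset.single_le_sum (f := fun j => (β j)⁻¹) (fun j _ => (inv_pos.2 (hβ j)).le)
      (Finset.mem_univ i)
  have hq2 : δ⁻¹ * (β i)⁻¹ ≤ δ⁻¹ * ∑ j, (β j)⁻¹ := by gcongr
  gcongr
  · linarith
  · linarith

theorem count_same (e : ℕ) (β : Fin (e + 2) → ℝ) (hβ : ∀ j, 0 < β j) : ∃ C : ℝ, 0 ≤ C ∧
    ∀ (L δ : ℝ), 2 ≤ L → 0 < δ → δ ≤ 1 → ∀ ζ : ℝ, (ζ = 1 ∨ ζ = -1) →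
    ∀ (a₁ a₂ k : Fin (e + 2) → ℝ) (γ : ℝ),
    (twoVecSet (e + 2) β L δ ζ ζ a₁ a₂ k γ).Finite ∧
    ((twoVecSet (e + 2) β L δ ζ ζ a₁ a₂ k γ).ncard : ℝ) ≤
      (5 * L) ^ e * ((5 * δ⁻¹) * (C * (4 * L) ^ (2 / 3 : ℝ))) := by
  classical
  obtain ⟨C, hC, H⟩ := count_quad e β hβ
  refine ⟨C, hC, ?_⟩
  intro L δ hL hδ hδ1 ζ hζ a₁ a₂ k γ
  have hL0 : 0 < L := by linarith
  have hδi : 1 ≤ δ⁻¹ := (one_le_inv₀ hδ).2 hδ1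
  have hζ2 : ζ * ζ = 1 := by rcases hζ with rfl | rfl <;> norm_num
  have hsum : ∀ x ∈ twoVecSet (e + 2) β L δ ζ ζ a₁ a₂ k γ, ∀ j, x.1 j + x.2 j = ζ * k j := by
    intro x hx j
    have := hx.2.2.2.2.1 j
    linear_combination ζ * this - (x.1 j + x.2 j) * hζ2
  set T : ℝ := L ^ 2 * (2 * (ζ * γ) - ∑ j, β j * k j ^ 2) - 2 * δ⁻¹ with hT
  set A : Fin (e + 2) → ℝ := fun j => L * (a₁ j - a₂ j) - 2 * L with hA
  set F : Finset (Fin (e + 2) → ℤ) := (ibox A (4 * L)).filter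
    (fun n => T ≤ ∑ j, β j * (n j : ℝ) ^ 2 ∧ ∑ j, β j * (n j : ℝ) ^ 2 ≤ T + 4 * δ⁻¹) with hFdef
  have hcount := count_inj (twoVecSet (e + 2) β L δ ζ ζ a₁ a₂ k γ) F
    (fun x j => ⌊L * (x.1 - x.2) j⌋) (by
      intro x hx
      have hx' := hx
      obtain ⟨h1, h2, h3, h4, h5, h6, h7⟩ := hx'
      have hl := lattice_sub h1 h2
      rw [hFdef, Finset.mem_filter, mem_ibox]
      constructor
      · intro j
        rw [floor_lattice hL0 hl]
        have t1 := abs_le.1 (coord_le _ h3 j)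
        have t2 := abs_le.1 (coord_le _ h4 j)
        rw [Pi.sub_apply] at t1 t2 ⊢
        simp only [hA]
        constructor <;> nlinarith [t1.1, t1.2, t2.1, t2.2]
      · have e1 : ∑ j, β j * ((⌊L * (x.1 - x.2) j⌋ : ℤ) : ℝ) ^ 2 =
            L ^ 2 * (2 * (ζ * (ζ * wnormSq β x.1 + ζ * wnormSq β x.2 - γ))) + (T + 2 * δ⁻¹) := by
          have e3 : 2 * wnormSq β x.1 + 2 * wnormSq β x.2 - ∑ j, β j * k j ^ 2 =
              ∑ j, β j * (x.1 j - x.2 j) ^ 2 := by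
            unfold wnormSq
            rw [Finset.mul_sum, Finset.mul_sum, ← Finset.sum_add_distrib, ← Finset.sum_sub_distrib]
            apply Finset.sum_congr rfl
            intro j _
            have := hsum x hx j
            linear_combination β j * (x.1 j + x.2 j + ζ * k j) * this + (β j * k j ^ 2) * hζ2
          have e4 : ∑ j, β j * ((⌊L * (x.1 - x.2) j⌋ : ℤ) : ℝ) ^ 2 =
              L ^ 2 * ∑ j, β j * (x.1 j - x.2 j) ^ 2 := by
            rw [Finset.mul_sum]
            apply Finset.sum_congr rfl
            intro j _
            rw [floor_lattice hL0 hl, Pi.sub_apply]; ring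
          rw [e4, ← e3, hT]
          linear_combination -(2 * L ^ 2 * (wnormSq β x.1 + wnormSq β x.2)) * hζ2
        have e5 : |L ^ 2 * (2 * (ζ * (ζ * wnormSq β x.1 + ζ * wnormSq β x.2 - γ)))| ≤ 2 * δ⁻¹ := by
          have : |ζ| = 1 := by rcases hζ with rfl | rfl <;> simp
          rw [abs_mul, abs_mul, abs_mul, this, one_mul, abs_of_pos (show 0 < L ^ 2 by positivity),
            abs_of_pos (show (0 : ℝ) < 2 by norm_num)]
          calc L ^ 2 * (2 * _) ≤ L ^ 2 * (2 * (δ⁻¹ * (L ^ 2)⁻¹)) := by gcongr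
            _ = _ := by field_simp
        rw [abs_le] at e5
        rw [e1]
        constructor <;> linarith [e5.1, e5.2]) (by
      intro x hx y hy h
      have h0 : ∀ j, x.1 j - x.2 j = y.1 j - y.2 j := by
        intro j
        have := congrArg (fun z : ℤ => (z : ℝ)) (congrFun h j)
        rw [floor_lattice hL0 (lattice_sub hx.1 hx.2.1),
          floor_lattice hL0 (lattice_sub hy.1 hy.2.1)] at this
        exact mul_left_cancel₀ hL0.ne' this
      refine Prod.ext ?_ ?_ <;> funext j <;>
        linarith [h0 j, hsum x hx j, hsum y hy j])
  refine ⟨hcount.1, ?_⟩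
  have hq := H (4 * L) T (4 * δ⁻¹) A F (by linarith) (by positivity) (by
      intro n hn
      rw [hFdef, Finset.mem_filter] at hn
      exact hn)
  have hc2 : ((twoVecSet (e + 2) β L δ ζ ζ a₁ a₂ k γ).ncard : ℝ) ≤ F.card := by
    exact_mod_cast hcount.2
  refine (hc2.trans hq).trans ?_
  gcongr <;> linarith

/-- Lemma A.7 (1) of Deng–Hani (two-vector counting): for `d ≥ 3` and `β ∈ (ℝ⁺)^d` there is
`C = C(d, β)` such that for all `L ≥ 2`, `δ ∈ (0,1]`, signs `ζ₁, ζ₂ ∈ {±1}`, lattice points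
`a₁, a₂, k` and `γ ∈ ℝ`, the number of pairs `(x₁, x₂) ∈ (Z_L^d)²` with `|x_j - a_j| ≤ 1`,
`ζ₁x₁ + ζ₂x₂ = k`, `|ζ₁|x₁|_β² + ζ₂|x₂|_β² - γ| ≤ δ⁻¹L⁻²` (and `x₁ ≠ x₂ if ζ₁ + ζ₂ = 0`)
is at most `C δ⁻¹ L^{d-1}`, and at most `C δ⁻¹ L^{d-1-1/3}` when `ζ₁ = ζ₂`. -/
theorem two_vector_counting (d : ℕ) (hd : 3 ≤ d) (β : Fin d → ℝ) (hβ : ∀ j, 0 < β j) :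
    ∃ C : ℝ, ∀ L δ : ℝ, 2 ≤ L → 0 < δ → δ ≤ 1 →
      ∀ ζ₁ ζ₂ : ℝ, (ζ₁ = 1 ∨ ζ₁ = -1) → (ζ₂ = 1 ∨ ζ₂ = -1) →
      ∀ a₁ a₂ k : Fin d → ℝ, isLatticeVec d L a₁ → isLatticeVec d L a₂ →
        isLatticeVec d L k → ∀ γ : ℝ,
        (twoVecSet d β L δ ζ₁ ζ₂ a₁ a₂ k γ).Finite ∧
        ((twoVecSet d β L δ ζ₁ ζ₂ a₁ a₂ k γ).ncard : ℝ) ≤ C * δ⁻¹ * L ^ ((d : ℝ) - 1) ∧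
        (ζ₁ = ζ₂ →
          ((twoVecSet d β L δ ζ₁ ζ₂ a₁ a₂ k γ).ncard : ℝ) ≤
            C * δ⁻¹ * L ^ ((d : ℝ) - 1 - 1 / 3)) := by
  obtain ⟨e, rfl⟩ : ∃ e, d = e + 2 := ⟨d - 2, by omega⟩
  obtain ⟨C, hC, H⟩ := count_same e β hβ
  have hβs : 0 ≤ ∑ j, (β j)⁻¹ := Finset.sum_nonneg (fun j _ => (inv_pos.2 (hβ j)).le)
  refine ⟨5 ^ e * (5 * (C * 4 ^ (2 / 3 : ℝ))) + 3 ^ (e + 1) * (∑ j, (β j)⁻¹ + 1), ?_⟩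
  intro L δ hL hδ hδ1 ζ₁ ζ₂ hζ₁ hζ₂ a₁ a₂ k _ _ hk γ
  have hL0 : 0 < L := by linarith
  have hL1 : 1 ≤ L := by linarith
  have hδ0 : 0 < δ⁻¹ := inv_pos.2 hδ
  by_cases hs : ζ₁ = ζ₂
  · subst hs
    obtain ⟨h1, h2⟩ := H L δ hL hδ hδ1 ζ₁ hζ₁ a₁ a₂ k γ
    have e1 : (5 * L) ^ e * ((5 * δ⁻¹) * (C * (4 * L) ^ (2 / 3 : ℝ))) =
        (5 ^ e * (5 * (C * 4 ^ (2 / 3 : ℝ)))) * δ⁻¹ * L ^ (((e + 2 : ℕ) : ℝ) - 1 - 1 / 3) := by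
      have : L ^ (((e + 2 : ℕ) : ℝ) - 1 - 1 / 3) = L ^ e * L ^ (2 / 3 : ℝ) := by
        rw [← Real.rpow_natCast L e, ← Real.rpow_add hL0]
        congr 1; push_cast; ring
      rw [this, mul_pow, Real.mul_rpow (by norm_num) hL0.le]; ring
    have h3 : ((twoVecSet (e + 2) β L δ ζ₁ ζ₁ a₁ a₂ k γ).ncard : ℝ) ≤
        (5 ^ e * (5 * (C * 4 ^ (2 / 3 : ℝ))) + 3 ^ (e + 1) * (∑ j, (β j)⁻¹ + 1)) * δ⁻¹ *
          L ^ (((e + 2 : ℕ) : ℝ) - 1 - 1 / 3) := by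
      rw [e1] at h2
      refine h2.trans ?_
      gcongr
      exact le_add_of_nonneg_right (by positivity)
    refine ⟨h1, h3.trans ?_, fun _ => h3⟩
    exact mul_le_mul_of_nonneg_left (Real.rpow_le_rpow_of_exponent_le hL1 (by linarith))
      (by positivity)
  · have hs' : ζ₂ = -ζ₁ := by
      rcases hζ₁ with rfl | rfl <;> rcases hζ₂ with rfl | rfl <;> simp_all
    subst hs'
    obtain ⟨h1, h2⟩ := count_opp (e + 1) β hβ L δ hL hδ hδ1 ζ₁ hζ₁ a₁ a₂ k hk γ
    refine ⟨h1, h2.trans ?_, fun h => absurd h hs⟩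
    have : L ^ (((e + 2 : ℕ) : ℝ) - 1) = L ^ (e + 1) := by
      rw [← Real.rpow_natCast L (e + 1)]
      congr 1; push_cast; ring
    rw [this, mul_pow]
    calc 3 ^ (e + 1) * L ^ (e + 1) * (δ⁻¹ * (∑ j, (β j)⁻¹ + 1)) =
        (3 ^ (e + 1) * (∑ j, (β j)⁻¹ + 1)) * δ⁻¹ * L ^ (e + 1) := by ring
      _ ≤ _ := by
        gcongr
        exact le_add_of_nonneg_left (by positivity)

end WKE
end

section
/- Let d ≥ 3 and let β ∈ (ℝ⁺)^d satisfy: (G1) there is c > 0 such that |β¹K¹ + β²K²| ≥ c (1+|K¹|+|K²|)⁻¹ (log(2+|K¹|+|K²|))⁻⁴ for all integers (K¹,K²) ≠ (0,0); and (G2) there is C₀ such that for every R ≥ 1 the number of triples (X,Y,Z) ∈ (ℤ^d)³ with |X|,|Y|,|Z| ≤ R, X ≠ 0 and max(|⟨X,Y⟩_β|, |⟨X,Z⟩_β|) ≤ 1 is at most C₀ R^{3d−4+1/6}. Then there is a constant C, depending only on d, β, c and C₀, such that for all L ≥ 2, all δ ∈ (0,1], all signs ζ₁,ζ₂,ζ₃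 ∈ {+1,−1} that are not all equal, all a₁,a₂,a₃,k ∈ Z_L^d and all γ ∈ ℝ, the number of triples (x₁,x₂,x₃) ∈ (Z_L^d)³ with |x_j − a_j| ≤ 1 for each j, ζ₁x₁+ζ₂x₂+ζ₃x₃ = k, |ζ₁|x₁|_β² + ζ₂|x₂|_β² + ζ₃|x₃|_β² − γ| ≤ δ⁻¹L⁻², and x_j ≠ x_{j'} whenever ζ_j + ζ_{j'} = 0, is at most C δ⁻¹ L^{2d−2}. -/
namespace WKE

/-- The counting set of Lemma A.7 (2) of Deng–Hani (three-vector counting). -/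
def threeVecSet (d : ℕ) (β : Fin d → ℝ) (L δ : ℝ) (ζ : Fin 3 → ℝ) (a : Fin 3 → Fin d → ℝ)
    (k : Fin d → ℝ) (γ : ℝ) : Set (Fin 3 → Fin d → ℝ) :=
  {x | (∀ j, isLatticeVec d L (x j)) ∧ (∀ j, euclNorm (x j - a j) ≤ 1) ∧
    (∀ i, ∑ j, ζ j * x j i = k i) ∧
    |∑ j, ζ j * wnormSq β (x j) - γ| ≤ δ⁻¹ * (L ^ 2)⁻¹ ∧
    (∀ j j', ζ j + ζ j' = 0 → x j ≠ x j')}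

section helpers
open Finset

lemma div_gcd_dvd_of (a b c : ℤ) (ha : a ≠ 0) (h : a ∣ b * c) : a / (Int.gcd a b : ℤ) ∣ c := by
  have hg : (Int.gcd a b : ℤ) ≠ 0 := by
    simp [Int.gcd_eq_zero_iff, ha]
  have hco : IsCoprime (a / (Int.gcd a b : ℤ)) (b / (Int.gcd a b : ℤ)) := by
    rw [Int.isCoprime_iff_gcd_eq_one]
    exact Int.gcd_ediv_gcd_ediv_gcd (Nat.pos_of_ne_zero (by exact_mod_cast hg))
  apply hco.dvd_of_dvd_mul_left
  obtain ⟨a', ha'⟩ := Int.gcd_dvd_left a b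
  obtain ⟨b', hb'⟩ := Int.gcd_dvd_right a b
  obtain ⟨k, hk⟩ := h
  have h1 : a / (Int.gcd a b : ℤ) = a' := Int.ediv_eq_of_eq_mul_right hg ha'
  have h2 : b / (Int.gcd a b : ℤ) = b' := Int.ediv_eq_of_eq_mul_right hg hb'
  rw [h1, h2]
  refine ⟨k, ?_⟩
  apply mul_left_cancel₀ hg
  rw [← mul_assoc, ← mul_assoc, ← hb', ← ha', hk]

/-- a set in `[-M, M]` with differences divisible by `r` has at most `2M/r + 1` elements. -/
lemma card_mod (M : ℕ) (r : ℤ) (hr : 0 < r) (s : Finset ℤ) (hs : ∀ z ∈ s, |z| ≤ M)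
    (hd : ∀ z ∈ s, ∀ w ∈ s, r ∣ z - w) : (s.card : ℝ) ≤ 2 * M / r + 1 := by
  rcases s.eq_empty_or_nonempty with rfl | hne
  · simp; positivity
  have hr' : (0:ℝ) < r := by exact_mod_cast hr
  set z0 := s.min' hne
  have hz0 : z0 ∈ s := s.min'_mem hne
  have key : s.card ≤ (Finset.Icc (0:ℤ) (2 * M / r)).card := by
    apply Finset.card_le_card_of_injOn (fun z => (z - z0) / r)
    · intro z hz
      have hz : z ∈ s := hz
      have h1 : z0 ≤ z := s.min'_le z hz
      have h2 := abs_le.1 (hs z hz)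
      have h3 := abs_le.1 (hs z0 hz0)
      simp only [coe_Icc, Set.mem_Icc]
      constructor
      · apply Int.ediv_nonneg <;> omega
      · apply Int.ediv_le_ediv hr; omega
    · intro z hz w hw h
      have h1 := Int.ediv_mul_cancel (hd z hz z0 hz0)
      have h2 := Int.ediv_mul_cancel (hd w hw z0 hz0)
      simp only at h
      rw [h, h2] at h1
      omega
  have h4 : ((Finset.Icc (0:ℤ) (2 * M / r)).card : ℝ) = ((2 * M / r : ℤ) : ℝ) + 1 := by
    rw [Int.card_Icc]
    have : (0:ℤ) ≤ 2 * M / r := by positivity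
    have h5 : (((2 * M / r + 1 - 0).toNat : ℤ)) = 2 * M / r + 1 := by
      rw [Int.toNat_of_nonneg]; ring; omega
    exact_mod_cast h5
  have h6 : ((2 * M / r : ℤ) : ℝ) ≤ 2 * M / r := by
    rw [le_div_iff₀ hr']
    exact_mod_cast Int.ediv_mul_le (2 * (M:ℤ)) hr.ne'
  have key' : (s.card : ℝ) ≤ ((Finset.Icc (0:ℤ) (2 * M / r)).card : ℝ) := Nat.cast_le.2 key
  rw [h4] at key'
  linarith

noncomputable abbrev box (M : ℕ) : Finset ℤ := Finset.Icc (-(M:ℤ)) M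

lemma count_z (M : ℕ) (x₁ x₂ x₃ : ℤ) (h3 : 0 < x₃) (hM : x₃ ≤ M) :
    ((((box M) ×ˢ (box M) ×ˢ (box M)).filter
      (fun z => x₁ * z.1 + x₂ * z.2.1 + x₃ * z.2.2 = 0)).card : ℝ)
      ≤ 4 * M ^ 2 * ((Int.gcd (Int.gcd x₃ x₂) x₁ : ℤ) / x₃ : ℝ) + 5 * M := by
  set S := ((box M) ×ˢ (box M) ×ˢ (box M)).filter
      (fun z => x₁ * z.1 + x₂ * z.2.1 + x₃ * z.2.2 = 0) with hS
  set h : ℤ := (Int.gcd x₃ x₂ : ℤ) with hh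
  have hhpos : 0 < h := by
    rw [hh]; exact_mod_cast Int.gcd_pos_of_ne_zero_left _ h3.ne'
  set g : ℤ := (Int.gcd h x₁ : ℤ) with hg
  have hgpos : 0 < g := by
    rw [hg]; exact_mod_cast Int.gcd_pos_of_ne_zero_left _ hhpos.ne'
  obtain ⟨u, hu⟩ : h ∣ x₃ := Int.gcd_dvd_left _ _
  obtain ⟨v, hv⟩ : g ∣ h := Int.gcd_dvd_left _ _
  have hx2 : h ∣ x₂ := Int.gcd_dvd_right _ _
  have hu0 : 0 < u := by
    rcases lt_trichotomy u 0 with h' | h' | h'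
    · nlinarith
    · subst h'; simp at hu; omega
    · exact h'
  have hv0 : 0 < v := by
    rcases lt_trichotomy v 0 with h' | h' | h'
    · nlinarith
    · subst h'; simp at hv; omega
    · exact h'
  have memS : ∀ z ∈ S, (|z.1| ≤ M ∧ |z.2.1| ≤ M) ∧ x₁ * z.1 + x₂ * z.2.1 + x₃ * z.2.2 = 0 := by
    intro z hz
    simp only [hS, box, mem_filter, mem_product, mem_Icc] at hz
    refine ⟨⟨abs_le.2 hz.1.1, abs_le.2 hz.1.2.1⟩, hz.2⟩
  have hv' : h / g = v := Int.ediv_eq_of_eq_mul_right hgpos.ne' hv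
  have hu' : x₃ / h = u := Int.ediv_eq_of_eq_mul_right hhpos.ne' hu
  have himg : ((S.image Prod.fst).card : ℝ) ≤ 2 * M / v + 1 := by
    have hdv : ∀ z ∈ S.image Prod.fst, |z| ≤ M ∧ v ∣ z := by
      intro z hz
      obtain ⟨w, hw, rfl⟩ := mem_image.1 hz
      obtain ⟨hb, he⟩ := memS w hw
      refine ⟨hb.1, ?_⟩
      rw [← hv']
      apply div_gcd_dvd_of h x₁ _ hhpos.ne'
      have : x₁ * w.1 = - (x₂ * w.2.1) - x₃ * w.2.2 := by linarith
      rw [this]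
      apply dvd_sub
      · exact (hx2.mul_right _).neg_right
      · exact (Dvd.intro _ hu.symm).mul_right _
    apply card_mod M v hv0
    · exact fun z hz => (hdv z hz).1
    · intro z hz w hw
      exact dvd_sub (hdv z hz).2 (hdv w hw).2
  have hfib : ∀ b ∈ S.image Prod.fst, (((S.filter (fun z => z.1 = b)).card : ℕ) : ℝ) ≤ 2 * M / u + 1 := by
    intro b _
    have h1 : (S.filter (fun z => z.1 = b)).card = ((S.filter (fun z => z.1 = b)).image (fun z => z.2.1)).card := by
      rw [Finset.card_image_of_injOn]
      intro z hz w hw hzw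
      simp only [coe_filter, Set.mem_ofPred_eq] at hz hw
      simp only at hzw
      have e1 := (memS z hz.1).2
      have e2 := (memS w hw.1).2
      rw [hz.2, hzw] at e1
      rw [hw.2] at e2
      have e3 : x₃ * z.2.2 = x₃ * w.2.2 := by linarith
      have e4 := mul_left_cancel₀ h3.ne' e3
      ext
      · rw [hz.2, hw.2]
      · exact hzw
      · exact e4
    rw [h1]
    apply card_mod M u hu0
    · intro z hz
      obtain ⟨w, hw, rfl⟩ := mem_image.1 hz
      exact (memS w (mem_filter.1 hw).1).1.2
    · intro z hz z' hz'
      obtain ⟨w, hw, rfl⟩ := mem_image.1 hz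
      obtain ⟨w', hw', rfl⟩ := mem_image.1 hz'
      rw [mem_filter] at hw hw'
      have e1 := (memS w hw.1).2
      have e2 := (memS w' hw'.1).2
      rw [hw.2] at e1
      rw [hw'.2] at e2
      rw [← hu']
      apply div_gcd_dvd_of x₃ x₂ _ h3.ne'
      refine ⟨w'.2.2 - w.2.2, ?_⟩
      linarith
  have hc : (S.card : ℝ) ≤ (2 * M / v + 1) * (2 * M / u + 1) := by
    have := Finset.card_eq_sum_card_image Prod.fst S
    rw [this]; push_cast
    calc _ ≤ ∑ b ∈ S.image Prod.fst, (2 * (M:ℝ) / u + 1) := Finset.sum_le_sum hfib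
      _ = (S.image Prod.fst).card * (2 * (M:ℝ) / u + 1) := by simp; ring
      _ ≤ _ := by
        apply mul_le_mul_of_nonneg_right himg
        have : (0:ℝ) < u := by exact_mod_cast hu0
        positivity
  refine hc.trans ?_
  have hvR : (1:ℝ) ≤ v := by exact_mod_cast hv0
  have huR : (1:ℝ) ≤ u := by exact_mod_cast hu0
  have hgR : (0:ℝ) < g := by exact_mod_cast hgpos
  have hMR : (1:ℝ) ≤ M := by
    have : (1:ℤ) ≤ M := by omega
    exact_mod_cast this
  have e : (g:ℝ) / x₃ = 1 / (u * v) := by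
    rw [hu, hv]; push_cast; field_simp
  rw [e]
  have e5 : (2 * (M:ℝ) / v + 1) * (2 * M / u + 1) = 4 * M ^ 2 * (1 / (u * v)) + 2 * M / v + 2 * M / u + 1 := by
    field_simp; ring
  rw [e5]
  have : 2 * (M:ℝ) / v ≤ 2 * M := div_le_self (by positivity) hvR
  have : 2 * (M:ℝ) / u ≤ 2 * M := div_le_self (by positivity) huR
  linarith

lemma card_box (m : ℕ) : (box m).card = 2 * m + 1 := by
  simp [box, Int.card_Icc]; omega

lemma gcd_sum (m : ℕ) (hm : 0 < m) :
    ∑ x ∈ (box m) ×ˢ (box m), ((Int.gcd (Int.gcd (m:ℤ) x.2) x.1 : ℤ) : ℝ)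
      ≤ 9 * m * ∑ e ∈ m.divisors, (e:ℝ) := by
  have h1 : ∀ x ∈ (box m) ×ˢ (box m), ((Int.gcd (Int.gcd (m:ℤ) x.2) x.1 : ℤ) : ℝ) ≤
      ∑ e ∈ m.divisors, if ((e:ℤ) ∣ x.1 ∧ (e:ℤ) ∣ x.2) then (e:ℝ) else 0 := by
    intro x _
    set g := Int.gcd (Int.gcd (m:ℤ) x.2) x.1 with hg
    have hgh : (g:ℤ) ∣ Int.gcd (m:ℤ) x.2 := Int.gcd_dvd_left _ _
    have hgm : (g:ℤ) ∣ m := hgh.trans (Int.gcd_dvd_left _ _)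
    have hg2 : (g:ℤ) ∣ x.2 := hgh.trans (Int.gcd_dvd_right _ _)
    have hg1 : (g:ℤ) ∣ x.1 := Int.gcd_dvd_right _ _
    have hmem : g ∈ m.divisors := Nat.mem_divisors.2 ⟨by exact_mod_cast hgm, hm.ne'⟩
    have := Finset.single_le_sum (f := fun e : ℕ => if ((e:ℤ) ∣ x.1 ∧ (e:ℤ) ∣ x.2) then (e:ℝ) else 0)
      (fun i _ => by split_ifs <;> positivity) hmem
    simpa [hg1, hg2] using this
  refine (Finset.sum_le_sum h1).trans ?_
  rw [Finset.sum_comm]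
  have h2 : ∀ e ∈ m.divisors, ∑ x ∈ (box m) ×ˢ (box m),
      (if ((e:ℤ) ∣ x.1 ∧ (e:ℤ) ∣ x.2) then (e:ℝ) else 0) ≤ 9 * m * ((m / e : ℕ) : ℝ) := by
    intro e he
    have hem := Nat.dvd_of_mem_divisors he
    have he0 : 0 < e := Nat.pos_of_mem_divisors he
    have heR : (0:ℝ) < e := by exact_mod_cast he0
    rw [← Finset.sum_filter, Finset.sum_const, nsmul_eq_mul]
    have h3 : ((box m) ×ˢ (box m)).filter (fun x => (e:ℤ) ∣ x.1 ∧ (e:ℤ) ∣ x.2) =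
      ((box m).filter (fun z => (e:ℤ) ∣ z)) ×ˢ ((box m).filter (fun z => (e:ℤ) ∣ z)) :=
      Finset.filter_product _ _
    have h4 : (((box m).filter (fun z => (e:ℤ) ∣ z)).card : ℝ) ≤ 2 * m / (e:ℤ) + 1 := by
      apply card_mod m e (by exact_mod_cast he0)
      · intro z hz
        simp only [box, mem_filter, mem_Icc] at hz
        exact abs_le.2 hz.1
      · intro z hz w hw
        rw [mem_filter] at hz hw
        exact dvd_sub hz.2 hw.2
    rw [h3, card_product]
    push_cast at h4 ⊢
    rw [Nat.cast_div hem heR.ne']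
    have h5 : (1:ℝ) ≤ m / e := by
      rw [le_div_iff₀ heR]; simpa using (by exact_mod_cast Nat.le_of_dvd hm hem : (e:ℝ) ≤ m)
    have h6 : 2 * (m:ℝ) / e + 1 ≤ 3 * (m / e) := by
      have : 2 * (m:ℝ) / e = 2 * (m / e) := by ring
      linarith
    have h7 := h4.trans h6
    calc _ ≤ (3 * ((m:ℝ) / e)) * (3 * (m / e)) * e := by gcongr
      _ = _ := by field_simp; ring
  refine (Finset.sum_le_sum h2).trans ?_
  rw [← Finset.mul_sum]
  have : ∑ e ∈ m.divisors, ((m / e : ℕ) : ℝ) = ∑ e ∈ m.divisors, (e:ℝ) :=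
    Nat.sum_div_divisors m (fun e => (e:ℝ))
  rw [this]

lemma sigma_sum (M : ℕ) : ∑ m ∈ Finset.Icc 1 M, ∑ e ∈ m.divisors, (e:ℝ) ≤ M ^ 2 := by
  have h1 : ∀ m ∈ Finset.Icc 1 M, ∑ e ∈ m.divisors, (e:ℝ) =
      ∑ e ∈ Finset.Icc 1 M, if e ∣ m then (e:ℝ) else 0 := by
    intro m hm
    rw [mem_Icc] at hm
    rw [← Finset.sum_filter]
    apply Finset.sum_congr _ (fun _ _ => rfl)
    ext e
    simp only [Nat.mem_divisors, mem_filter, mem_Icc]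
    constructor
    · rintro ⟨h, h0⟩
      exact ⟨⟨Nat.pos_of_dvd_of_pos h (by omega), (Nat.le_of_dvd (by omega) h).trans hm.2⟩, h⟩
    · rintro ⟨_, h⟩
      exact ⟨h, by omega⟩
  rw [Finset.sum_congr rfl h1, Finset.sum_comm]
  have h2 : ∀ e ∈ Finset.Icc 1 M, ∑ m ∈ Finset.Icc 1 M, (if e ∣ m then (e:ℝ) else 0) ≤ M := by
    intro e he
    rw [mem_Icc] at he
    rw [← Finset.sum_filter, Finset.sum_const, nsmul_eq_mul]
    have : ((Finset.Icc 1 M).filter (fun m => e ∣ m)).card = M / e := by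
      rw [← Nat.Ioc_filter_dvd_card_eq_div]; rfl
    rw [this]
    exact_mod_cast Nat.div_mul_le_self M e
  refine (Finset.sum_le_sum h2).trans ?_
  simp [sq]


noncomputable def Zset (M : ℕ) (x₁ x₂ x₃ : ℤ) : Finset (ℤ × ℤ × ℤ) :=
  ((box M) ×ˢ (box M) ×ˢ (box M)).filter (fun z => x₁ * z.1 + x₂ * z.2.1 + x₃ * z.2.2 = 0)

noncomputable def box3 (M : ℕ) : Finset (ℤ × ℤ × ℤ) := (box M) ×ˢ (box M) ×ˢ (box M)

lemma mem_box3 {M : ℕ} {x : ℤ × ℤ × ℤ} :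
    x ∈ box3 M ↔ |x.1| ≤ M ∧ |x.2.1| ≤ M ∧ |x.2.2| ≤ M := by
  simp [box3, box, abs_le]

noncomputable def Aset (M : ℕ) : Finset ((ℤ × ℤ × ℤ) × (ℤ × ℤ × ℤ)) :=
  (box3 M ×ˢ box3 M).filter
    (fun p => p.1.1 * p.2.1 + p.1.2.1 * p.2.2.1 + p.1.2.2 * p.2.2.2 = 0)

noncomputable def A3set (M : ℕ) : Finset ((ℤ × ℤ × ℤ) × (ℤ × ℤ × ℤ)) :=
  (Aset M).filter (fun p => |p.1.1| ≤ p.1.2.2 ∧ |p.1.2.1| ≤ p.1.2.2 ∧ 0 < p.1.2.2)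

lemma A3_card (M : ℕ) : ((A3set M).card : ℝ) ≤ 81 * M ^ 4 := by
  have hsub : A3set M ⊆ (Finset.Icc 1 M).biUnion (fun m => ((box m) ×ˢ (box m)).biUnion
      (fun x => (Zset M x.1 x.2 m).image (fun z => ((x.1, x.2, (m:ℤ)), z)))) := by
    rintro ⟨⟨x1, x2, x3⟩, z⟩ h
    simp only [A3set, Aset, mem_filter, mem_product, mem_box3] at h
    obtain ⟨⟨⟨hx, hz⟩, he⟩, h1, h2, h3⟩ := h
    obtain ⟨m, rfl⟩ := Int.eq_ofNat_of_zero_le h3.le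
    simp only [mem_biUnion, mem_image]
    refine ⟨m, ?_, (x1, x2), ?_, z, ?_, rfl⟩
    · have := hx.2.2
      rw [abs_of_pos h3] at this
      rw [mem_Icc]; omega
    · simp only [box, mem_product, mem_Icc]
      exact ⟨abs_le.1 h1, abs_le.1 h2⟩
    · simp only [Zset, box, mem_filter, mem_product, mem_Icc]
      exact ⟨⟨abs_le.1 hz.1, abs_le.1 hz.2.1, abs_le.1 hz.2.2⟩, he⟩
  have h1 : ((A3set M).card : ℝ) ≤ ∑ m ∈ Finset.Icc 1 M, ∑ x ∈ (box m) ×ˢ (box m),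
      ((Zset M x.1 x.2 m).card : ℝ) := by
    have : (A3set M).card ≤ ∑ m ∈ Finset.Icc 1 M, ∑ x ∈ (box m) ×ˢ (box m),
      (Zset M x.1 x.2 m).card := by
      refine (card_le_card hsub).trans (card_biUnion_le.trans (Finset.sum_le_sum fun m _ => ?_))
      exact card_biUnion_le.trans (Finset.sum_le_sum fun x _ => card_image_le)
    exact_mod_cast this
  refine h1.trans ?_
  have h2 : ∀ m ∈ Finset.Icc 1 M, ∑ x ∈ (box m) ×ˢ (box m), ((Zset M x.1 x.2 m).card : ℝ) ≤
      36 * M ^ 2 * ∑ e ∈ m.divisors, (e:ℝ) + 45 * M ^ 3 := by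
    intro m hm
    rw [mem_Icc] at hm
    have hm0 : (0:ℝ) < m := by exact_mod_cast hm.1
    have hmM : (m:ℝ) ≤ M := by exact_mod_cast hm.2
    have hm1 : (1:ℝ) ≤ m := by exact_mod_cast hm.1
    have h3 : ∀ x ∈ (box m) ×ˢ (box m), ((Zset M x.1 x.2 m).card : ℝ) ≤
        4 * M ^ 2 * (((Int.gcd (Int.gcd (m:ℤ) x.2) x.1 : ℤ) : ℝ) / m) + 5 * M := by
      intro x _
      have := count_z M x.1 x.2 m (by omega) (by omega)
      simpa [Zset] using this
    refine (Finset.sum_le_sum h3).trans ?_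
    rw [Finset.sum_add_distrib, ← Finset.mul_sum, ← Finset.sum_div, Finset.sum_const, nsmul_eq_mul,
      card_product, card_box]
    have h4 := gcd_sum m hm.1
    have h5 : (∑ x ∈ (box m) ×ˢ (box m), ((Int.gcd (Int.gcd (m:ℤ) x.2) x.1 : ℤ) : ℝ)) / m ≤
        9 * ∑ e ∈ m.divisors, (e:ℝ) := by
      rw [div_le_iff₀ hm0]; linarith
    have h6 : (((2 * m + 1) * (2 * m + 1) : ℕ) : ℝ) ≤ 9 * M ^ 2 := by
      push_cast; nlinarith
    have h7 : (((2 * m + 1) * (2 * m + 1) : ℕ) : ℝ) * (5 * M) ≤ 9 * M ^ 2 * (5 * M) := by gcongr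
    have h8 : 4 * (M:ℝ) ^ 2 * ((∑ x ∈ (box m) ×ˢ (box m), ((Int.gcd (Int.gcd (m:ℤ) x.2) x.1 : ℤ) : ℝ)) / m) ≤
        4 * M ^ 2 * (9 * ∑ e ∈ m.divisors, (e:ℝ)) := by gcongr
    linarith
  refine (Finset.sum_le_sum h2).trans ?_
  rw [Finset.sum_add_distrib, ← Finset.mul_sum, Finset.sum_const, nsmul_eq_mul, Nat.card_Icc]
  have h9 := sigma_sum M
  have h10 : 36 * (M:ℝ) ^ 2 * ∑ m ∈ Finset.Icc 1 M, ∑ e ∈ m.divisors, (e:ℝ) ≤ 36 * M ^ 2 * M ^ 2 := by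
    gcongr
  simp only [add_tsub_cancel_right]
  nlinarith

lemma card_box3 (m : ℕ) : (box3 m).card = (2 * m + 1) ^ 3 := by
  rw [box3, card_product, card_product, card_box]; ring

lemma A_card (M : ℕ) (hM : 1 ≤ M) : ((Aset M).card : ℝ) ≤ 513 * M ^ 4 := by
  let f1 : (ℤ × ℤ × ℤ) × (ℤ × ℤ × ℤ) → (ℤ × ℤ × ℤ) × (ℤ × ℤ × ℤ) := fun p => (-p.1, p.2)
  let f2 : (ℤ × ℤ × ℤ) × (ℤ × ℤ × ℤ) → (ℤ × ℤ × ℤ) × (ℤ × ℤ × ℤ) :=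
    fun p => ((p.1.2.2, p.1.2.1, p.1.1), (p.2.2.2, p.2.2.1, p.2.1))
  let f3 : (ℤ × ℤ × ℤ) × (ℤ × ℤ × ℤ) → (ℤ × ℤ × ℤ) × (ℤ × ℤ × ℤ) :=
    fun p => ((p.1.1, p.1.2.2, p.1.2.1), (p.2.1, p.2.2.2, p.2.2.1))
  let B := A3set M ∪ (A3set M).image f1
  have hB : B.card ≤ 2 * (A3set M).card := by
    refine (card_union_le _ _).trans ?_
    have : ((A3set M).image f1).card ≤ (A3set M).card := card_image_le
    omega
  let T0 : Finset ((ℤ × ℤ × ℤ) × (ℤ × ℤ × ℤ)) := (box3 M).image (fun z => (0, z))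
  have hT0 : T0.card ≤ (2 * M + 1) ^ 3 := by
    rw [← card_box3]; exact card_image_le
  have hBmem : ∀ p ∈ Aset M, |p.1.1| ≤ |p.1.2.2| → |p.1.2.1| ≤ |p.1.2.2| → p.1.2.2 ≠ 0 → p ∈ B := by
    intro p hp h1 h2 h3
    rcases lt_or_gt_of_ne h3 with h | h
    · apply mem_union_right
      rw [mem_image]
      refine ⟨f1 p, ?_, by simp [f1]⟩
      rw [abs_of_neg h] at h1 h2
      simp only [A3set, Aset, mem_filter, mem_product, mem_box3] at hp ⊢
      simp only [f1, Prod.fst_neg, Prod.snd_neg, abs_neg]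
      refine ⟨⟨hp.1, ?_⟩, h1, h2, by omega⟩
      linarith [hp.2]
    · apply mem_union_left
      rw [abs_of_pos h] at h1 h2
      simp only [A3set, mem_filter]
      exact ⟨hp, h1, h2, h⟩
  have hsub : Aset M ⊆ T0 ∪ (B ∪ (B.image f2 ∪ B.image f3)) := by
    intro p hp
    have hp' := hp
    simp only [Aset, mem_filter, mem_product, mem_box3] at hp'
    by_cases h0 : p.1 = 0
    · apply mem_union_left
      rw [mem_image]
      refine ⟨p.2, mem_box3.2 hp'.1.2, ?_⟩
      rw [← h0]
    apply mem_union_right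
    have hex : p.1.1 ≠ 0 ∨ p.1.2.1 ≠ 0 ∨ p.1.2.2 ≠ 0 := by
      by_contra hcon
      push Not at hcon
      exact h0 (by ext <;> simp [hcon])
    have h2 : f2 p ∈ Aset M := by
      simp only [Aset, mem_filter, mem_product, mem_box3, f2]
      refine ⟨⟨⟨hp'.1.1.2.2, hp'.1.1.2.1, hp'.1.1.1⟩, hp'.1.2.2.2, hp'.1.2.2.1, hp'.1.2.1⟩, ?_⟩
      linarith [hp'.2]
    have h3 : f3 p ∈ Aset M := by
      simp only [Aset, mem_filter, mem_product, mem_box3, f3]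
      refine ⟨⟨⟨hp'.1.1.1, hp'.1.1.2.2, hp'.1.1.2.1⟩, hp'.1.2.1, hp'.1.2.2.2, hp'.1.2.2.1⟩, ?_⟩
      linarith [hp'.2]
    have hpos : 0 < |p.1.1| ∨ 0 < |p.1.2.1| ∨ 0 < |p.1.2.2| := by simpa using hex
    have hcase : (|p.1.1| ≤ |p.1.2.2| ∧ |p.1.2.1| ≤ |p.1.2.2|) ∨
      (|p.1.2.2| ≤ |p.1.1| ∧ |p.1.2.1| ≤ |p.1.1|) ∨ (|p.1.1| ≤ |p.1.2.1| ∧ |p.1.2.2| ≤ |p.1.2.1|) := by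
      omega
    rcases hcase with h | h | h
    · apply mem_union_left
      refine hBmem p hp h.1 h.2 (abs_pos.1 (by omega))
    · apply mem_union_right; apply mem_union_left
      rw [mem_image]
      exact ⟨f2 p, hBmem _ h2 h.1 h.2 (abs_pos.1 (by simp only [f2]; omega)), rfl⟩
    · apply mem_union_right; apply mem_union_right
      rw [mem_image]
      exact ⟨f3 p, hBmem _ h3 h.1 h.2 (abs_pos.1 (by simp only [f3]; omega)), rfl⟩
  have hcard : (Aset M).card ≤ (2 * M + 1) ^ 3 + 6 * (A3set M).card := by
    refine (card_le_card hsub).trans ?_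
    refine (card_union_le _ _).trans ?_
    have h1 := card_union_le B (B.image f2 ∪ B.image f3)
    have h2 := card_union_le (B.image f2) (B.image f3)
    have h3 : (B.image f2).card ≤ B.card := card_image_le
    have h4 : (B.image f3).card ≤ B.card := card_image_le
    omega
  have hR : ((Aset M).card : ℝ) ≤ (2 * M + 1) ^ 3 + 6 * (A3set M).card := by exact_mod_cast hcard
  have h3 := A3_card M
  have hM' : (1:ℝ) ≤ M := by exact_mod_cast hM
  have h4 : (2 * (M:ℝ) + 1) ^ 3 ≤ (3 * M) ^ 3 := by gcongr; linarith
  have h5 : (M:ℝ) ^ 3 ≤ M ^ 4 := pow_le_pow_right₀ hM' (by norm_num)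
  nlinarith


noncomputable def DD (T : ℝ) (h : ℝ → ℝ) : ℝ := ∫ u in (0:ℝ)..T, ∫ v in (0:ℝ)..T, h (u - v)

noncomputable def ww (T θ : ℝ) : ℝ :=
  (∫ u in (0:ℝ)..T, Real.cos (θ * u)) ^ 2 + (∫ u in (0:ℝ)..T, Real.sin (θ * u)) ^ 2

lemma cont_inner (T : ℝ) (h : ℝ → ℝ) (hc : Continuous h) :
    Continuous (fun u : ℝ => ∫ v in (0:ℝ)..T, h (u - v)) := by
  apply intervalIntegral.continuous_parametric_intervalIntegral_of_continuous'
  exact hc.comp (continuous_fst.sub continuous_snd)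

lemma DD_mono (T : ℝ) (hT : 0 ≤ T) (f g : ℝ → ℝ) (hf : Continuous f) (hg : Continuous g)
    (h : ∀ t, f t ≤ g t) : DD T f ≤ DD T g := by
  apply intervalIntegral.integral_mono_on hT
  · exact (cont_inner T f hf).intervalIntegrable _ _
  · exact (cont_inner T g hg).intervalIntegrable _ _
  · intro u _
    apply intervalIntegral.integral_mono_on hT
    · exact (hf.comp (continuous_const.sub continuous_id)).intervalIntegrable _ _
    · exact (hg.comp (continuous_const.sub continuous_id)).intervalIntegrable _ _
    · intro v _; exact h _

lemma DD_mono_T (T T' : ℝ) (hT : 0 ≤ T) (hTT : T ≤ T') (f : ℝ → ℝ) (hf : Continuous f)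
    (h : ∀ t, 0 ≤ f t) : DD T f ≤ DD T' f := by
  have hT' := hT.trans hTT
  calc DD T f ≤ ∫ u in (0:ℝ)..T, ∫ v in (0:ℝ)..T', f (u - v) := by
        apply intervalIntegral.integral_mono_on hT
        · exact (cont_inner T f hf).intervalIntegrable _ _
        · exact (cont_inner T' f hf).intervalIntegrable _ _
        · intro u _
          apply intervalIntegral.integral_mono_interval le_rfl hT hTT
          · exact Filter.Eventually.of_forall (fun v => h _)
          · exact (hf.comp (continuous_const.sub continuous_id)).intervalIntegrable _ _
    _ ≤ DD T' f := by
        apply intervalIntegral.integral_mono_interval le_rfl hT hTT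
        · exact Filter.Eventually.of_forall (fun u =>
            intervalIntegral.integral_nonneg hT' (fun v _ => h _))
        · exact (cont_inner T' f hf).intervalIntegrable _ _

lemma DD_sum {ι : Type*} (T : ℝ) (s : Finset ι) (f : ι → ℝ → ℝ) (hf : ∀ i, Continuous (f i)) :
    DD T (fun t => ∑ i ∈ s, f i t) = ∑ i ∈ s, DD T (f i) := by
  unfold DD
  rw [← intervalIntegral.integral_finsetSum]
  · congr 1; ext u
    rw [intervalIntegral.integral_finsetSum]
    intro i _
    exact ((hf i).comp (continuous_const.sub continuous_id)).intervalIntegrable _ _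
  · intro i _
    exact (cont_inner T (f i) (hf i)).intervalIntegrable _ _

lemma DD_cos (T θ : ℝ) : DD T (fun t => Real.cos (θ * t)) = ww T θ := by
  unfold DD ww
  have h1 : ∀ u : ℝ, ∫ v in (0:ℝ)..T, Real.cos (θ * (u - v)) =
      Real.cos (θ * u) * (∫ v in (0:ℝ)..T, Real.cos (θ * v)) +
      Real.sin (θ * u) * (∫ v in (0:ℝ)..T, Real.sin (θ * v)) := by
    intro u
    rw [← intervalIntegral.integral_const_mul, ← intervalIntegral.integral_const_mul,
      ← intervalIntegral.integral_add]
    · congr 1; ext v; rw [mul_sub, Real.cos_sub]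
    · exact Continuous.intervalIntegrable (by fun_prop) _ _
    · exact Continuous.intervalIntegrable (by fun_prop) _ _
  simp_rw [h1]
  rw [intervalIntegral.integral_add, intervalIntegral.integral_mul_const,
    intervalIntegral.integral_mul_const]
  · ring
  · exact Continuous.intervalIntegrable (by fun_prop) _ _
  · exact Continuous.intervalIntegrable (by fun_prop) _ _

lemma ww_nonneg (T θ : ℝ) : 0 ≤ ww T θ := by unfold ww; positivity

lemma ww_lower (T θ : ℝ) (hT : 0 ≤ T) (h : |θ| * T ≤ 1) : T ^ 2 / 4 ≤ ww T θ := by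
  have h1 : T / 2 ≤ ∫ u in (0:ℝ)..T, Real.cos (θ * u) := by
    calc T / 2 = ∫ u in (0:ℝ)..T, (1/2 : ℝ) := by simp; ring
      _ ≤ _ := by
        apply intervalIntegral.integral_mono_on hT
        · exact Continuous.intervalIntegrable (by fun_prop) _ _
        · exact Continuous.intervalIntegrable (by fun_prop) _ _
        · intro u hu
          have h2 := Real.one_sub_sq_div_two_le_cos (x := θ * u)
          have h3 : |θ * u| ≤ 1 := by
            rw [abs_mul, abs_of_nonneg hu.1]
            exact (mul_le_mul_of_nonneg_left hu.2 (abs_nonneg _)).trans h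
          have h4 : (θ * u) ^ 2 ≤ 1 := by
            rw [← sq_abs]; exact pow_le_one₀ (abs_nonneg _) h3
          linarith
  unfold ww
  nlinarith [sq_nonneg (∫ u in (0:ℝ)..T, Real.sin (θ * u))]

lemma ww_period (b : ℝ) (hb : 0 < b) (n : ℤ) :
    ww (2 * Real.pi / b) (b * n) = if n = 0 then (2 * Real.pi / b) ^ 2 else 0 := by
  split_ifs with h
  · subst h; simp [ww]
  · have hn : (n:ℝ) ≠ 0 := by exact_mod_cast h
    have hbn : b * n ≠ 0 := mul_ne_zero hb.ne' hn
    have e : b * n * (2 * Real.pi / b) = n * (2 * Real.pi) := by field_simp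
    unfold ww
    rw [intervalIntegral.integral_comp_mul_left _ hbn, intervalIntegral.integral_comp_mul_left _ hbn,
      integral_cos, integral_sin, e]
    have h1 : Real.sin (n * (2 * Real.pi)) = 0 := by
      have := Real.sin_add_int_mul_two_pi 0 n
      simpa using this
    have h2 : Real.cos (n * (2 * Real.pi)) = 1 := by
      have := Real.cos_add_int_mul_two_pi 0 n
      simpa using this
    rw [h1, h2]; simp

noncomputable def SS {α : Type} (J : Finset α) (n : α → ℤ) (t : ℝ) : ℝ :=
  ∑ j ∈ J, Real.cos (n j * t)

lemma SS_prod {α : Type} (J : Finset α) (n : α → ℤ)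
    (hsin : ∀ t : ℝ, ∑ j ∈ J, Real.sin (n j * t) = 0) (a b c t : ℝ) :
    SS J n (a * t) * SS J n (b * t) * SS J n (c * t) =
      ∑ p ∈ J ×ˢ J ×ˢ J, Real.cos ((a * n p.1 + b * n p.2.1 + c * n p.2.2) * t) := by
  have hE : ∀ s : ℝ, ((SS J n s : ℝ) : ℂ) = ∑ j ∈ J, Complex.exp (((n j * s : ℝ) : ℂ) * Complex.I) := by
    intro s
    simp_rw [Complex.exp_mul_I, ← Complex.ofReal_cos, ← Complex.ofReal_sin]
    rw [Finset.sum_add_distrib, ← Finset.sum_mul, ← Complex.ofReal_sum, ← Complex.ofReal_sum, hsin]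
    simp [SS]
  have h1 : ((SS J n (a * t) * SS J n (b * t) * SS J n (c * t) : ℝ) : ℂ) =
      ∑ p ∈ J ×ˢ J ×ˢ J,
        Complex.exp ((((a * n p.1 + b * n p.2.1 + c * n p.2.2) * t : ℝ) : ℂ) * Complex.I) := by
    push_cast
    rw [hE, hE, hE, mul_assoc, Finset.sum_mul_sum, Finset.sum_mul, Finset.sum_product]
    apply Finset.sum_congr rfl; intro i _
    rw [Finset.sum_product, Finset.mul_sum]
    apply Finset.sum_congr rfl; intro j _
    rw [Finset.mul_sum]
    apply Finset.sum_congr rfl; intro k _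
    rw [← Complex.exp_add, ← Complex.exp_add]
    congr 1; push_cast; ring
  have h2 := congrArg Complex.re h1
  rw [Complex.ofReal_re, Complex.re_sum] at h2
  rw [h2]
  apply Finset.sum_congr rfl; intro p _
  rw [Complex.exp_ofReal_mul_I_re]

lemma SS_cont {α : Type} (J : Finset α) (n : α → ℤ) : Continuous (SS J n) := by
  unfold SS; fun_prop

lemma fourier (a b c : ℝ) (ha : 0 < a) (hb : 0 < b) (hc : 0 < c) : ∃ C : ℝ, 0 ≤ C ∧
    ∀ {α : Type} (J : Finset α) (n : α → ℤ), (∀ t : ℝ, ∑ j ∈ J, Real.sin (n j * t) = 0) →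
      (∀ t : ℝ, 0 ≤ ∑ j ∈ J, Real.cos (n j * t)) →
      (((J ×ˢ J ×ˢ J).filter (fun p => |a * n p.1 + b * n p.2.1 + c * n p.2.2| ≤ 2)).card : ℝ) ≤
      C * ((J ×ˢ J ×ˢ J).filter (fun p => n p.1 + n p.2.1 + n p.2.2 = 0)).card := by
  set Ta := 2 * Real.pi / a with hTa
  set Tb := 2 * Real.pi / b with hTb
  set Tc := 2 * Real.pi / c with hTc
  have hpi := Real.pi_pos
  have hTa0 : 0 < Ta := by positivity
  have hTb0 : 0 < Tb := by positivity
  have hTc0 : 0 < Tc := by positivity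
  obtain ⟨T, hT0, hT2, hTTa, hTTb, hTTc⟩ : ∃ T : ℝ, 0 < T ∧ T ≤ 1 / 2 ∧ T ≤ Ta ∧ T ≤ Tb ∧ T ≤ Tc := by
    refine ⟨min (1/2) (min Ta (min Tb Tc)), by positivity, ?_, ?_, ?_, ?_⟩ <;> simp
  refine ⟨(Ta ^ 2 + Tb ^ 2 + Tc ^ 2) * (4 / T ^ 2), by positivity, ?_⟩
  intro α J n hsin hcos
  have hS0 : ∀ t, 0 ≤ SS J n t := hcos
  have hSc : ∀ a : ℝ, Continuous (fun t => SS J n (a * t)) := fun a =>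
    (SS_cont J n).comp (continuous_const.mul continuous_id)
  have hDD : ∀ T a b c : ℝ, DD T (fun t => SS J n (a * t) * SS J n (b * t) * SS J n (c * t)) =
      ∑ p ∈ J ×ˢ J ×ˢ J, ww T (a * n p.1 + b * n p.2.1 + c * n p.2.2) := by
    intro T a b c
    simp_rw [SS_prod J n hsin]
    rw [DD_sum]
    · simp_rw [DD_cos]
    · intro i; fun_prop
  set I0 := ((J ×ˢ J ×ˢ J).filter (fun p => n p.1 + n p.2.1 + n p.2.2 = 0)).card with hI0
  have hcube : ∀ a : ℝ, 0 < a → T ≤ 2 * Real.pi / a →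
      DD T (fun t => SS J n (a * t) * SS J n (a * t) * SS J n (a * t)) ≤ (2 * Real.pi / a) ^ 2 * I0 := by
    intro a ha hT
    refine (DD_mono_T T _ hT0.le hT (fun t => SS J n (a * t) * SS J n (a * t) * SS J n (a * t)) (((hSc a).mul (hSc a)).mul (hSc a)) ?_).trans ?_
    · intro t; have := hS0 (a * t); positivity
    rw [hDD]
    have : ∀ p ∈ J ×ˢ J ×ˢ J, ww (2 * Real.pi / a) (a * n p.1 + a * n p.2.1 + a * n p.2.2) =
        if n p.1 + n p.2.1 + n p.2.2 = 0 then (2 * Real.pi / a) ^ 2 else 0 := by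
      intro p _
      rw [← ww_period a ha]; congr 1; push_cast; ring
    rw [Finset.sum_congr rfl this, ← Finset.sum_filter, Finset.sum_const, nsmul_eq_mul, mul_comm]
  have hmain : DD T (fun t => SS J n (a * t) * SS J n (b * t) * SS J n (c * t)) ≤
      (Ta ^ 2 + Tb ^ 2 + Tc ^ 2) * I0 := by
    have h1 : DD T (fun t => SS J n (a * t) * SS J n (b * t) * SS J n (c * t)) ≤
      DD T (fun t => ∑ i : Fin 3, (fun t => SS J n ((![a, b, c] i) * t) * SS J n ((![a, b, c] i) * t) *
        SS J n ((![a, b, c] i) * t)) t) := by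
      apply DD_mono T hT0.le
      · exact ((hSc a).mul (hSc b)).mul (hSc c)
      · exact continuous_finsetSum _ (fun i _ => ((hSc _).mul (hSc _)).mul (hSc _))
      · intro t
        simp only [Fin.sum_univ_three, Matrix.cons_val_zero, Matrix.cons_val_one, Matrix.cons_val]
        have hx := hS0 (a * t)
        have hy := hS0 (b * t)
        have hz := hS0 (c * t)
        set x := SS J n (a * t)
        set y := SS J n (b * t)
        set z := SS J n (c * t)
        have : 0 ≤ x * x * x + y * y * y + z * z * z - 3 * (x * y * z) := by
          have : x * x * x + y * y * y + z * z * z - 3 * (x * y * z) =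
            (x + y + z) * ((x - y) ^ 2 + (y - z) ^ 2 + (x - z) ^ 2) / 2 := by ring
          rw [this]; positivity
        have : 0 ≤ x * y * z := by positivity
        linarith
    rw [DD_sum] at h1
    · simp only [Fin.sum_univ_three, Matrix.cons_val_zero, Matrix.cons_val_one, Matrix.cons_val] at h1
      have h2 := hcube a ha hTTa
      have h3 := hcube b hb hTTb
      have h4 := hcube c hc hTTc
      rw [← hTa] at h2; rw [← hTb] at h3; rw [← hTc] at h4
      linarith
    · intro i; exact ((hSc _).mul (hSc _)).mul (hSc _)
  rw [hDD] at hmain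
  have hlow : (T ^ 2 / 4) * ((J ×ˢ J ×ˢ J).filter
      (fun p => |a * n p.1 + b * n p.2.1 + c * n p.2.2| ≤ 2)).card ≤
      ∑ p ∈ J ×ˢ J ×ˢ J, ww T (a * n p.1 + b * n p.2.1 + c * n p.2.2) := by
    rw [mul_comm, ← nsmul_eq_mul, ← Finset.sum_const, Finset.sum_filter]
    apply Finset.sum_le_sum
    intro p _
    split_ifs with h
    · apply ww_lower T _ hT0.le
      nlinarith [abs_nonneg (a * n p.1 + b * n p.2.1 + c * n p.2.2)]
    · exact ww_nonneg _ _
  have hfin := hlow.trans hmain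
  have e : (Ta ^ 2 + Tb ^ 2 + Tc ^ 2) * (4 / T ^ 2) * (I0 : ℝ) =
    (Ta ^ 2 + Tb ^ 2 + Tc ^ 2) * I0 / (T ^ 2 / 4) := by field_simp
  rw [e, le_div_iff₀ (by positivity)]
  linarith

noncomputable def Eset (a b c : ℝ) (K : ℕ) : Finset ((ℤ × ℤ × ℤ) × (ℤ × ℤ × ℤ)) :=
  (box3 K ×ˢ box3 K).filter (fun p => |a * (p.1.1 * p.2.1 : ℤ) + b * (p.1.2.1 * p.2.2.1 : ℤ)
    + c * (p.1.2.2 * p.2.2.2 : ℤ)| ≤ 2)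

lemma E_card (a b c : ℝ) (ha : 0 < a) (hb : 0 < b) (hc : 0 < c) : ∃ C : ℝ, 0 ≤ C ∧
    ∀ K : ℕ, 1 ≤ K → ((Eset a b c K).card : ℝ) ≤ C * K ^ 4 := by
  obtain ⟨C, hC, hF⟩ := fourier a b c ha hb hc
  refine ⟨C * (27 * 513 * 81), by positivity, ?_⟩
  intro K hK
  let Y : Finset ℤ := Finset.Icc (-(K:ℤ)) (2 * K)
  let J : Finset (ℤ × ℤ × ℤ) := box K ×ˢ (Y ×ˢ Y)
  let n : ℤ × ℤ × ℤ → ℤ := fun j => j.1 * (j.2.1 - j.2.2)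
  have hYc : Y.card = 3 * K + 1 := by
    simp only [Y, Int.card_Icc]; omega
  have hsin : ∀ t : ℝ, ∑ j ∈ J, Real.sin (n j * t) = 0 := by
    intro t
    rw [Finset.sum_product]
    apply Finset.sum_eq_zero
    intro x _
    rw [Finset.sum_product]
    have : ∀ y y' : ℤ, Real.sin ((n (x, y, y') : ℤ) * t) =
        Real.sin (x * y * t) * Real.cos (x * y' * t) - Real.cos (x * y * t) * Real.sin (x * y' * t) := by
      intro y y'
      rw [← Real.sin_sub]; congr 1; simp only [n]; push_cast; ring
    simp_rw [this, Finset.sum_sub_distrib]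
    rw [← Finset.sum_mul_sum, ← Finset.sum_mul_sum]; ring
  have hcos : ∀ t : ℝ, 0 ≤ ∑ j ∈ J, Real.cos (n j * t) := by
    intro t
    rw [Finset.sum_product]
    apply Finset.sum_nonneg
    intro x _
    rw [Finset.sum_product]
    have : ∀ y y' : ℤ, Real.cos ((n (x, y, y') : ℤ) * t) =
        Real.cos (x * y * t) * Real.cos (x * y' * t) + Real.sin (x * y * t) * Real.sin (x * y' * t) := by
      intro y y'
      rw [← Real.cos_sub]; congr 1; simp only [n]; push_cast; ring
    simp_rw [this, Finset.sum_add_distrib]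
    rw [← Finset.sum_mul_sum, ← Finset.sum_mul_sum]
    exact add_nonneg (mul_self_nonneg _) (mul_self_nonneg _)
  have hmain := hF J n hsin hcos
  let W : Finset ℤ := Finset.Icc 0 (K:ℤ)
  have hWc : W.card = K + 1 := by
    simp only [W, Int.card_Icc]; omega
  have hlow : (Eset a b c K ×ˢ (W ×ˢ W ×ˢ W)).card ≤
      ((J ×ˢ J ×ˢ J).filter (fun p => |a * n p.1 + b * n p.2.1 + c * n p.2.2| ≤ 2)).card := by
    apply Finset.card_le_card_of_injOn (fun p => ((p.1.1.1, p.2.1 + p.1.2.1, p.2.1),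
      (p.1.1.2.1, p.2.2.1 + p.1.2.2.1, p.2.2.1), (p.1.1.2.2, p.2.2.2 + p.1.2.2.2, p.2.2.2)))
    · rintro ⟨⟨⟨x1, x2, x3⟩, ⟨z1, z2, z3⟩⟩, ⟨w1, w2, w3⟩⟩ hp
      have hp' := Finset.mem_coe.1 hp
      simp only [Eset, W, mem_filter, mem_product, mem_box3, mem_Icc, abs_le (a := x1),
        abs_le (a := x2), abs_le (a := x3), abs_le (a := z1), abs_le (a := z2), abs_le (a := z3)] at hp'
      obtain ⟨⟨⟨hx, hz⟩, he⟩, hw⟩ := hp'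
      apply Finset.mem_coe.2
      simp only [J, Y, box, mem_filter, mem_product, mem_Icc]
      refine ⟨by omega, ?_⟩
      simp only [n, add_sub_cancel_left]
      exact he
    · rintro ⟨⟨⟨x1, x2, x3⟩, ⟨z1, z2, z3⟩⟩, ⟨w1, w2, w3⟩⟩ _ ⟨⟨⟨x1', x2', x3'⟩, ⟨z1', z2', z3'⟩⟩, ⟨w1', w2', w3'⟩⟩ _ h
      simp only [Prod.mk.injEq] at h ⊢
      omega
  have hup : ((J ×ˢ J ×ˢ J).filter (fun p => n p.1 + n p.2.1 + n p.2.2 = 0)).card ≤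
      (Aset (3 * K) ×ˢ (Y ×ˢ Y ×ˢ Y)).card := by
    apply Finset.card_le_card_of_injOn (fun p => (((p.1.1, p.2.1.1, p.2.2.1),
      (p.1.2.1 - p.1.2.2, p.2.1.2.1 - p.2.1.2.2, p.2.2.2.1 - p.2.2.2.2)),
      (p.1.2.2, p.2.1.2.2, p.2.2.2.2)))
    · rintro ⟨⟨x1, y1, w1⟩, ⟨x2, y2, w2⟩, ⟨x3, y3, w3⟩⟩ hp
      have hp' := Finset.mem_coe.1 hp
      simp only [J, Y, box, mem_filter, mem_product, mem_Icc] at hp'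
      obtain ⟨hx, he⟩ := hp'
      apply Finset.mem_coe.2
      simp only [Aset, Y, mem_filter, mem_product, mem_box3, mem_Icc, abs_le]
      push_cast
      refine ⟨⟨by omega, ?_⟩, by omega⟩
      simpa only [n] using he
    · rintro ⟨⟨x1, y1, w1⟩, ⟨x2, y2, w2⟩, ⟨x3, y3, w3⟩⟩ _ ⟨⟨x1', y1', w1'⟩, ⟨x2', y2', w2'⟩, ⟨x3', y3', w3'⟩⟩ _ h
      simp only [Prod.mk.injEq] at h ⊢
      omega
  simp only [card_product, hWc, hYc] at hlow hup
  have hA := A_card (3 * K) (by omega)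
  have hlow' : ((Eset a b c K).card : ℝ) * ((K + 1) * ((K + 1) * (K + 1))) ≤
      (((J ×ˢ J ×ˢ J).filter (fun p => |a * n p.1 + b * n p.2.1 + c * n p.2.2| ≤ 2)).card : ℝ) := by
    exact_mod_cast hlow
  have hup' : (((J ×ˢ J ×ˢ J).filter (fun p => n p.1 + n p.2.1 + n p.2.2 = 0)).card : ℝ) ≤
      (Aset (3 * K)).card * ((3 * K + 1) * ((3 * K + 1) * (3 * K + 1))) := by
    exact_mod_cast hup
  have hK0 : (0:ℝ) ≤ K := by positivity
  have h3 : ((3 * K + 1) * ((3 * K + 1) * (3 * K + 1)) : ℝ) ≤ 27 * ((K + 1) * ((K + 1) * (K + 1))) := by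
    nlinarith [mul_nonneg hK0 hK0]
  push_cast at hA
  have h4 : ((Eset a b c K).card : ℝ) * ((K + 1) * ((K + 1) * (K + 1))) ≤
      (C * (27 * 513 * 81) * K ^ 4) * ((K + 1) * ((K + 1) * (K + 1))) := by
    calc _ ≤ C * ((Aset (3 * K)).card * ((3 * K + 1) * ((3 * K + 1) * (3 * K + 1)))) :=
          hlow'.trans (hmain.trans (mul_le_mul_of_nonneg_left hup' hC))
      _ ≤ C * ((513 * (3 * K) ^ 4) * (27 * ((K + 1) * ((K + 1) * (K + 1))))) := by gcongr
      _ = _ := by ring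
  exact le_of_mul_le_mul_right h4 (by positivity)

noncomputable def phi (a b c : ℝ) (p q : ℤ × ℤ × ℤ) : ℝ :=
  a * (p.1 * q.1 : ℤ) + b * (p.2.1 * q.2.1 : ℤ) + c * (p.2.2 * q.2.2 : ℤ)

lemma phi_sub_left (a b c : ℝ) (p p' q : ℤ × ℤ × ℤ) :
    phi a b c (p - p') q = phi a b c p q - phi a b c p' q := by
  simp only [phi, Prod.fst_sub, Prod.snd_sub]; push_cast; ring

lemma phi_sub_right (a b c : ℝ) (p q q' : ℤ × ℤ × ℤ) :
    phi a b c p (q - q') = phi a b c p q - phi a b c p q' := by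
  simp only [phi, Prod.fst_sub, Prod.snd_sub]; push_cast; ring

lemma box3_sub {K : ℕ} {p p' A : ℤ × ℤ × ℤ} (h : p - A ∈ box3 K) (h' : p' - A ∈ box3 K) :
    p - p' ∈ box3 (2 * K) := by
  simp only [mem_box3, Prod.fst_sub, Prod.snd_sub, abs_le] at *
  push_cast
  omega

lemma three_box (a b c : ℝ) (ha : 0 < a) (hb : 0 < b) (hc : 0 < c) : ∃ C : ℝ, 0 ≤ C ∧
    ∀ K : ℕ, 1 ≤ K → ∀ (S : Finset ((ℤ × ℤ × ℤ) × (ℤ × ℤ × ℤ))) (A B : ℤ × ℤ × ℤ),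
      (∀ s ∈ S, s.1 - A ∈ box3 K ∧ s.2 - B ∈ box3 K) →
      (∀ s ∈ S, ∀ s' ∈ S, |phi a b c s.1 s.2 - phi a b c s'.1 s'.2| ≤ 1) →
      (S.card : ℝ) ≤ C * K ^ 4 := by
  classical
  obtain ⟨C, hC, hE⟩ := E_card a b c ha hb hc
  refine ⟨C * 16, by positivity, ?_⟩
  intro K hK S A B hbox hdiff
  obtain ⟨q0, hq0⟩ : ∃ q0 : ℤ × ℤ × ℤ → ℤ × ℤ × ℤ, ∀ p q, (p, q) ∈ S → (p, q0 p) ∈ S := by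
    refine ⟨fun p => if h : ∃ q, (p, q) ∈ S then h.choose else 0, ?_⟩
    intro p q h
    have h' : ∃ q, (p, q) ∈ S := ⟨q, h⟩
    simp only [h', dif_pos]
    exact h'.choose_spec
  let S1 := S.image (fun s => (s.1, s.2 - q0 s.1))
  have hS1c : S1.card = S.card := by
    apply Finset.card_image_of_injOn
    rintro ⟨p, q⟩ _ ⟨p', q'⟩ _ h
    simp only [Prod.mk.injEq] at h
    obtain ⟨rfl, h⟩ := h
    simpa using h
  have hS1 : ∀ s ∈ S1, s.1 - A ∈ box3 K ∧ s.2 ∈ box3 (2 * K) ∧ |phi a b c s.1 s.2| ≤ 1 := by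
    intro s hs
    obtain ⟨⟨p, q⟩, hpq, rfl⟩ := mem_image.1 hs
    have h0 := hq0 p q hpq
    have hb1 := hbox (p, q) hpq
    have hb2 := hbox (p, q0 p) h0
    have hb3 := hdiff (p, q) hpq (p, q0 p) h0
    refine ⟨hb1.1, box3_sub hb1.2 hb2.2, ?_⟩
    simp only [phi_sub_right]
    exact hb3
  obtain ⟨p0, hp0⟩ : ∃ p0 : ℤ × ℤ × ℤ → ℤ × ℤ × ℤ, ∀ p q, (p, q) ∈ S1 → (p0 q, q) ∈ S1 := by
    refine ⟨fun q => if h : ∃ p, (p, q) ∈ S1 then h.choose else 0, ?_⟩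
    intro p q h
    have h' : ∃ p, (p, q) ∈ S1 := ⟨p, h⟩
    simp only [h', dif_pos]
    exact h'.choose_spec
  let S2 := S1.image (fun s => (s.1 - p0 s.2, s.2))
  have hS2c : S2.card = S1.card := by
    apply Finset.card_image_of_injOn
    rintro ⟨p, q⟩ _ ⟨p', q'⟩ _ h
    simp only [Prod.mk.injEq] at h
    obtain ⟨h, rfl⟩ := h
    simpa using h
  have hS2 : S2 ⊆ Eset a b c (2 * K) := by
    intro s hs
    obtain ⟨⟨p, q⟩, hpq, rfl⟩ := mem_image.1 hs
    have h0 := hp0 p q hpq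
    obtain ⟨h1, h2, h3⟩ := hS1 _ hpq
    obtain ⟨h4, h5, h6⟩ := hS1 _ h0
    simp only [Eset, mem_filter, mem_product]
    refine ⟨⟨box3_sub h1 h4, h2⟩, ?_⟩
    change |phi a b c (p - p0 q) q| ≤ 2
    rw [phi_sub_left]
    calc _ ≤ |phi a b c p q| + |phi a b c (p0 q) q| := abs_sub _ _
      _ ≤ 2 := by simp only at h3 h6; linarith
  have h7 := hE (2 * K) (by omega)
  have h8 : (S.card : ℝ) ≤ (Eset a b c (2 * K)).card := by
    rw [← hS1c, ← hS2c]; exact_mod_cast card_le_card hS2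
  refine h8.trans (h7.trans (le_of_eq ?_))
  push_cast; ring

lemma d_box (e : ℕ) (β : Fin (e + 3) → ℝ) (hβ : ∀ j, 0 < β j) : ∃ C : ℝ, 0 ≤ C ∧
    ∀ K : ℕ, 1 ≤ K → ∀ (S : Finset ((Fin (e + 3) → ℤ) × (Fin (e + 3) → ℤ))) (A B : Fin (e + 3) → ℤ),
      (∀ s ∈ S, ∀ j, |s.1 j - A j| ≤ K ∧ |s.2 j - B j| ≤ K) →
      (∀ s ∈ S, ∀ s' ∈ S, |winner β (fun j => (s.1 j : ℝ)) (fun j => (s.2 j : ℝ)) -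
        winner β (fun j => (s'.1 j : ℝ)) (fun j => (s'.2 j : ℝ))| ≤ 1) →
      (S.card : ℝ) ≤ C * K ^ (2 * e + 4) := by
  classical
  obtain ⟨C, hC, h3⟩ := three_box (β 0) (β 1) (β 2) (hβ _) (hβ _) (hβ _)
  refine ⟨C * 9 ^ e, by positivity, ?_⟩
  intro K hK S A B hbox hdiff
  let tl : (Fin (e + 3) → ℤ) → (Fin e → ℤ) := fun P j => P j.succ.succ.succ
  let hd : (Fin (e + 3) → ℤ) → ℤ × ℤ × ℤ := fun P => (P 0, P 1, P 2)
  have hext : ∀ P P' : Fin (e + 3) → ℤ, tl P = tl P' → hd P = hd P' → P = P' := by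
    intro P P' h1 h2
    simp only [hd, Prod.mk.injEq] at h2
    funext j
    refine Fin.cases h2.1 (fun j => ?_) j
    refine Fin.cases h2.2.1 (fun j => ?_) j
    refine Fin.cases h2.2.2 (fun j => ?_) j
    exact congrFun h1 j
  let T : (Fin (e + 3) → ℤ) × (Fin (e + 3) → ℤ) → (Fin e → ℤ) × (Fin e → ℤ) :=
    fun s => (tl s.1, tl s.2)
  have himg : (S.image T).card ≤ (2 * K + 1) ^ e * (2 * K + 1) ^ e := by
    let bx : (Fin (e + 3) → ℤ) → Finset (Fin e → ℤ) := fun A =>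
      Fintype.piFinset (fun j => Finset.Icc (tl A j - K) (tl A j + K))
    have hbx : ∀ A, (bx A).card = (2 * K + 1) ^ e := by
      intro A
      simp only [bx, Fintype.card_piFinset, Int.card_Icc]
      rw [Finset.prod_congr rfl (g := fun _ => 2 * K + 1)]
      · simp
      · intro j _; omega
    have : (bx A ×ˢ bx B).card = (2 * K + 1) ^ e * (2 * K + 1) ^ e := by
      rw [card_product, hbx, hbx]
    rw [← this]
    apply card_le_card
    intro t ht
    obtain ⟨s, hs, rfl⟩ := mem_image.1 ht
    simp only [bx, mem_product, Fintype.mem_piFinset, mem_Icc, T, tl]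
    constructor
    · intro j
      have := abs_le.1 (hbox s hs j.succ.succ.succ).1
      omega
    · intro j
      have := abs_le.1 (hbox s hs j.succ.succ.succ).2
      omega
  have hfib : ∀ t ∈ S.image T, (((S.filter (fun s => T s = t)).card : ℕ) : ℝ) ≤ C * K ^ 4 := by
    intro t _
    set F := S.filter (fun s => T s = t) with hF
    have hinj : Set.InjOn (fun s : (Fin (e + 3) → ℤ) × (Fin (e + 3) → ℤ) => (hd s.1, hd s.2)) F := by
      intro s hs s' hs' h
      have hs := (mem_filter.1 (Finset.mem_coe.1 hs)).2
      have hs' := (mem_filter.1 (Finset.mem_coe.1 hs')).2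
      rw [← hs'] at hs
      simp only [T, Prod.mk.injEq] at hs h
      exact Prod.ext (hext _ _ hs.1 h.1) (hext _ _ hs.2 h.2)
    rw [← Finset.card_image_of_injOn hinj]
    apply h3 K hK _ (hd A) (hd B)
    · intro s hs
      obtain ⟨r, hr, rfl⟩ := mem_image.1 hs
      have hr' := hbox r (mem_filter.1 hr).1
      simp only [mem_box3, hd, Prod.fst_sub, Prod.snd_sub]
      exact ⟨⟨(hr' 0).1, (hr' 1).1, (hr' 2).1⟩, (hr' 0).2, (hr' 1).2, (hr' 2).2⟩
    · intro s hs s' hs'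
      obtain ⟨r, hr, rfl⟩ := mem_image.1 hs
      obtain ⟨r', hr', rfl⟩ := mem_image.1 hs'
      rw [mem_filter] at hr hr'
      have h := hdiff r hr.1 r' hr'.1
      have ht : T r = T r' := by rw [hr.2, hr'.2]
      simp only [T, Prod.mk.injEq] at ht
      have hw : ∀ r : (Fin (e + 3) → ℤ) × (Fin (e + 3) → ℤ),
          winner β (fun j => (r.1 j : ℝ)) (fun j => (r.2 j : ℝ)) =
          phi (β 0) (β 1) (β 2) (hd r.1) (hd r.2) +
          ∑ j : Fin e, β j.succ.succ.succ * (tl r.1 j) * (tl r.2 j) := by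
        intro r
        simp only [winner, phi, Fin.sum_univ_succ, hd, tl]
        push_cast
        simp only [Fin.succ_zero_eq_one, Fin.succ_one_eq_two]
        ring
      rw [hw r, hw r', ht.1, ht.2] at h
      simpa using h
  have hKR : (1:ℝ) ≤ K := by exact_mod_cast hK
  rw [Finset.card_eq_sum_card_image T S]; push_cast
  calc _ ≤ ∑ t ∈ S.image T, C * (K:ℝ) ^ 4 := Finset.sum_le_sum hfib
    _ = (S.image T).card * (C * (K:ℝ) ^ 4) := by rw [Finset.sum_const, nsmul_eq_mul]
    _ ≤ ((2 * K + 1) ^ e * (2 * K + 1) ^ e) * (C * (K:ℝ) ^ 4) := by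
      gcongr; exact_mod_cast himg
    _ ≤ ((3 * K) ^ e * (3 * K) ^ e) * (C * (K:ℝ) ^ 4) := by gcongr <;> linarith
    _ = _ := by
      rw [mul_pow, show (9:ℝ) = 3 * 3 by norm_num, mul_pow, pow_add, two_mul, pow_add]; ring

lemma d_count (d : ℕ) (hd : 3 ≤ d) (β : Fin d → ℝ) (hβ : ∀ j, 0 < β j) : ∃ C : ℝ, 0 ≤ C ∧
    ∀ K : ℕ, 1 ≤ K → ∀ δ : ℝ, 0 < δ → δ ≤ 1 → ∀ Γ : ℝ,
      ∀ (S : Finset ((Fin d → ℤ) × (Fin d → ℤ))) (A B : Fin d → ℤ),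
      (∀ s ∈ S, ∀ j, |s.1 j - A j| ≤ K ∧ |s.2 j - B j| ≤ K) →
      (∀ s ∈ S, |winner β (fun j => (s.1 j : ℝ)) (fun j => (s.2 j : ℝ)) - Γ| ≤ δ⁻¹ / 2) →
      (S.card : ℝ) ≤ C * δ⁻¹ * K ^ (2 * d - 2) := by
  classical
  obtain ⟨e, rfl⟩ : ∃ e, d = e + 3 := ⟨d - 3, by omega⟩
  obtain ⟨C, hC, hbx⟩ := d_box e β hβ
  refine ⟨3 * C, by positivity, ?_⟩
  intro K hK δ hδ hδ1 Γ S A B hbox hw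
  let f : (Fin (e + 3) → ℤ) × (Fin (e + 3) → ℤ) → ℤ := fun s =>
    ⌊winner β (fun j => (s.1 j : ℝ)) (fun j => (s.2 j : ℝ))⌋
  have hδi : 1 ≤ δ⁻¹ := (one_le_inv₀ hδ).2 hδ1
  have himg : ((S.image f).card : ℝ) ≤ 3 * δ⁻¹ := by
    have h1 : S.image f ⊆ Finset.Icc ⌊Γ - δ⁻¹ / 2⌋ ⌊Γ + δ⁻¹ / 2⌋ := by
      intro t ht
      obtain ⟨s, hs, rfl⟩ := mem_image.1 ht
      have := abs_le.1 (hw s hs)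
      rw [mem_Icc]
      exact ⟨Int.floor_le_floor (by linarith), Int.floor_le_floor (by linarith)⟩
    have h2 := card_le_card h1
    rw [Int.card_Icc] at h2
    have h3 : ⌊Γ - δ⁻¹ / 2⌋ ≤ ⌊Γ + δ⁻¹ / 2⌋ := Int.floor_le_floor (by linarith)
    have h4 : ((S.image f).card : ℤ) ≤ ⌊Γ + δ⁻¹ / 2⌋ + 1 - ⌊Γ - δ⁻¹ / 2⌋ := by omega
    have h5 : ((S.image f).card : ℝ) ≤ ⌊Γ + δ⁻¹ / 2⌋ + 1 - ⌊Γ - δ⁻¹ / 2⌋ := by exact_mod_cast h4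
    have h6 := Int.floor_le (Γ + δ⁻¹ / 2)
    have h7 := Int.lt_floor_add_one (Γ - δ⁻¹ / 2)
    linarith
  have hfib : ∀ t ∈ S.image f, (((S.filter (fun s => f s = t)).card : ℕ) : ℝ) ≤ C * K ^ (2 * e + 4) := by
    intro t _
    apply hbx K hK _ A B
    · intro s hs; exact hbox s (mem_filter.1 hs).1
    · intro s hs s' hs'
      have h1 := (mem_filter.1 hs).2
      have h2 := (mem_filter.1 hs').2
      rw [← h2] at h1
      exact (Int.abs_sub_lt_one_of_floor_eq_floor h1).le
  rw [Finset.card_eq_sum_card_image f S]; push_cast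
  calc _ ≤ ∑ t ∈ S.image f, C * (K:ℝ) ^ (2 * e + 4) := Finset.sum_le_sum hfib
    _ = (S.image f).card * (C * (K:ℝ) ^ (2 * e + 4)) := by rw [Finset.sum_const, nsmul_eq_mul]
    _ ≤ (3 * δ⁻¹) * (C * (K:ℝ) ^ (2 * e + 4)) := by gcongr
    _ = _ := by
      rw [show 2 * (e + 3) - 2 = 2 * e + 4 by omega]; ring

end helpers

lemma sign_split (ζ : Fin 3 → ℝ) (h1 : ∀ j, ζ j = 1 ∨ ζ j = -1) (h2 : ¬ (∀ j j', ζ j = ζ j')) :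
    ∃ (ε : ℝ) (o i i' : Fin 3), (ε = 1 ∨ ε = -1) ∧ (∀ j, j = o ∨ j = i ∨ j = i') ∧
      ∀ f : Fin 3 → ℝ, ∑ j, ζ j * f j = ε * (f i + f i' - f o) := by
  rcases h1 0 with a | a <;> rcases h1 1 with b | b <;> rcases h1 2 with c | c
  · exact absurd (fun j j' => by fin_cases j <;> fin_cases j' <;> simp [a, b, c]) h2
  · exact ⟨1, 2, 0, 1, Or.inl rfl, by decide, fun f => by rw [Fin.sum_univ_three, a, b, c]; ring⟩
  · exact ⟨1, 1, 0, 2, Or.inl rfl, by decide, fun f => by rw [Fin.sum_univ_three, a, b, c]; ring⟩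
  · exact ⟨-1, 0, 1, 2, Or.inr rfl, by decide, fun f => by rw [Fin.sum_univ_three, a, b, c]; ring⟩
  · exact ⟨1, 0, 1, 2, Or.inl rfl, by decide, fun f => by rw [Fin.sum_univ_three, a, b, c]; ring⟩
  · exact ⟨-1, 1, 0, 2, Or.inr rfl, by decide, fun f => by rw [Fin.sum_univ_three, a, b, c]; ring⟩
  · exact ⟨-1, 2, 0, 1, Or.inr rfl, by decide, fun f => by rw [Fin.sum_univ_three, a, b, c]; ring⟩
  · exact absurd (fun j j' => by fin_cases j <;> fin_cases j' <;> simp [a, b, c]) h2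

lemma abs_le_euclNorm {d : ℕ} (x : Fin d → ℝ) (j : Fin d) : |x j| ≤ euclNorm x := by
  unfold euclNorm
  rw [← Real.sqrt_sq_eq_abs]
  apply Real.sqrt_le_sqrt
  exact Finset.single_le_sum (f := fun j => x j ^ 2) (fun i _ => sq_nonneg _) (Finset.mem_univ j)

lemma int_box (L : ℝ) (hL : 0 < L) (x a : ℝ) (m n k : ℤ) (hx : x = m / L) (ha : a = n / L)
    (h : |x - a| ≤ 1) : |(m - k) - (n - k)| ≤ ((⌊L⌋₊ : ℕ) : ℤ) := by
  have e : (((m - k) - (n - k) : ℤ) : ℝ) = L * (x - a) := by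
    rw [hx, ha]; push_cast; field_simp; ring
  rw [Int.natCast_floor_eq_floor hL.le, Int.le_floor]
  push_cast at e ⊢
  rw [e, abs_mul, abs_of_pos hL]
  nlinarith

lemma main_aux (d : ℕ) (hd : 3 ≤ d) (β : Fin d → ℝ) (hβ : ∀ j, 0 < β j) :
    ∃ C : ℝ, ∀ L δ : ℝ, 2 ≤ L → 0 < δ → δ ≤ 1 →
      ∀ ζ : Fin 3 → ℝ, (∀ j, ζ j = 1 ∨ ζ j = -1) → ¬ (∀ j j', ζ j = ζ j') →
      ∀ a : Fin 3 → Fin d → ℝ, (∀ j, isLatticeVec d L (a j)) →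
      ∀ k : Fin d → ℝ, isLatticeVec d L k → ∀ γ : ℝ,
        (threeVecSet d β L δ ζ a k γ).Finite ∧
        ((threeVecSet d β L δ ζ a k γ).ncard : ℝ) ≤
          C * δ⁻¹ * L ^ (2 * (d : ℝ) - 2) := by
  classical
  obtain ⟨C, hC, hcount⟩ := d_count d hd β hβ
  refine ⟨C, ?_⟩
  intro L δ hL hδ hδ1 ζ hζ hζ' a ha k hk γ
  obtain ⟨ε, o, i, i', hε, hcov, hsum⟩ := sign_split ζ hζ hζ'
  have hL0 : 0 < L := by linarith
  have hε2 : ε * ε = 1 := by rcases hε with h | h <;> rw [h] <;> norm_num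
  obtain ⟨κ, hκ⟩ : ∃ κ : Fin d → ℤ, ∀ j, ε * k j = κ j / L := by
    choose m hm using hk
    rcases hε with h | h
    · exact ⟨m, fun j => by rw [h, hm]; ring⟩
    · exact ⟨fun j => - m j, fun j => by rw [h, hm]; push_cast; ring⟩
  choose n hn using ha
  set K : ℕ := ⌊L⌋₊ with hK
  have hK1 : 1 ≤ K := Nat.le_floor (by norm_num; linarith)
  have hKL : (K:ℝ) ≤ L := Nat.floor_le hL0.le
  let A : Fin d → ℤ := fun j => n i j - κ j
  let B : Fin d → ℤ := fun j => n i' j - κ j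
  let Γ : ℝ := (wnormSq β (fun j => ε * k j) - ε * γ) * L ^ 2 / 2
  let bx : (Fin d → ℤ) → Finset (Fin d → ℤ) := fun A =>
    Fintype.piFinset (fun j => Finset.Icc (A j - K) (A j + K))
  let S : Finset ((Fin d → ℤ) × (Fin d → ℤ)) := (bx A ×ˢ bx B).filter
    (fun s => |winner β (fun j => (s.1 j : ℝ)) (fun j => (s.2 j : ℝ)) - Γ| ≤ δ⁻¹ / 2)
  let Φ : (Fin 3 → Fin d → ℝ) → (Fin d → ℤ) × (Fin d → ℤ) := fun x =>
    (fun j => round (L * x i j) - κ j, fun j => round (L * x i' j) - κ j)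
  have hround : ∀ x : Fin d → ℝ, isLatticeVec d L x → ∀ j, x j = (round (L * x j) : ℤ) / L := by
    intro x hx j
    obtain ⟨m, hm⟩ := hx j
    have : L * x j = m := by rw [hm]; field_simp
    rw [this, round_intCast, hm]
  have hxo : ∀ x ∈ threeVecSet d β L δ ζ a k γ, ∀ j, x o j = x i j + x i' j - ε * k j := by
    rintro x ⟨_, _, hx, _, _⟩ j
    have := hx j
    rw [hsum (fun l => x l j)] at this
    rw [← this, ← mul_assoc, hε2]; ring
  have hmaps : ∀ x ∈ threeVecSet d β L δ ζ a k γ, Φ x ∈ (S : Set _) := by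
    intro x hx
    have hxo' := hxo x hx
    obtain ⟨hlat, hball, hx3, hq, _⟩ := hx
    apply Finset.mem_coe.2
    have hpt : ∀ l j, |x l j - a l j| ≤ 1 := fun l j =>
      (abs_le_euclNorm (x l - a l) j).trans (hball l)
    simp only [S, Finset.mem_filter, Finset.mem_product, bx, Fintype.mem_piFinset, Finset.mem_Icc, Φ]
    refine ⟨⟨fun j => ?_, fun j => ?_⟩, ?_⟩
    · have := abs_le.1 (int_box L hL0 (x i j) (a i j) _ _ (κ j) (hround _ (hlat i) j) (hn i j) (hpt i j))
      simp only [A]; omega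
    · have := abs_le.1 (int_box L hL0 (x i' j) (a i' j) _ _ (κ j) (hround _ (hlat i') j) (hn i' j) (hpt i' j))
      simp only [B]; omega
    · rw [hsum (fun l => wnormSq β (x l))] at hq
      set w := winner β (fun j => ((round (L * x i j) - κ j : ℤ) : ℝ))
        (fun j => ((round (L * x i' j) - κ j : ℤ) : ℝ)) with hw
      have hid : wnormSq β (x i) + wnormSq β (x i') - wnormSq β (x o) =
          wnormSq β (fun j => ε * k j) - 2 * (w / L ^ 2) := by
        rw [hw]
        simp only [wnormSq, winner]
        rw [Finset.sum_div, Finset.mul_sum, ← Finset.sum_add_distrib, ← Finset.sum_sub_distrib,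
          ← Finset.sum_sub_distrib]
        apply Finset.sum_congr rfl
        intro j _
        have e1 : ((round (L * x i j) - κ j : ℤ) : ℝ) = L * (x i j - ε * k j) := by
          have := hround _ (hlat i) j
          rw [eq_div_iff hL0.ne'] at this
          have h2 := hκ j
          rw [eq_div_iff hL0.ne'] at h2
          push_cast; rw [← this, ← h2]; ring
        have e2 : ((round (L * x i' j) - κ j : ℤ) : ℝ) = L * (x i' j - ε * k j) := by
          have := hround _ (hlat i') j
          rw [eq_div_iff hL0.ne'] at this
          have h2 := hκ j
          rw [eq_div_iff hL0.ne'] at h2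
          push_cast; rw [← this, ← h2]; ring
        rw [e1, e2, hxo' j]
        field_simp
        ring
      rw [hid] at hq
      have e3 : w - Γ = - (L ^ 2 / 2) * (ε * (ε * (wnormSq β (fun j => ε * k j) - 2 * (w / L ^ 2)) - γ)) := by
        have : ε * (ε * (wnormSq β (fun j => ε * k j) - 2 * (w / L ^ 2)) - γ) =
          (wnormSq β (fun j => ε * k j) - 2 * (w / L ^ 2)) - ε * γ := by
          rw [mul_sub, ← mul_assoc, hε2]; ring
        rw [this]
        simp only [Γ]
        field_simp
        ring
      rw [e3, abs_mul, abs_mul]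
      have hε1 : |ε| = 1 := by rcases hε with h | h <;> rw [h] <;> norm_num
      rw [hε1, one_mul, abs_neg, abs_of_pos (by positivity)]
      calc _ ≤ L ^ 2 / 2 * (δ⁻¹ * (L ^ 2)⁻¹) := by gcongr
        _ = _ := by field_simp
  have hinj : Set.InjOn Φ (threeVecSet d β L δ ζ a k γ) := by
    intro x hx y hy h
    have hi : ∀ j, x i j = y i j := by
      intro j
      have h1 := congrFun (congrArg Prod.fst h) j
      simp only [Φ, sub_left_inj] at h1
      rw [hround _ (hx.1 i) j, hround _ (hy.1 i) j, h1]
    have hi' : ∀ j, x i' j = y i' j := by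
      intro j
      have h1 := congrFun (congrArg Prod.snd h) j
      simp only [Φ, sub_left_inj] at h1
      rw [hround _ (hx.1 i') j, hround _ (hy.1 i') j, h1]
    funext l j
    rcases hcov l with rfl | rfl | rfl
    · rw [hxo x hx, hxo y hy, hi, hi']
    · exact hi j
    · exact hi' j
  constructor
  · exact Set.Finite.of_injOn hmaps hinj S.finite_toSet
  have hle := Set.ncard_le_ncard_of_injOn Φ hmaps hinj S.finite_toSet
  rw [Set.ncard_coe_finset] at hle
  have hS := hcount K hK1 δ hδ hδ1 Γ S A B (by
      intro s hs j
      simp only [S, Finset.mem_filter, Finset.mem_product, bx, Fintype.mem_piFinset, Finset.mem_Icc] at hs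
      have h1 := hs.1.1 j
      have h2 := hs.1.2 j
      rw [abs_le, abs_le]
      omega) (by
      intro s hs
      exact (Finset.mem_filter.1 hs).2)
  have hle' : ((threeVecSet d β L δ ζ a k γ).ncard : ℝ) ≤ S.card := by exact_mod_cast hle
  refine hle'.trans (hS.trans ?_)
  have e : L ^ (2 * (d : ℝ) - 2) = L ^ (2 * d - 2 : ℕ) := by
    rw [← Real.rpow_natCast, Nat.cast_sub (by omega)]; push_cast; rfl
  rw [e]
  have : (K:ℝ) ^ (2 * d - 2) ≤ L ^ (2 * d - 2) := pow_le_pow_left₀ (by positivity) hKL _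
  have hδ' : 0 ≤ δ⁻¹ := by positivity
  gcongr

/-- Lemma A.7 (2) of Deng–Hani (three-vector counting): let `d ≥ 3` and let `β ∈ (ℝ⁺)^d`
satisfy the Diophantine condition (G1) with constant `c > 0` and the triple-counting bound
(G2) with constant `C₀`.  Then there is `C = C(d, β, c, C₀)` such that for all `L ≥ 2`,
`δ ∈ (0,1]`, signs `ζ₁, ζ₂, ζ₃ ∈ {±1}` not all equal, lattice points `a₁, a₂, a₃, k` and
`γ ∈ ℝ`, the number of triples `(x₁, x₂, x₃) ∈ (Z_L^d)³` with `|x_j - a_j| ≤ 1`,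
`ζ₁x₁ + ζ₂x₂ + ζ₃x₃ = k`, `|ζ₁|x₁|_β² + ζ₂|x₂|_β² + ζ₃|x₃|_β² - γ| ≤ δ⁻¹L⁻²` and
`x_j ≠ x_{j'}` whenever `ζ_j + ζ_{j'} = 0`, is at most `C δ⁻¹ L^{2d-2}`. -/
theorem three_vector_counting (d : ℕ) (hd : 3 ≤ d) (β : Fin d → ℝ) (hβ : ∀ j, 0 < β j)
    (c : ℝ) (hc : 0 < c)
    (hG1 : ∀ K₁ K₂ : ℤ, (K₁, K₂) ≠ (0, 0) →
      c * (1 + |(K₁ : ℝ)| + |(K₂ : ℝ)|)⁻¹ *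
          ((Real.log (2 + |(K₁ : ℝ)| + |(K₂ : ℝ)|)) ^ 4)⁻¹ ≤
        |β ⟨0, by omega⟩ * (K₁ : ℝ) + β ⟨1, by omega⟩ * (K₂ : ℝ)|)
    (C₀ : ℝ)
    (hG2 : ∀ R : ℝ, 1 ≤ R →
      ((latticeTriples d β R).ncard : ℝ) ≤ C₀ * R ^ (3 * (d : ℝ) - 4 + 1 / 6)) :
    ∃ C : ℝ, ∀ L δ : ℝ, 2 ≤ L → 0 < δ → δ ≤ 1 →
      ∀ ζ : Fin 3 → ℝ, (∀ j, ζ j = 1 ∨ ζ j = -1) → ¬ (∀ j j', ζ j = ζ j') →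
      ∀ a : Fin 3 → Fin d → ℝ, (∀ j, isLatticeVec d L (a j)) →
      ∀ k : Fin d → ℝ, isLatticeVec d L k → ∀ γ : ℝ,
        (threeVecSet d β L δ ζ a k γ).Finite ∧
        ((threeVecSet d β L δ ζ a k γ).ncard : ℝ) ≤
          C * δ⁻¹ * L ^ (2 * (d : ℝ) - 2) := by
  exact main_aux d hd β hβ

end WKE
end
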